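/- Let Γ be any infinite countable discrete group and let R ⊆ R(Γ ↷ [0,1]^Γ) be any countable pmp subequivalence relation of the orbit equivalence relation of the Bernoulli shift Γ ↷ ([0,1]^Γ, Leb^Γ). Then there exists a Borel partition {X_n : n ∈ ℕ} of [0,1]^Γ into R-invariant subsets such that R|X_0 is hyperfinite and, for every n ≥ 1 with X_n non-null, R|X_n is strongly ergodic. -/

import Mathlib

open MeasureTheory Set Filter

noncomputable section

variable {X : Type*} [MeasurableSpace X]

/-- `R ⊆ X × X` is an equivalence relation. -/
def IsEquivRelSet (R : Set (X × X)) : Prop :=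
  (∀ x, (x, x) ∈ R) ∧ (∀ x y, (x, y) ∈ R → (y, x) ∈ R) ∧
    (∀ x y z, (x, y) ∈ R → (y, z) ∈ R → (x, z) ∈ R)

/-- `R ⊆ Y × Y` is an equivalence relation on the subset `Y`. -/
def IsEquivRelOn (R : Set (X × X)) (Y : Set X) : Prop :=
  R ⊆ Y ×ˢ Y ∧ (∀ x ∈ Y, (x, x) ∈ R) ∧ (∀ x y, (x, y) ∈ R → (y, x) ∈ R) ∧
    (∀ x y z, (x, y) ∈ R → (y, z) ∈ R → (x, z) ∈ R)

/-- `R` is a countable pmp equivalence relation on `(X, μ)`: a Borel equivalence relation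
with countable classes such that every Borel automorphism of `X` whose graph is contained
in `R` preserves `μ`. -/
def IsCountablePmpRel (μ : Measure X) (R : Set (X × X)) : Prop :=
  IsEquivRelSet R ∧ MeasurableSet R ∧ (∀ x, {y | (x, y) ∈ R}.Countable) ∧
    ∀ φ : X ≃ X, Measurable ⇑φ → Measurable ⇑φ.symm → (∀ x, (x, φ x) ∈ R) →
      MeasurePreserving ⇑φ μ μ

/-- The restriction `R|A` is hyperfinite: away from a null subset of `A`, it is the union of
an increasing sequence of Borel equivalence relations with finite classes. -/
def HyperfiniteOn (μ : Measure X) (R : Set (X × X)) (A : Set X) : Prop :=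
  ∃ Y : Set X, MeasurableSet Y ∧ Y ⊆ A ∧ μ (A \ Y) = 0 ∧
    ∃ Rn : ℕ → Set (X × X), Monotone Rn ∧
      (∀ n, MeasurableSet (Rn n) ∧ IsEquivRelOn (Rn n) Y ∧
        ∀ x, {y | (x, y) ∈ Rn n}.Finite) ∧
      R ∩ Y ×ˢ Y = ⋃ n, Rn n

/-- The restriction `R|A` is strongly ergodic (with respect to the normalized restricted
measure): every sequence of measurable subsets of `A` that is asymptotically invariant under
every element of the full group of `R|A` is asymptotically trivial. -/
def StronglyErgodicOnRel (μ : Measure X) (R : Set (X × X)) (A : Set X) : Prop :=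
  ∀ B : ℕ → Set X, (∀ n, MeasurableSet (B n) ∧ B n ⊆ A) →
    (∀ φ : X ≃ X, Measurable ⇑φ → Measurable ⇑φ.symm →
      (∀ x ∈ A, (x, φ x) ∈ R ∧ φ x ∈ A) → (∀ x ∉ A, φ x = x) →
      Tendsto (fun n => μ (symmDiff (B n) (⇑φ '' B n))) atTop (nhds 0)) →
    Tendsto (fun n => μ (B n) * (μ A - μ (B n))) atTop (nhds 0)

/-- The restriction `R|A` is ergodic. -/
def ErgodicOnRel (μ : Measure X) (R : Set (X × X)) (A : Set X) : Prop :=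
  ∀ B : Set X, MeasurableSet B → B ⊆ A →
    (∀ x y, x ∈ A → y ∈ A → (x, y) ∈ R → (x ∈ B ↔ y ∈ B)) →
    μ B = 0 ∨ μ (A \ B) = 0

/-- The Bernoulli shift `Γ ↷ [0,1]^Γ`, `(g · x) h = x (g⁻¹ h)`. -/
def bernoulliShift {Γ : Type*} [Group Γ] (g : Γ) (x : Γ → ℝ) : Γ → ℝ :=
  fun h => x (g⁻¹ * h)

/-- `μ` is the Bernoulli product measure `Leb^Γ` on `[0,1]^Γ` (realized on `Γ → ℝ` as the
product of copies of Lebesgue measure restricted to `[0,1]`). -/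
def IsBernoulliLebProduct {Γ : Type*} (μ : Measure (Γ → ℝ)) : Prop :=
  IsProbabilityMeasure μ ∧
    ∀ (s : Finset Γ) (t : Γ → Set ℝ), (∀ i, MeasurableSet (t i)) →
      μ {x | ∀ i ∈ s, x i ∈ t i} = ∏ i ∈ s, volume (t i ∩ Icc (0:ℝ) 1)

/-- Coefficients of the biased Walsh functions against the biased product weights. -/
def noiseCoeff {I : Type*} [DecidableEq I] (τ : ℝ) (J U z : Finset I) : ℝ :=
  ∏ j ∈ J, if j ∈ U then (if j ∈ z then √(τ * (1 - τ)) else -√(τ * (1 - τ)))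
    else (if j ∈ z then τ else 1 - τ)

/-- The biased Walsh transform over the coordinates in `J`. -/
def walshNoise {I : Type*} [DecidableEq I] (τ : ℝ) (J U : Finset I) (F : Finset I → ℝ) : ℝ :=
  ∑ z ∈ J.powerset, noiseCoeff τ J U z * F z

section
variable {I : Type*} [DecidableEq I] {τ : ℝ}

lemma noiseCoeff_insert {j : I} {J : Finset I} (hj : j ∉ J) (U z : Finset I) :
    noiseCoeff τ (insert j J) U z =
      (if j ∈ U then (if j ∈ z then √(τ * (1 - τ)) else -√(τ * (1 - τ)))
        else (if j ∈ z then τ else 1 - τ)) * noiseCoeff τ J U z := by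
  simp only [noiseCoeff]; rw [Finset.prod_insert hj]

lemma noiseCoeff_congr {J U z U' z' : Finset I} (h : ∀ j ∈ J, (j ∈ U ↔ j ∈ U'))
    (h' : ∀ j ∈ J, (j ∈ z ↔ j ∈ z')) : noiseCoeff τ J U z = noiseCoeff τ J U' z' :=
  Finset.prod_congr rfl fun j hj => by simp only [h j hj, h' j hj]

lemma noiseCoeff_empty_nonneg (h0 : 0 ≤ τ) (h1 : τ ≤ 1) (J z : Finset I) :
    0 ≤ noiseCoeff τ J ∅ z :=
  Finset.prod_nonneg fun j _ => by
    simp only [Finset.notMem_empty, if_false]; split_ifs <;> linarith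

lemma walshNoise_insert_of_notMem {j : I} {J U : Finset I} (hj : j ∉ J) (hU : j ∉ U)
    (F : Finset I → ℝ) :
    walshNoise τ (insert j J) U F =
      (1 - τ) * walshNoise τ J U F + τ * walshNoise τ J U (fun z => F (insert j z)) := by
  simp only [walshNoise]
  rw [Finset.sum_powerset_insert hj, Finset.mul_sum, Finset.mul_sum]
  congr 1
  · refine Finset.sum_congr rfl fun z hz => ?_
    have hjz : j ∉ z := fun h => hj (Finset.mem_powerset.1 hz h)
    rw [noiseCoeff_insert hj, if_neg hU, if_neg hjz, mul_assoc]
  · refine Finset.sum_congr rfl fun z hz => ?_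
    rw [noiseCoeff_insert hj, if_neg hU, if_pos (Finset.mem_insert_self _ _), mul_assoc,
      noiseCoeff_congr (U' := U) (z' := z) (fun _ _ => Iff.rfl) fun i hi => ?_]
    have : i ≠ j := fun h => hj (h ▸ hi)
    simp [this]

lemma walshNoise_insert_insert {j : I} {J : Finset I} (hj : j ∉ J) (U : Finset I)
    (F : Finset I → ℝ) :
    walshNoise τ (insert j J) (insert j U) F =
      √(τ * (1 - τ)) * (walshNoise τ J U (fun z => F (insert j z)) - walshNoise τ J U F) := by
  simp only [walshNoise]
  rw [Finset.sum_powerset_insert hj, mul_sub, Finset.mul_sum, Finset.mul_sum, sub_eq_neg_add,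
    ← Finset.sum_neg_distrib]
  congr 1
  · refine Finset.sum_congr rfl fun z hz => ?_
    have hjz : j ∉ z := fun h => hj (Finset.mem_powerset.1 hz h)
    rw [noiseCoeff_insert hj, if_pos (Finset.mem_insert_self _ _), if_neg hjz,
      noiseCoeff_congr (U' := U) (z' := z) (fun i hi => ?_) fun _ _ => Iff.rfl]
    · ring
    · have : i ≠ j := fun h => hj (h ▸ hi)
      simp [this]
  · refine Finset.sum_congr rfl fun z hz => ?_
    rw [noiseCoeff_insert hj, if_pos (Finset.mem_insert_self _ _),
      if_pos (Finset.mem_insert_self _ _),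
      noiseCoeff_congr (U' := U) (z' := z) (fun i hi => ?_) fun i hi => ?_]
    · ring
    · have : i ≠ j := fun h => hj (h ▸ hi)
      simp [this]
    · have : i ≠ j := fun h => hj (h ▸ hi)
      simp [this]

lemma walshNoise_sub (J U : Finset I) (F F' : Finset I → ℝ) :
    walshNoise τ J U (fun z => F z - F' z) = walshNoise τ J U F - walshNoise τ J U F' := by
  simp only [walshNoise, mul_sub, Finset.sum_sub_distrib]

/-- Parseval's identity for the biased Walsh transform. -/
lemma sum_walshNoise_sq (h0 : 0 ≤ τ) (h1 : τ ≤ 1) (J : Finset I) (F : Finset I → ℝ) :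
    ∑ U ∈ J.powerset, walshNoise τ J U F ^ 2 = walshNoise τ J ∅ (fun z => F z ^ 2) := by
  induction J using Finset.induction_on generalizing F with
  | empty => simp [walshNoise, noiseCoeff]
  | insert j J hj ih =>
    rw [Finset.sum_powerset_insert hj, walshNoise_insert_of_notMem hj (Finset.notMem_empty j),
      ← ih, ← ih, Finset.mul_sum, Finset.mul_sum, ← Finset.sum_add_distrib,
      ← Finset.sum_add_distrib]
    refine Finset.sum_congr rfl fun U hU => ?_
    have hjU : j ∉ U := fun h => hj (Finset.mem_powerset.1 hU h)
    rw [walshNoise_insert_of_notMem hj hjU, walshNoise_insert_insert hj, mul_pow,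
      Real.sq_sqrt (mul_nonneg h0 (by linarith))]
    ring

/-- Coordinates on which `F` does not depend can be dropped from the Walsh transform. -/
lemma sum_walshNoise_sq_mul_of_subset {J₀ J : Finset I} (h : J₀ ⊆ J) (F : Finset I → ℝ)
    (hF : ∀ j ∉ J₀, ∀ z, F (insert j z) = F z) (c : Finset I → ℝ) :
    ∑ U ∈ J.powerset, walshNoise τ J U F ^ 2 * c U =
      ∑ U ∈ J₀.powerset, walshNoise τ J₀ U F ^ 2 * c U := by
  suffices H : ∀ K : Finset I, ∑ U ∈ (J₀ ∪ K).powerset, walshNoise τ (J₀ ∪ K) U F ^ 2 * c U =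
      ∑ U ∈ J₀.powerset, walshNoise τ J₀ U F ^ 2 * c U by
    have := H J
    rwa [Finset.union_eq_right.2 h] at this
  intro K
  induction K using Finset.induction_on with
  | empty => simp
  | insert j K _ ih =>
    rw [Finset.union_insert]
    by_cases hj : j ∈ J₀ ∪ K
    · rwa [Finset.insert_eq_of_mem hj]
    have hj0 : j ∉ J₀ := fun h => hj (Finset.mem_union_left _ h)
    have hF' : (fun z => F (insert j z)) = F := funext (hF j hj0)
    rw [Finset.sum_powerset_insert hj, ← ih]
    conv_rhs => rw [← add_zero (∑ U ∈ (J₀ ∪ K).powerset, _)]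
    congr 1
    · refine Finset.sum_congr rfl fun U hU => ?_
      have hjU : j ∉ U := fun h => hj (Finset.mem_powerset.1 hU h)
      rw [walshNoise_insert_of_notMem hj hjU, hF']
      ring
    · refine Finset.sum_eq_zero fun U _ => ?_
      rw [walshNoise_insert_insert hj, hF']
      ring

lemma walshNoise_empty_one (J : Finset I) : walshNoise τ J ∅ (fun _ => 1) = 1 := by
  induction J using Finset.induction_on with
  | empty => simp [walshNoise, noiseCoeff]
  | insert j J hj ih =>
    rw [walshNoise_insert_of_notMem hj (Finset.notMem_empty j), ih]; ring

/-- The union bound for the noise. -/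
lemma walshNoise_inter_nonempty_le (h0 : 0 ≤ τ) (h1 : τ ≤ 1) (J K : Finset I) :
    walshNoise τ J ∅ (fun z => if (z ∩ K).Nonempty then 1 else 0) ≤ K.card * τ := by
  have hmul : ∀ (K : Finset I) (z : Finset I), (if (z ∩ K).Nonempty then (1 : ℝ) else 0) ≤
      ∑ j ∈ K, if j ∈ z then 1 else 0 := by
    intro K z
    split_ifs with h
    · obtain ⟨j, hj⟩ := h
      rw [Finset.mem_inter] at hj
      refine le_trans ?_ (Finset.single_le_sum (f := fun j => if j ∈ z then (1 : ℝ) else 0)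
        (fun i _ => by split_ifs <;> norm_num) hj.2)
      simp [hj.1]
    · exact Finset.sum_nonneg fun i _ => by split_ifs <;> norm_num
  have hsingle : ∀ j, walshNoise τ J ∅ (fun z => if j ∈ z then 1 else 0) ≤ τ := by
    intro j
    induction J using Finset.induction_on with
    | empty => simp only [walshNoise, noiseCoeff, Finset.powerset_empty, Finset.sum_singleton,
        Finset.notMem_empty, if_false, mul_zero, h0]
    | insert i J hi ih =>
      rw [walshNoise_insert_of_notMem hi (Finset.notMem_empty i)]
      by_cases hij : j = i
      · subst hij
        have e1 : walshNoise τ J ∅ (fun z => if j ∈ z then (1 : ℝ) else 0) = 0 :=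
          Finset.sum_eq_zero fun z hz => by
            simp only [if_neg fun h => hi (Finset.mem_powerset.1 hz h), mul_zero]
        simp only [Finset.mem_insert_self, if_true]
        rw [e1, walshNoise_empty_one]
        linarith
      · simp only [Finset.mem_insert, hij, false_or]
        linarith
  calc walshNoise τ J ∅ (fun z => if (z ∩ K).Nonempty then 1 else 0)
      ≤ walshNoise τ J ∅ (fun z => ∑ j ∈ K, if j ∈ z then 1 else 0) :=
        Finset.sum_le_sum fun z _ =>
          mul_le_mul_of_nonneg_left (hmul K z) (noiseCoeff_empty_nonneg h0 h1 J z)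
    _ = ∑ j ∈ K, walshNoise τ J ∅ (fun z => if j ∈ z then 1 else 0) := by
        simp only [walshNoise, Finset.mul_sum]
        exact Finset.sum_comm
    _ ≤ ∑ j ∈ K, τ := Finset.sum_le_sum fun j _ => hsingle j
    _ = K.card * τ := by simp

/-- The uniform average over the subsets of `J`. -/
def cubeAvg (J : Finset I) (F : Finset I → ℝ) : ℝ :=
  (2 ^ J.card)⁻¹ * ∑ z ∈ J.powerset, F z

lemma cubeAvg_insert {j : I} {J : Finset I} (hj : j ∉ J) (F : Finset I → ℝ) :
    cubeAvg (insert j J) F = (cubeAvg J F + cubeAvg J (fun z => F (insert j z))) / 2 := by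
  simp only [cubeAvg]
  rw [Finset.sum_powerset_insert hj, Finset.card_insert_of_notMem hj, pow_succ]
  field_simp

omit [DecidableEq I] in
lemma cubeAvg_add (J : Finset I) (F G : Finset I → ℝ) :
    cubeAvg J (fun z => F z + G z) = cubeAvg J F + cubeAvg J G := by
  simp only [cubeAvg, Finset.sum_add_distrib, mul_add]

omit [DecidableEq I] in
lemma cubeAvg_mul_left (J : Finset I) (c : ℝ) (F : Finset I → ℝ) :
    cubeAvg J (fun z => c * F z) = c * cubeAvg J F := by
  simp only [cubeAvg, ← Finset.mul_sum]; ring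

omit [DecidableEq I] in
lemma cubeAvg_congr {J : Finset I} {F G : Finset I → ℝ} (h : ∀ z ⊆ J, F z = G z) :
    cubeAvg J F = cubeAvg J G := by
  simp only [cubeAvg]
  rw [Finset.sum_congr rfl fun z hz => h z (Finset.mem_powerset.1 hz)]

omit [DecidableEq I] in
lemma cubeAvg_nonneg {J : Finset I} {F : Finset I → ℝ} (h : ∀ z ⊆ J, 0 ≤ F z) :
    0 ≤ cubeAvg J F :=
  mul_nonneg (by positivity) (Finset.sum_nonneg fun z hz => h z (Finset.mem_powerset.1 hz))

omit [DecidableEq I] in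
lemma cubeAvg_mul_sq_le (J : Finset I) (F G : Finset I → ℝ) :
    cubeAvg J (fun z => F z * G z) ^ 2 ≤
      cubeAvg J (fun z => F z ^ 2) * cubeAvg J (fun z => G z ^ 2) := by
  simp only [cubeAvg]
  have := Finset.sum_mul_sq_le_sq_mul_sq J.powerset F G
  have h2 : (0:ℝ) ≤ ((2 ^ J.card)⁻¹) ^ 2 := by positivity
  nlinarith [mul_le_mul_of_nonneg_left this h2]

/-- The Walsh function of `S`. -/
def walshChar (S z : Finset I) : ℝ := ∏ j ∈ S, if j ∈ z then -1 else 1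

/-- The Walsh polynomial with coefficients `a`, damped by `κ` in each degree. -/
def walshPoly (κ : ℝ) (J : Finset I) (a : Finset I → ℝ) (z : Finset I) : ℝ :=
  ∑ S ∈ J.powerset, κ ^ S.card * a S * walshChar S z

lemma walshChar_insert_right {j : I} {S : Finset I} (hj : j ∉ S) (z : Finset I) :
    walshChar S (insert j z) = walshChar S z :=
  Finset.prod_congr rfl fun i hi => by
    have : i ≠ j := fun h => hj (h ▸ hi)
    simp [this]

lemma walshPoly_insert_left {j : I} {J : Finset I} (hj : j ∉ J) (κ : ℝ) (a : Finset I → ℝ)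
    (z : Finset I) :
    walshPoly κ (insert j J) a z = walshPoly κ J a z +
      κ * (if j ∈ z then -1 else 1) * walshPoly κ J (fun S => a (insert j S)) z := by
  simp only [walshPoly]
  rw [Finset.sum_powerset_insert hj, Finset.mul_sum]
  congr 1
  refine Finset.sum_congr rfl fun S hS => ?_
  have hjS : j ∉ S := fun h => hj (Finset.mem_powerset.1 hS h)
  rw [walshChar, Finset.prod_insert hjS, Finset.card_insert_of_notMem hjS, walshChar]
  ring

lemma walshPoly_insert_right {j : I} {J : Finset I} (hj : j ∉ J) (κ : ℝ) (a : Finset I → ℝ)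
    (z : Finset I) : walshPoly κ J a (insert j z) = walshPoly κ J a z :=
  Finset.sum_congr rfl fun S hS => by
    rw [walshChar_insert_right fun h => hj (Finset.mem_powerset.1 hS h)]

/-- Bonami's inequality: the noise with parameter `1/√3` is a contraction from `L²` to `L⁴`. -/
lemma cubeAvg_walshPoly_pow_four_le {κ : ℝ} (hκ : κ ^ 2 = 1 / 3) (J : Finset I)
    (a : Finset I → ℝ) :
    cubeAvg J (fun z => walshPoly κ J a z ^ 4) ≤ (∑ S ∈ J.powerset, a S ^ 2) ^ 2 := by
  induction J using Finset.induction_on generalizing a with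
  | empty =>
    simp [cubeAvg, walshPoly, walshChar]
    apply le_of_eq; ring
  | insert j J hj ih =>
    have hG := ih a
    have hH := ih (fun S => a (insert j S))
    set A := ∑ S ∈ J.powerset, a S ^ 2 with hA
    set B := ∑ S ∈ J.powerset, a (insert j S) ^ 2 with hB
    have hA0 : 0 ≤ A := Finset.sum_nonneg fun _ _ => sq_nonneg _
    have hB0 : 0 ≤ B := Finset.sum_nonneg fun _ _ => sq_nonneg _
    rw [Finset.sum_powerset_insert hj, ← hA, ← hB, cubeAvg_insert hj]
    set G := walshPoly κ J a
    set H := walshPoly κ J (fun S => a (insert j S))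
    have e1 : cubeAvg J (fun z => walshPoly κ (insert j J) a z ^ 4) =
        cubeAvg J (fun z => (G z + κ * H z) ^ 4) := cubeAvg_congr fun z hz => by
      rw [walshPoly_insert_left hj, if_neg fun h => hj (hz h), mul_one]
    have e2 : cubeAvg J (fun z => walshPoly κ (insert j J) a (insert j z) ^ 4) =
        cubeAvg J (fun z => (G z - κ * H z) ^ 4) := cubeAvg_congr fun z hz => by
      rw [walshPoly_insert_left hj, if_pos (Finset.mem_insert_self _ _),
        walshPoly_insert_right hj, walshPoly_insert_right hj]
      ring
    have e3 : (cubeAvg J (fun z => (G z + κ * H z) ^ 4) +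
        cubeAvg J (fun z => (G z - κ * H z) ^ 4)) / 2 =
        cubeAvg J (fun z => G z ^ 4) + 2 * cubeAvg J (fun z => G z ^ 2 * H z ^ 2) +
          1 / 9 * cubeAvg J (fun z => H z ^ 4) := by
      rw [← cubeAvg_mul_left, ← cubeAvg_mul_left, ← cubeAvg_add, ← cubeAvg_add, ← cubeAvg_add,
        div_eq_inv_mul, ← cubeAvg_mul_left]
      refine cubeAvg_congr fun z _ => ?_
      have h4 : κ ^ 4 = 1 / 9 := by
        rw [show κ ^ 4 = (κ ^ 2) ^ 2 by ring, hκ]; norm_num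
      linear_combination (6 * G z ^ 2 * H z ^ 2) * hκ + H z ^ 4 * h4
    have hCS := cubeAvg_mul_sq_le J (fun z => G z ^ 2) (fun z => H z ^ 2)
    simp only [← pow_mul] at hCS
    have hH0 : 0 ≤ cubeAvg J (fun z => H z ^ 4) := cubeAvg_nonneg fun z _ => by positivity
    have hAB : cubeAvg J (fun z => G z ^ 2 * H z ^ 2) ≤ A * B := by
      refine abs_le_of_sq_le_sq' (hCS.trans ?_) (by positivity) |>.2
      rw [mul_pow]
      exact mul_le_mul hG hH hH0 (by positivity)
    rw [e1, e2, e3]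
    nlinarith

/-- The Walsh coefficients of a function on the cube. -/
def walshCoeff (J : Finset I) (F : Finset I → ℝ) (S : Finset I) : ℝ :=
  cubeAvg J (fun z => F z * walshChar S z)

lemma walshCoeff_insert_of_notMem {j : I} {J S : Finset I} (hj : j ∉ J) (hS : j ∉ S)
    (F : Finset I → ℝ) :
    walshCoeff (insert j J) F S = walshCoeff J (fun z => (F z + F (insert j z)) / 2) S := by
  simp only [walshCoeff]
  rw [cubeAvg_insert hj, ← cubeAvg_add, div_eq_inv_mul, ← cubeAvg_mul_left]
  refine cubeAvg_congr fun z _ => ?_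
  rw [walshChar_insert_right hS]
  ring

lemma walshCoeff_insert_insert {j : I} {J S : Finset I} (hj : j ∉ J) (hS : j ∉ S)
    (F : Finset I → ℝ) :
    walshCoeff (insert j J) F (insert j S) =
      walshCoeff J (fun z => (F z - F (insert j z)) / 2) S := by
  simp only [walshCoeff]
  rw [cubeAvg_insert hj, ← cubeAvg_add, div_eq_inv_mul, ← cubeAvg_mul_left]
  refine cubeAvg_congr fun z hz => ?_
  have hjz : j ∉ z := fun h => hj (hz h)
  have h1 : walshChar (insert j S) z = walshChar S z := by
    rw [walshChar, Finset.prod_insert hS, if_neg hjz, one_mul, walshChar]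
  have h2 : walshChar (insert j S) (insert j z) = -walshChar S z := by
    rw [walshChar, Finset.prod_insert hS, if_pos (Finset.mem_insert_self _ _), ← walshChar,
      walshChar_insert_right hS]
    ring
  rw [h1, h2]
  ring

/-- The noise operator on functions on the cube. -/
def cubeNoise (τ : ℝ) (J : Finset I) (F : Finset I → ℝ) (y : Finset I) : ℝ :=
  walshNoise τ J ∅ (fun z => F (symmDiff y z))

lemma cubeNoise_insert {j : I} {J y : Finset I} (hj : j ∉ J) (hy : y ⊆ J) (F : Finset I → ℝ) :
    cubeNoise τ (insert j J) F y =
      (1 - τ) * cubeNoise τ J F y + τ * cubeNoise τ J (fun z => F (insert j z)) y := by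
  simp only [cubeNoise]
  rw [walshNoise_insert_of_notMem hj (Finset.notMem_empty j)]
  congr 2
  refine Finset.sum_congr rfl fun z hz => ?_
  congr 1
  refine congrArg F ?_
  ext i
  have hjz : j ∉ z := fun h => hj (Finset.mem_powerset.1 hz h)
  have hjy : j ∉ y := fun h => hj (hy h)
  simp only [Finset.mem_symmDiff, Finset.mem_insert]
  by_cases h : i = j
  · subst h; simp [hjy]
  · simp [h]

lemma cubeNoise_insert' {j : I} {J y : Finset I} (hj : j ∉ J) (hy : y ⊆ J) (F : Finset I → ℝ) :
    cubeNoise τ (insert j J) F (insert j y) =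
      (1 - τ) * cubeNoise τ J (fun z => F (insert j z)) y + τ * cubeNoise τ J F y := by
  simp only [cubeNoise]
  rw [walshNoise_insert_of_notMem hj (Finset.notMem_empty j)]
  congr 2
  all_goals
    refine Finset.sum_congr rfl fun z hz => ?_
    congr 1
    refine congrArg F ?_
    ext i
    have hjz : j ∉ z := fun h => hj (Finset.mem_powerset.1 hz h)
    have hjy : j ∉ y := fun h => hj (hy h)
    simp only [Finset.mem_symmDiff, Finset.mem_insert]
    by_cases h : i = j
    · subst h; simp [hjy, hjz]
    · simp [h]

lemma cubeNoise_add_smul (J : Finset I) (F G : Finset I → ℝ) (a b : ℝ) (y : Finset I) :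
    cubeNoise τ J (fun z => a * F z + b * G z) y =
      a * cubeNoise τ J F y + b * cubeNoise τ J G y := by
  simp only [cubeNoise, walshNoise, Finset.mul_sum]
  rw [← Finset.sum_add_distrib]
  exact Finset.sum_congr rfl fun _ _ => by ring

lemma sum_walshCoeff_sq_noise (J : Finset I) (F : Finset I → ℝ) :
    cubeAvg J (fun y => cubeNoise τ J F y ^ 2) =
      ∑ S ∈ J.powerset, ((1 - 2 * τ) ^ 2) ^ S.card * walshCoeff J F S ^ 2 := by
  induction J using Finset.induction_on generalizing F with
  | empty => simp [cubeAvg, cubeNoise, walshNoise, noiseCoeff, walshCoeff, walshChar]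
  | insert j J hj ih =>
    rw [Finset.sum_powerset_insert hj, cubeAvg_insert hj]
    have e1 : ∑ S ∈ J.powerset, ((1 - 2 * τ) ^ 2) ^ S.card * walshCoeff (insert j J) F S ^ 2 =
        cubeAvg J (fun y => cubeNoise τ J (fun z => (F z + F (insert j z)) / 2) y ^ 2) := by
      rw [ih]
      refine Finset.sum_congr rfl fun S hS => ?_
      rw [walshCoeff_insert_of_notMem hj fun h => hj (Finset.mem_powerset.1 hS h)]
    have e2 : ∑ S ∈ J.powerset, ((1 - 2 * τ) ^ 2) ^ (insert j S).card *
          walshCoeff (insert j J) F (insert j S) ^ 2 = (1 - 2 * τ) ^ 2 *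
        cubeAvg J (fun y => cubeNoise τ J (fun z => (F z - F (insert j z)) / 2) y ^ 2) := by
      rw [ih, Finset.mul_sum]
      refine Finset.sum_congr rfl fun S hS => ?_
      have hjS : j ∉ S := fun h => hj (Finset.mem_powerset.1 hS h)
      rw [walshCoeff_insert_insert hj hjS, Finset.card_insert_of_notMem hjS]
      ring
    rw [e1, e2, ← cubeAvg_mul_left, ← cubeAvg_add, ← cubeAvg_add, div_eq_inv_mul,
      ← cubeAvg_mul_left]
    refine cubeAvg_congr fun y hy => ?_
    have l1 := cubeNoise_add_smul (τ := τ) J F (fun z => F (insert j z)) (1 / 2) (1 / 2) y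
    have l2 := cubeNoise_add_smul (τ := τ) J F (fun z => F (insert j z)) (1 / 2) (-1 / 2) y
    rw [cubeNoise_insert hj hy, cubeNoise_insert' hj hy,
      show (fun z => (F z + F (insert j z)) / 2) =
        fun z => 1 / 2 * F z + 1 / 2 * F (insert j z) by ext; ring, l1,
      show (fun z => (F z - F (insert j z)) / 2) =
        fun z => 1 / 2 * F z + -1 / 2 * F (insert j z) by ext; ring, l2]
    ring

lemma cubeNoise_zero (J : Finset I) (F : Finset I → ℝ) {y : Finset I} (hy : y ⊆ J) :
    cubeNoise 0 J F y = F y := by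
  induction J using Finset.induction_on generalizing F y with
  | empty =>
    obtain rfl := Finset.subset_empty.1 hy
    simp [cubeNoise, walshNoise, noiseCoeff]
  | insert j J hj ih =>
    by_cases hjy : j ∈ y
    · obtain ⟨y', hy', rfl⟩ : ∃ y', y' ⊆ J ∧ y = insert j y' :=
        ⟨y.erase j, Finset.subset_insert_iff.1 hy,
          (Finset.insert_erase hjy).symm⟩
      rw [cubeNoise_insert' hj hy', ih _ hy']; ring
    · have hy' : y ⊆ J := (Finset.subset_insert_iff_of_notMem hjy).1 hy
      rw [cubeNoise_insert hj hy', ih _ hy']; ring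

lemma sum_walshCoeff_sq (J : Finset I) (F : Finset I → ℝ) :
    ∑ S ∈ J.powerset, walshCoeff J F S ^ 2 = cubeAvg J (fun z => F z ^ 2) := by
  have := sum_walshCoeff_sq_noise (τ := 0) J F
  rw [cubeAvg_congr fun y hy => by rw [cubeNoise_zero J F hy]] at this
  simpa using this.symm

/-- The level inequality for indicator functions. -/
lemma sum_third_pow_walshCoeff_sq_le (J : Finset I) {F : Finset I → ℝ}
    (hF : ∀ z, F z = 0 ∨ F z = 1) :
    (∑ S ∈ J.powerset, (1 / 3 : ℝ) ^ S.card * walshCoeff J F S ^ 2) ^ 2 ≤ cubeAvg J F ^ 3 := by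
  set W := ∑ S ∈ J.powerset, (1 / 3 : ℝ) ^ S.card * walshCoeff J F S ^ 2 with hW
  set m := cubeAvg J F
  have hF0 : ∀ z, 0 ≤ F z := fun z => by rcases hF z with h | h <;> simp [h]
  have hm : 0 ≤ m := cubeAvg_nonneg fun z _ => hF0 z
  have hF2 : ∀ z, F z ^ 2 = F z := fun z => by rcases hF z with h | h <;> simp [h]
  set κ := √(1 / 3 : ℝ)
  have hκ : κ ^ 2 = 1 / 3 := Real.sq_sqrt (by norm_num)
  set G := walshPoly κ J (fun S => κ ^ S.card * walshCoeff J F S)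
  have h1 : W = cubeAvg J (fun z => F z * (F z * G z)) := by
    simp only [← mul_assoc, ← sq, hF2]
    simp only [hW, G, walshPoly, cubeAvg, Finset.mul_sum]
    rw [Finset.sum_comm]
    refine Finset.sum_congr rfl fun S _ => ?_
    rw [sq (walshCoeff J F S)]
    nth_rw 2 [walshCoeff]
    simp only [cubeAvg, Finset.mul_sum]
    refine Finset.sum_congr rfl fun z _ => ?_
    rw [← hκ]; ring
  have h2 : ∑ S ∈ J.powerset, (κ ^ S.card * walshCoeff J F S) ^ 2 = W := by
    refine Finset.sum_congr rfl fun S _ => ?_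
    rw [← hκ]; ring
  have h3 : cubeAvg J (fun z => G z ^ 4) ≤ W ^ 2 := by
    have := cubeAvg_walshPoly_pow_four_le hκ J (fun S => κ ^ S.card * walshCoeff J F S)
    rwa [h2] at this
  have h4 := cubeAvg_mul_sq_le J F (fun z => F z * G z)
  have h5 := cubeAvg_mul_sq_le J F (fun z => G z ^ 2)
  simp only [mul_pow, hF2, ← pow_mul] at h4 h5
  rw [← h1] at h4
  norm_num at h5
  set K := cubeAvg J (fun z => F z * G z ^ 2)
  have hW4 : W ^ 4 ≤ m ^ 3 * W ^ 2 := by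
    calc W ^ 4 = (W ^ 2) ^ 2 := by ring
      _ ≤ (m * K) ^ 2 := pow_le_pow_left₀ (sq_nonneg _) h4 2
      _ = m ^ 2 * K ^ 2 := by ring
      _ ≤ m ^ 2 * (m * W ^ 2) := mul_le_mul_of_nonneg_left
          (h5.trans (mul_le_mul_of_nonneg_left h3 hm)) (by positivity)
      _ = m ^ 3 * W ^ 2 := by ring
  rcases eq_or_ne W 0 with h | h
  · rw [h]; simpa using pow_nonneg hm 3
  · have : 0 < W ^ 2 := by positivity
    nlinarith [pow_nonneg hm 3]

/-- Small set expansion on the cube. -/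
lemma cubeAvg_cubeNoise_sq_le {M : ℕ}
    (hM : ((1 - 2 * τ) ^ 2) ^ M ≤ 1 / 3) {η : ℝ} (hη : 0 ≤ η) (J : Finset I) {F : Finset I → ℝ}
    (hF : ∀ z, F z = 0 ∨ F z = 1) (hm : cubeAvg J F ≤ η ^ (2 * M)) :
    cubeAvg J (fun y => cubeNoise τ J F y ^ 2) ≤ η * cubeAvg J F := by
  rw [sum_walshCoeff_sq_noise]
  set r := (1 - 2 * τ) ^ 2
  have hr : 0 ≤ r := sq_nonneg _
  set m := cubeAvg J F
  have hF2 : ∀ z, F z ^ 2 = F z := fun z => by rcases hF z with h | h <;> simp [h]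
  have hF0 : ∀ z, 0 ≤ F z := fun z => by rcases hF z with h | h <;> simp [h]
  have hm0 : 0 ≤ m := cubeAvg_nonneg fun z _ => hF0 z
  have hP : ∑ S ∈ J.powerset, walshCoeff J F S ^ 2 = m := by
    rw [sum_walshCoeff_sq]; simp only [hF2]; rfl
  set Q := ∑ S ∈ J.powerset, r ^ S.card * walshCoeff J F S ^ 2
  have hQ0 : 0 ≤ Q := Finset.sum_nonneg fun S _ => by positivity
  obtain ⟨M, rfl⟩ : ∃ k, M = k + 1 := ⟨M - 1, by
    rcases M with _ | M
    · norm_num at hM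
    · simp⟩
  have hJ : Q ^ (M + 1) ≤ m ^ M * ∑ S ∈ J.powerset,
      (1 / 3 : ℝ) ^ S.card * walshCoeff J F S ^ 2 := by
    rcases eq_or_lt_of_le hm0 with h | h
    · have h0 : ∀ S ∈ J.powerset, walshCoeff J F S ^ 2 = 0 :=
        (Finset.sum_eq_zero_iff_of_nonneg fun S _ => sq_nonneg _).1 (hP.trans h.symm)
      have hQ : Q = 0 := Finset.sum_eq_zero fun S hS => by rw [h0 S hS, mul_zero]
      rw [hQ, zero_pow (Nat.succ_ne_zero M)]
      exact mul_nonneg (pow_nonneg hm0 M) (Finset.sum_nonneg fun S _ => by positivity)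
    · have hJen := Real.pow_arith_mean_le_arith_mean_pow J.powerset
        (fun S => walshCoeff J F S ^ 2 / m) (fun S => r ^ S.card) (fun S _ => by positivity)
        (by rw [← Finset.sum_div, hP, div_self h.ne']) (fun S _ => by positivity) (M + 1)
      have hQm : ∑ S ∈ J.powerset, walshCoeff J F S ^ 2 / m * r ^ S.card = Q / m := by
        rw [Finset.sum_div]
        exact Finset.sum_congr rfl fun S _ => by ring
      have hle : ∑ S ∈ J.powerset, walshCoeff J F S ^ 2 / m * (r ^ S.card) ^ (M + 1) ≤
          (∑ S ∈ J.powerset, (1 / 3 : ℝ) ^ S.card * walshCoeff J F S ^ 2) / m := by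
        rw [Finset.sum_div]
        refine Finset.sum_le_sum fun S _ => ?_
        rw [← pow_mul, mul_comm S.card, pow_mul, mul_comm, mul_div_assoc]
        exact mul_le_mul_of_nonneg_right (pow_le_pow_left₀ (by positivity) hM _) (by positivity)
      rw [hQm] at hJen
      have := mul_le_mul_of_nonneg_left (hJen.trans hle) (pow_nonneg hm0 (M + 1))
      rw [div_pow, mul_div_cancel₀ _ (pow_pos h _).ne'] at this
      refine this.trans (le_of_eq ?_)
      field_simp
      ring
  have hL := sum_third_pow_walshCoeff_sq_le J hF
  set W := ∑ S ∈ J.powerset, (1 / 3 : ℝ) ^ S.card * walshCoeff J F S ^ 2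
  have : Q ^ (2 * (M + 1)) ≤ (η * m) ^ (2 * (M + 1)) := by
    calc Q ^ (2 * (M + 1)) = (Q ^ (M + 1)) ^ 2 := by ring
      _ ≤ (m ^ M * W) ^ 2 := pow_le_pow_left₀ (by positivity) hJ 2
      _ = m ^ (2 * M) * W ^ 2 := by ring
      _ ≤ m ^ (2 * M) * m ^ 3 := mul_le_mul_of_nonneg_left hL (by positivity)
      _ = m ^ (2 * (M + 1)) * m := by ring
      _ ≤ m ^ (2 * (M + 1)) * η ^ (2 * (M + 1)) := mul_le_mul_of_nonneg_left hm (by positivity)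
      _ = _ := by rw [mul_pow, mul_comm]
  exact le_of_pow_le_pow_left₀ (by omega) (by positivity) this
end

/-- The fair coin. -/
def fairCoin : Measure (Fin 2) := (2⁻¹ : ENNReal) • Measure.count

lemma fairCoin_singleton (a : Fin 2) : fairCoin {a} = 2⁻¹ := by
  simp [fairCoin]

instance : IsProbabilityMeasure fairCoin := ⟨by
  rw [fairCoin, Measure.smul_apply, Measure.count_apply MeasurableSet.univ]
  simp [ENNReal.inv_mul_cancel]⟩

lemma fairCoin_map_add (a : Fin 2) : fairCoin.map (fun b => b + a) = fairCoin := by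
  refine Measure.ext_of_singleton fun b => ?_
  rw [Measure.map_apply (by fun_prop) (measurableSet_singleton b), fairCoin_singleton,
    show (fun c => c + a) ⁻¹' {b} = {b - a} by
      ext; simp only [mem_preimage, mem_singleton_iff, eq_sub_iff_add_eq],
    fairCoin_singleton]

/-- The fair coin-flipping measure. -/
def coinMeasure (I : Type*) : Measure (I → Fin 2) := Measure.infinitePi fun _ => fairCoin

instance (I : Type*) : IsProbabilityMeasure (coinMeasure I) := by
  unfold coinMeasure; infer_instance

/-- Flip the coordinates of `x` which belong to `z`. -/
def flipCoords {I : Type*} [DecidableEq I] (z : Finset I) (x : I → Fin 2) (i : I) : Fin 2 :=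
  x i + if i ∈ z then 1 else 0

section
variable {I : Type*} [DecidableEq I]

lemma measurable_flipCoords (z : Finset I) : Measurable (flipCoords z) :=
  measurable_pi_lambda _ fun i => (measurable_pi_apply i).add_const _

lemma measurePreserving_flipCoords (z : Finset I) :
    MeasurePreserving (flipCoords z) (coinMeasure I) (coinMeasure I) := by
  refine ⟨measurable_flipCoords z, ?_⟩
  have := Measure.infinitePi_map_pi (μ := fun _ : I => fairCoin)
    (f := fun i b => b + if i ∈ z then 1 else 0) (fun i => by fun_prop)
  simp only [fairCoin_map_add] at this
  exact this

lemma flipCoords_flipCoords (z w : Finset I) (x : I → Fin 2) :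
    flipCoords z (flipCoords w x) = flipCoords (symmDiff w z) x := by
  ext i
  simp only [flipCoords, Finset.mem_symmDiff]
  by_cases h : i ∈ z <;> by_cases h' : i ∈ w <;> simp [h, h', add_assoc]

lemma flipCoords_empty (x : I → Fin 2) : flipCoords ∅ x = x := by
  ext i; simp [flipCoords]
end

/-- Reindexing of coordinates. -/
lemma measurePreserving_reindex {I : Type*} (e : I ≃ I) :
    MeasurePreserving (fun (x : I → Fin 2) i => x (e i)) (coinMeasure I) (coinMeasure I) := by
  have h := Measure.infinitePi_map_piCongrLeft (X := fun _ : I => Fin 2)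
    (fun _ : I => fairCoin) e.symm
  refine ⟨by fun_prop, ?_⟩
  convert! h using 2
  ext x i
  have := Equiv.piCongrLeft_apply_apply (fun _ : I => Fin 2) e.symm x (e i)
  simp at this
  exact congrArg _ this.symm

/-- Measurable sets are approximated by clopen cylinders. -/
lemma exists_cylinder_approx {I : Type*} {E : Set (I → Fin 2)} (hE : MeasurableSet E) {η : ℝ}
    (hη : 0 < η) : ∃ (J : Finset I) (E' : Set (I → Fin 2)), MeasurableSet E' ∧
      (∀ x y, (∀ j ∈ J, x j = y j) → (x ∈ E' ↔ y ∈ E')) ∧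
      (coinMeasure I).real (symmDiff E' E) < η := by
  obtain ⟨t, ht, htE⟩ := exists_measure_symmDiff_lt_of_generateFrom_isSetRing
    (μ := coinMeasure I) (isSetRing_measurableCylinders (α := fun _ : I => Fin 2))
    ⟨{univ}, countable_singleton _, by
      rw [singleton_subset_iff]; exact univ_mem_measurableCylinders _, by simp⟩
    (generateFrom_measurableCylinders (α := fun _ : I => Fin 2)).symm hE
    (ε := ENNReal.ofReal η) (by simpa using hη)
  obtain ⟨J, S, hS, rfl⟩ := (mem_measurableCylinders t).1 ht
  refine ⟨J, _, MeasurableSet.of_mem_measurableCylinders ht, fun x y hxy => ?_, ?_⟩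
  · have : J.restrict x = J.restrict y := by ext j; exact congrArg _ (hxy j j.2)
    rw [mem_cylinder, mem_cylinder, this]
  · rw [Measure.real]
    exact (ENNReal.toReal_lt_of_lt_ofReal htE)

lemma exists_floor_iff_digits (b : ℕ → Fin 2) (n : ℕ) : ∃ k : ℕ, k < 2 ^ n ∧
    ∀ x ∈ Ico (0 : ℝ) 1, (∀ i < n, Real.digits x 2 i = b i) ↔ ⌊x * 2 ^ n⌋₊ = k := by
  induction n with
  | zero =>
    refine ⟨0, by norm_num, fun x hx => ?_⟩
    simp [Nat.floor_eq_zero, hx.2]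
  | succ n ih =>
    obtain ⟨k, hk, h⟩ := ih
    refine ⟨2 * k + (b n).val, by have := (b n).isLt; rw [pow_succ]; omega, fun x hx => ?_⟩
    have e : ⌊x * 2 ^ n⌋₊ = ⌊x * 2 ^ (n + 1)⌋₊ / 2 := by
      rw [← Nat.floor_div_natCast]
      congr 1
      push_cast
      rw [pow_succ]; ring
    have e2 : (∀ i < n + 1, Real.digits x 2 i = b i) ↔
        (∀ i < n, Real.digits x 2 i = b i) ∧ Real.digits x 2 n = b n := by
      constructor
      · exact fun H => ⟨fun i hi => H i (by omega), H n (by omega)⟩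
      · rintro ⟨H1, H2⟩ i hi
        rcases Nat.lt_succ_iff_lt_or_eq.1 hi with h | rfl
        · exact H1 i h
        · exact H2
    have e3 : Real.digits x 2 n = b n ↔ ⌊x * 2 ^ (n + 1)⌋₊ % 2 = (b n).val := by
      rw [Real.digits, ← Fin.val_inj]
      simp [Fin.ofNat]
    rw [e2, h x hx, e, e3]
    have := (b n).isLt
    omega

lemma measurable_digits : Measurable fun x : ℝ => Real.digits x 2 := by
  refine measurable_pi_lambda _ fun n => ?_
  simp only [Real.digits]
  exact (measurable_from_top (f := fun k : ℕ => Fin.ofNat 2 k)).comp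
    (Nat.measurable_floor.comp (by fun_prop))

lemma map_digits : (volume.restrict (Ico (0 : ℝ) 1)).map (fun x => Real.digits x 2) =
    coinMeasure ℕ := by
  refine ((Measure.isProjectiveLimit_infinitePi _).unique
    ((isProjectiveLimit_nat_iff (isProjectiveMeasureFamily_pi _) _).2 fun n => ?_)).symm
  rw [Measure.map_map (by fun_prop) measurable_digits]
  refine Measure.ext_of_singleton fun b => ?_
  rw [Measure.map_apply ((by fun_prop : Measurable (Preorder.frestrictLe n)).comp
    measurable_digits) (measurableSet_singleton b), Measure.pi_singleton]
  simp only [fairCoin_singleton, Finset.prod_const, Finset.card_univ, Fintype.card_coe,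
    Nat.card_Iic]
  obtain ⟨k, hk, h⟩ := exists_floor_iff_digits
    (fun i => if h : i ≤ n then b ⟨i, Finset.mem_Iic.2 h⟩ else 0) (n + 1)
  have hs : ((Preorder.frestrictLe n ∘ fun x => Real.digits x 2) ⁻¹' {b}) ∩ Ico 0 1 =
      Ico ((k : ℝ) / 2 ^ (n + 1)) ((k + 1) / 2 ^ (n + 1)) := by
    have hp : (0 : ℝ) < 2 ^ (n + 1) := by positivity
    have key : ∀ x ∈ Ico (0 : ℝ) 1, (Preorder.frestrictLe n (Real.digits x 2) = b ↔
        ⌊x * 2 ^ (n + 1)⌋₊ = k) := fun x hx => by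
      rw [← h x hx]
      constructor
      · rintro rfl i hi
        simp [Nat.lt_succ_iff.1 hi]
      · intro H
        ext ⟨i, hi⟩
        have := H i (Nat.lt_succ_iff.2 (Finset.mem_Iic.1 hi))
        rw [dif_pos (Finset.mem_Iic.1 hi)] at this
        simp [this]
    have hk' : (k : ℝ) + 1 ≤ 2 ^ (n + 1) := by exact_mod_cast hk
    ext x
    simp only [mem_inter_iff, mem_preimage, mem_singleton_iff, Function.comp_apply]
    constructor
    · rintro ⟨hb, hx⟩
      rw [key x hx, Nat.floor_eq_iff (mul_nonneg hx.1 hp.le)] at hb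
      exact ⟨(div_le_iff₀ hp).2 hb.1, (lt_div_iff₀ hp).2 hb.2⟩
    · intro hx
      have hx1 := (div_le_iff₀ hp).1 hx.1
      have hx2 := (lt_div_iff₀ hp).1 hx.2
      have hx0 : x ∈ Ico (0 : ℝ) 1 := ⟨le_trans (by positivity) hx.1, by nlinarith⟩
      exact ⟨(key x hx0).2 ((Nat.floor_eq_iff (mul_nonneg hx0.1 hp.le)).2 ⟨hx1, hx2⟩), hx0⟩
  rw [Measure.restrict_apply ((by fun_prop : Measurable (Preorder.frestrictLe n)).comp
    measurable_digits (measurableSet_singleton b)), hs, Real.volume_Ico]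
  rw [← sub_div, add_sub_cancel_left, ENNReal.ofReal_div_of_pos (by positivity),
    ENNReal.ofReal_one, one_div, ENNReal.ofReal_pow (by norm_num), ENNReal.inv_pow]
  simp

lemma map_ofDigits : (coinMeasure ℕ).map Real.ofDigits = volume.restrict (Icc (0 : ℝ) 1) := by
  rw [← map_digits, Measure.map_map Real.continuous_ofDigits.measurable measurable_digits,
    ← restrict_Ico_eq_restrict_Icc]
  conv_rhs => rw [← Measure.map_id (μ := volume.restrict (Ico (0 : ℝ) 1))]
  refine Measure.map_congr ?_
  filter_upwards [ae_restrict_mem measurableSet_Ico] with x hx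
  exact Real.ofDigits_digits one_lt_two hx

/-- The map which assembles bits into points of `[0,1]^Γ`. -/
def assembleBits {Γ : Type*} (w : Γ × ℕ → Fin 2) (γ : Γ) : ℝ := Real.ofDigits fun n => w (γ, n)

lemma measurePreserving_assembleBits {Γ : Type*} {μ : Measure (Γ → ℝ)}
    (hμ : IsBernoulliLebProduct μ) : MeasurePreserving assembleBits (coinMeasure (Γ × ℕ)) μ := by
  have : IsProbabilityMeasure (volume.restrict (Icc (0 : ℝ) 1)) := ⟨by simp⟩
  have hμ' : μ = Measure.infinitePi fun _ => volume.restrict (Icc (0 : ℝ) 1) := by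
    refine Measure.eq_infinitePi _ fun s t ht => ?_
    have := hμ.2 s t ht
    rw [Set.pi_def] at *
    simp only [Measure.restrict_apply (ht _)]
    rw [← this]
    congr 1
    ext x
    simp
  have hm : Measurable (assembleBits (Γ := Γ)) := measurable_pi_lambda _ fun γ =>
    Real.continuous_ofDigits.measurable.comp (by fun_prop)
  refine ⟨hm, ?_⟩
  have h1 := Measure.infinitePi_map_curry (ι := Γ) (κ := ℕ) (fun _ _ => fairCoin)
  have h2 := Measure.infinitePi_map_pi (μ := fun _ : Γ => coinMeasure ℕ)
    (f := fun _ => Real.ofDigits) fun _ => Real.continuous_ofDigits.measurable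
  simp only [map_ofDigits] at h2
  rw [hμ', ← h2]
  simp only [coinMeasure]
  have hm2 : Measurable fun (x : Γ → ℕ → Fin 2) γ => Real.ofDigits (x γ) :=
    measurable_pi_lambda _ fun γ => Real.continuous_ofDigits.measurable.comp (measurable_pi_apply γ)
  rw [← h1, Measure.map_map hm2 (MeasurableEquiv.measurable _)]
  rfl

section
variable {I : Type*} [DecidableEq I] {τ : ℝ}

omit [DecidableEq I] in
lemma sum_powerset_map_equiv (e : I ≃ I) (J : Finset I) (G : Finset I → ℝ) :
    ∑ U ∈ (J.map e.toEmbedding).powerset, G U = ∑ U ∈ J.powerset, G (U.map e.toEmbedding) := by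
  refine Finset.sum_nbij' (fun U => U.map e.symm.toEmbedding) (fun U => U.map e.toEmbedding)
    ?_ ?_ ?_ ?_ ?_
  · intro U hU
    rw [Finset.mem_powerset] at hU ⊢
    intro i hi
    obtain ⟨j, hj, rfl⟩ := Finset.mem_map.1 hi
    obtain ⟨k, hk, rfl⟩ := Finset.mem_map.1 (hU hj)
    simpa using hk
  · intro U hU
    rw [Finset.mem_powerset] at hU ⊢
    exact Finset.map_subset_map.2 hU
  · intro U _
    simp [Finset.map_map]
  · intro U _
    simp [Finset.map_map]
  · intro U _
    simp [Finset.map_map]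

lemma walshNoise_map_equiv (e : I ≃ I) (J U : Finset I) (F : Finset I → ℝ) :
    walshNoise τ (J.map e.toEmbedding) (U.map e.toEmbedding) F =
      walshNoise τ J U (fun z => F (z.map e.toEmbedding)) := by
  rw [walshNoise, sum_powerset_map_equiv, walshNoise]
  refine Finset.sum_congr rfl fun z _ => ?_
  simp [noiseCoeff, Finset.prod_map]

/-- The biased Walsh transform of `f` based at `x`. -/
def walshAt (τ : ℝ) (J U : Finset I) (f : (I → Fin 2) → ℝ) (x : I → Fin 2) : ℝ :=
  walshNoise τ J U fun z => f (flipCoords z x)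

lemma measurable_of_dependsOn_finset {β : Type*} [MeasurableSpace β] {J : Finset I}
    {f : (I → Fin 2) → β} (hf : DependsOn f (J : Set I)) : Measurable f := by
  have : f = (fun y : J → Fin 2 => f fun i => if h : i ∈ J then y ⟨i, h⟩ else 0) ∘ J.restrict := by
    ext x
    exact hf fun i hi => by simp [Finset.mem_coe.1 hi]
  rw [this]
  exact (measurable_of_finite _).comp (by fun_prop)

lemma measurable_walshAt {J U : Finset I} {f : (I → Fin 2) → ℝ} (hf : Measurable f) :
    Measurable (walshAt τ J U f) :=
  Finset.measurable_sum _ fun z _ => (hf.comp (measurable_flipCoords z)).const_mul _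

lemma flipCoords_insert_of_dependsOn {β : Type*} {J : Finset I} {f : (I → Fin 2) → β}
    (hf : DependsOn f (J : Set I)) {j : I} (hj : j ∉ J) (z : Finset I) (x : I → Fin 2) :
    f (flipCoords (insert j z) x) = f (flipCoords z x) :=
  hf fun i hi => by
    have : i ≠ j := fun h => hj (h ▸ hi)
    simp [flipCoords, this]

lemma cubeAvg_flipCoords_eq {J : Finset I} {f : (I → Fin 2) → ℝ}
    (hf : DependsOn f (J : Set I)) (x y : I → Fin 2) :
    cubeAvg J (fun z => f (flipCoords z x)) = cubeAvg J (fun z => f (flipCoords z y)) := by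
  simp only [cubeAvg]
  congr 1
  set w := J.filter fun i => x i ≠ y i with hw
  have hwJ : w ⊆ J := Finset.filter_subset _ _
  have hsub : ∀ z ∈ J.powerset, symmDiff w z ∈ J.powerset := fun z hz => by
    rw [Finset.mem_powerset] at hz ⊢
    intro i hi
    rcases Finset.mem_symmDiff.1 hi with h | h
    · exact hwJ h.1
    · exact hz h.1
  refine Finset.sum_nbij' (fun z => symmDiff w z) (fun z => symmDiff w z) hsub hsub
    (fun z _ => symmDiff_symmDiff_cancel_left w z) (fun z _ => symmDiff_symmDiff_cancel_left w z)
    fun z _ => ?_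
  rw [← flipCoords_flipCoords]
  refine hf fun i hi => ?_
  have h2 : x i = flipCoords w y i := by
    simp only [flipCoords, hw, Finset.mem_filter, Finset.mem_coe.1 hi, true_and]
    generalize x i = a
    generalize y i = b
    revert a b; decide
  simp only [flipCoords] at h2 ⊢
  rw [h2]

lemma integral_cubeAvg_flipCoords (J : Finset I) {f : (I → Fin 2) → ℝ}
    (hf : Integrable f (coinMeasure I)) :
    ∫ x, cubeAvg J (fun z => f (flipCoords z x)) ∂coinMeasure I = ∫ x, f x ∂coinMeasure I := by
  simp only [cubeAvg]
  have h1 : ∀ z : Finset I, ∫ x, f (flipCoords z x) ∂coinMeasure I = ∫ x, f x ∂coinMeasure I :=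
    fun z => by
      have hz := measurePreserving_flipCoords z
      conv_rhs => rw [← hz.map_eq]
      rw [integral_map hz.aemeasurable]
      rw [hz.map_eq]; exact hf.1
  have h2 : ∀ z ∈ J.powerset, Integrable (fun x => f (flipCoords z x)) (coinMeasure I) :=
    fun z _ => (measurePreserving_flipCoords z).integrable_comp_of_integrable hf
  rw [integral_const_mul, integral_finsetSum _ h2]
  simp only [h1, Finset.sum_const, Finset.card_powerset, nsmul_eq_mul]
  push_cast
  rw [← mul_assoc, inv_mul_cancel₀ (by positivity), one_mul]

lemma cubeAvg_flipCoords_eq_integral {J : Finset I} {f : (I → Fin 2) → ℝ}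
    (hf : DependsOn f (J : Set I)) (hfi : Integrable f (coinMeasure I)) (x : I → Fin 2) :
    cubeAvg J (fun z => f (flipCoords z x)) = ∫ y, f y ∂coinMeasure I := by
  rw [← integral_cubeAvg_flipCoords J hfi]
  simp only [fun y => cubeAvg_flipCoords_eq hf y x]
  simp

/-- Small set expansion for cylinder sets. -/
lemma integral_walshAt_empty_sq_le {M : ℕ} (hM : ((1 - 2 * τ) ^ 2) ^ M ≤ 1 / 3) {η : ℝ}
    (hη : 0 ≤ η) {J : Finset I} {f : (I → Fin 2) → ℝ} (hf : DependsOn f (J : Set I))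
    (hfi : Integrable f (coinMeasure I))
    (hwi : Integrable (fun x => walshAt τ J ∅ f x ^ 2) (coinMeasure I))
    (h01 : ∀ x, f x = 0 ∨ f x = 1) (hm : ∫ x, f x ∂coinMeasure I ≤ η ^ (2 * M)) :
    ∫ x, walshAt τ J ∅ f x ^ 2 ∂coinMeasure I ≤ η * ∫ x, f x ∂coinMeasure I := by
  rw [← integral_cubeAvg_flipCoords J hwi]
  have : ∀ x, cubeAvg J (fun z => walshAt τ J ∅ f (flipCoords z x) ^ 2) ≤
      η * ∫ x, f x ∂coinMeasure I := fun x => by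
    have h := cubeAvg_cubeNoise_sq_le (τ := τ) hM hη J (F := fun z => f (flipCoords z x))
      (fun z => h01 _) (by rwa [cubeAvg_flipCoords_eq_integral hf hfi])
    rw [cubeAvg_flipCoords_eq_integral hf hfi] at h
    refine le_trans (le_of_eq ?_) h
    simp only [walshAt, cubeNoise, flipCoords_flipCoords]
  calc _ ≤ ∫ x, η * ∫ x, f x ∂coinMeasure I ∂coinMeasure I := by
        refine integral_mono_of_nonneg (Eventually.of_forall fun x => ?_) (integrable_const _)
          (Eventually.of_forall this)
        exact cubeAvg_nonneg fun z _ => sq_nonneg _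
    _ = _ := by simp

end

section
variable {I : Type*} [DecidableEq I] {τ : ℝ}

lemma abs_sq_sub_sq_le {l : ℝ} (hl : 0 < l) (a b : ℝ) :
    |a ^ 2 - b ^ 2| ≤ (2 * l)⁻¹ * (a - b) ^ 2 + l * a ^ 2 + l * b ^ 2 := by
  have h1 : a ^ 2 - b ^ 2 = (a - b) * (a + b) := by ring
  have h2 : (a + b) ^ 2 ≤ 2 * a ^ 2 + 2 * b ^ 2 := by nlinarith [sq_nonneg (a - b)]
  have h3 : |a - b| * |a + b| ≤ (2 * l)⁻¹ * |a - b| ^ 2 + l / 2 * |a + b| ^ 2 := by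
    have := sq_nonneg (|a - b| - l * |a + b|)
    rw [← sub_nonneg]
    have e : (2 * l)⁻¹ * |a - b| ^ 2 + l / 2 * |a + b| ^ 2 - |a - b| * |a + b| =
        (2 * l)⁻¹ * (|a - b| - l * |a + b|) ^ 2 := by
      field_simp; ring
    rw [e]; positivity
  rw [h1, abs_mul]
  rw [sq_abs, sq_abs] at h3
  nlinarith [h3, mul_le_mul_of_nonneg_left h2 (half_pos hl).le]

lemma sum_abs_walshNoise_sq_sub_le (h0 : 0 ≤ τ) (h1 : τ ≤ 1) {l : ℝ} (hl : 0 < l) (J : Finset I)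
    (F F' : Finset I → ℝ) :
    ∑ U ∈ J.powerset, |walshNoise τ J U F ^ 2 - walshNoise τ J U F' ^ 2| ≤
      (2 * l)⁻¹ * walshNoise τ J ∅ (fun z => (F z - F' z) ^ 2) +
        l * walshNoise τ J ∅ (fun z => F z ^ 2) + l * walshNoise τ J ∅ (fun z => F' z ^ 2) := by
  rw [← sum_walshNoise_sq h0 h1, ← sum_walshNoise_sq h0 h1, ← sum_walshNoise_sq h0 h1,
    Finset.mul_sum, Finset.mul_sum, Finset.mul_sum, ← Finset.sum_add_distrib,
    ← Finset.sum_add_distrib]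
  refine Finset.sum_le_sum fun U _ => ?_
  rw [walshNoise_sub]
  exact abs_sq_sub_sq_le hl _ _

lemma sum_walshNoise_fun {ι : Type*} (s : Finset ι) (J U : Finset I) (F : ι → Finset I → ℝ) :
    ∑ i ∈ s, walshNoise τ J U (F i) = walshNoise τ J U fun z => ∑ i ∈ s, F i z := by
  simp only [walshNoise, Finset.mul_sum]
  exact Finset.sum_comm

/-- Indicator of a level set of a labelling. -/
def labelInd {Y : Type*} (k : Y → ℕ) (i : ℕ) (x : Y) : ℝ := if k x = i then 1 else 0

lemma labelInd_sq {Y : Type*} (k : Y → ℕ) (i : ℕ) (x : Y) :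
    labelInd k i x ^ 2 = labelInd k i x := by simp [labelInd]

lemma sum_labelInd {Y : Type*} {k : Y → ℕ} {N : ℕ} {x : Y} (hx : k x < N) :
    ∑ i ∈ Finset.range N, labelInd k i x = 1 := by simp [labelInd, hx]

lemma sum_labelInd_sub_sq_le {Y : Type*} (k k' : Y → ℕ) (N : ℕ) (x : Y) :
    ∑ i ∈ Finset.range N, (labelInd k i x - labelInd k' i x) ^ 2 ≤
      2 * if k x ≠ k' x then 1 else 0 := by
  by_cases h : k x = k' x
  · simp [labelInd, h]
  · have : ∀ i ∈ Finset.range N, (labelInd k i x - labelInd k' i x) ^ 2 ≤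
        (if k x = i then 1 else 0) + (if k' x = i then 1 else 0) := fun i _ => by
      simp only [labelInd]; split_ifs <;> norm_num
    refine (Finset.sum_le_sum this).trans ?_
    rw [Finset.sum_add_distrib, Finset.sum_ite_eq, Finset.sum_ite_eq]
    simp only [ne_eq, h, not_false_iff, if_true]
    split_ifs <;> norm_num

end

section
variable {Γ : Type*} [DecidableEq Γ]

/-- The fraction of the coordinates in `U` lying over `γ`. -/
def walshWeight (U : Finset (Γ × ℕ)) (γ : Γ) : ℝ := (U.filter fun i => i.1 = γ).card / U.card

lemma walshWeight_nonneg (U : Finset (Γ × ℕ)) (γ : Γ) : 0 ≤ walshWeight U γ := by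
  unfold walshWeight; positivity

lemma sum_walshWeight_le (U : Finset (Γ × ℕ)) (G : Finset Γ) : ∑ γ ∈ G, walshWeight U γ ≤ 1 := by
  simp only [walshWeight]
  rw [← Finset.sum_div]
  refine div_le_one_of_le₀ ?_ (by positivity)
  rw [← Nat.cast_sum, ← Finset.card_biUnion fun a _ b _ hab =>
    Finset.disjoint_filter.2 fun i _ h1 h2 => hab (h1.symm.trans h2)]
  exact_mod_cast Finset.card_le_card (Finset.biUnion_subset.2 fun _ _ => Finset.filter_subset _ _)

lemma sum_walshWeight_eq {U : Finset (Γ × ℕ)} (hU : U.Nonempty) {G : Finset Γ}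
    (hG : U.image Prod.fst ⊆ G) : ∑ γ ∈ G, walshWeight U γ = 1 := by
  simp only [walshWeight]
  rw [← Finset.sum_div, ← Nat.cast_sum,
    ← Finset.card_eq_sum_card_fiberwise (f := Prod.fst)
      (fun i hi => hG (Finset.mem_image_of_mem _ hi))]
  have : (U.card : ℝ) ≠ 0 := by exact_mod_cast hU.card_pos.ne'
  exact div_self this

variable [Group Γ]

/-- The action of `s` on coordinates. -/
def shiftEquiv (s : Γ) : Γ × ℕ ≃ Γ × ℕ := (Equiv.mulLeft s).prodCongr (Equiv.refl ℕ)

/-- The shift on bit configurations. -/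
def bitShift (s : Γ) (x : Γ × ℕ → Fin 2) (i : Γ × ℕ) : Fin 2 := x (s⁻¹ * i.1, i.2)

omit [DecidableEq Γ] in
lemma measurePreserving_bitShift (s : Γ) :
    MeasurePreserving (bitShift s) (coinMeasure (Γ × ℕ)) (coinMeasure (Γ × ℕ)) :=
  measurePreserving_reindex (shiftEquiv s⁻¹)

lemma flipCoords_map_bitShift (s : Γ) (z : Finset (Γ × ℕ)) (x : Γ × ℕ → Fin 2) :
    flipCoords (z.map (shiftEquiv s).toEmbedding) (bitShift s x) = bitShift s (flipCoords z x) := by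
  ext ⟨h, n⟩
  have : ((h, n) ∈ z.map (shiftEquiv s).toEmbedding) ↔ (s⁻¹ * h, n) ∈ z := by
    constructor
    · rw [Finset.mem_map]
      rintro ⟨⟨a, b⟩, hab, he⟩
      simp only [shiftEquiv, Equiv.coe_toEmbedding, Equiv.prodCongr_apply, Prod.map, 
        Equiv.coe_mulLeft, Equiv.refl_apply, Prod.mk.injEq] at he
      obtain ⟨rfl, rfl⟩ := he
      simpa using hab
    · intro hz
      exact Finset.mem_map.2 ⟨_, hz, by simp [shiftEquiv]⟩
  simp only [flipCoords, bitShift, this]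

lemma walshWeight_map (s : Γ) (U : Finset (Γ × ℕ)) (γ : Γ) :
    walshWeight (U.map (shiftEquiv s).toEmbedding) (s * γ) = walshWeight U γ := by
  simp only [walshWeight, Finset.card_map, Finset.filter_map]
  congr 3
  ext i
  simp [shiftEquiv]

lemma walshAt_map_bitShift (τ : ℝ) (s : Γ) (J U : Finset (Γ × ℕ)) (f : (Γ × ℕ → Fin 2) → ℝ)
    (x : Γ × ℕ → Fin 2) :
    walshAt τ (J.map (shiftEquiv s).toEmbedding) (U.map (shiftEquiv s).toEmbedding) f
      (bitShift s x) = walshAt τ J U (fun y => f (bitShift s y)) x := by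
  simp only [walshAt, walshNoise_map_equiv, flipCoords_map_bitShift]

/-- The energy density of a labelling, localised over group elements. -/
def reiterDensity (τ : ℝ) (J : Finset (Γ × ℕ)) (N : ℕ) (k : (Γ × ℕ → Fin 2) → ℕ)
    (x : Γ × ℕ → Fin 2) (γ : Γ) : ℝ :=
  ∑ i ∈ Finset.range N, ∑ U ∈ J.powerset, walshAt τ J U (labelInd k i) x ^ 2 * walshWeight U γ

omit [Group Γ] in
lemma reiterDensity_eq_of_subset {τ : ℝ} {J₀ J : Finset (Γ × ℕ)} (h : J₀ ⊆ J) {N : ℕ}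
    {k : (Γ × ℕ → Fin 2) → ℕ} (hk : DependsOn k (J₀ : Set (Γ × ℕ))) (x : Γ × ℕ → Fin 2) (γ : Γ) :
    reiterDensity τ J N k x γ = reiterDensity τ J₀ N k x γ := by
  refine Finset.sum_congr rfl fun i _ => ?_
  refine sum_walshNoise_sq_mul_of_subset h _ (fun j hj z => ?_) _
  simp only [labelInd]
  rw [flipCoords_insert_of_dependsOn hk hj]

lemma reiterDensity_bitShift {τ : ℝ} (J : Finset (Γ × ℕ)) (N : ℕ)
    (k : (Γ × ℕ → Fin 2) → ℕ) (s : Γ) (x : Γ × ℕ → Fin 2) (γ : Γ) :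
    reiterDensity τ (J.map (shiftEquiv s).toEmbedding) N k (bitShift s x) (s * γ) =
      reiterDensity τ J N (fun y => k (bitShift s y)) x γ := by
  refine Finset.sum_congr rfl fun i _ => ?_
  rw [sum_powerset_map_equiv]
  refine Finset.sum_congr rfl fun U _ => ?_
  rw [walshAt_map_bitShift, walshWeight_map]
  rfl

omit [DecidableEq Γ] in
lemma dependsOn_comp_bitShift {β : Type*} {k : (Γ × ℕ → Fin 2) → β} {J : Finset (Γ × ℕ)} (s : Γ)
    (hk : DependsOn k ((J.map (shiftEquiv s).toEmbedding : Finset (Γ × ℕ)) : Set (Γ × ℕ))) :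
    DependsOn (fun y => k (bitShift s y)) (J : Set (Γ × ℕ)) := by
  intro x y hxy
  refine hk fun i hi => ?_
  obtain ⟨j, hj, rfl⟩ := Finset.mem_map.1 (Finset.mem_coe.1 hi)
  have e : ∀ w : Γ × ℕ → Fin 2, bitShift s w ((shiftEquiv s).toEmbedding j) = w j := fun w => by
    simp [bitShift, shiftEquiv, Prod.map]
  rw [e, e]
  exact hxy j hj

lemma sum_abs_reiterDensity_sub_le {τ : ℝ} (h0 : 0 ≤ τ) (h1 : τ ≤ 1) {l : ℝ} (hl : 0 < l)
    {J₀ : Finset (Γ × ℕ)} {N : ℕ} {k : (Γ × ℕ → Fin 2) → ℕ} (hk : DependsOn k (J₀ : Set (Γ × ℕ)))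
    (hkN : ∀ x, k x < N) (s : Γ) : ∃ J : Finset (Γ × ℕ), ∀ (G : Finset Γ) (x : Γ × ℕ → Fin 2),
    ∑ γ ∈ G, |reiterDensity τ J₀ N k x γ - reiterDensity τ J₀ N k (bitShift s x) (s * γ)| ≤
      l⁻¹ * walshAt τ J ∅ (fun y => if k y ≠ k (bitShift s y) then 1 else 0) x + 2 * l := by
  set J₁ := J₀.map (shiftEquiv s).symm.toEmbedding with hJ₁
  have hJ : J₁.map (shiftEquiv s).toEmbedding = J₀ := by simp [hJ₁, Finset.map_map]
  refine ⟨J₀ ∪ J₁, fun G x => ?_⟩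
  set J := J₀ ∪ J₁
  set k' := fun y => k (bitShift s y)
  have hk' : DependsOn k' (J₁ : Set (Γ × ℕ)) := dependsOn_comp_bitShift s (by rwa [hJ])
  have e1 : ∀ γ, reiterDensity τ J₀ N k x γ = reiterDensity τ J N k x γ := fun γ =>
    (reiterDensity_eq_of_subset Finset.subset_union_left hk x γ).symm
  have e2 : ∀ γ, reiterDensity τ J₀ N k (bitShift s x) (s * γ) = reiterDensity τ J N k' x γ :=
    fun γ => by
      rw [reiterDensity_eq_of_subset Finset.subset_union_right hk' x γ,
        ← reiterDensity_bitShift, hJ]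
  simp only [e1, e2]
  calc ∑ γ ∈ G, |reiterDensity τ J N k x γ - reiterDensity τ J N k' x γ|
      ≤ ∑ γ ∈ G, ∑ i ∈ Finset.range N, ∑ U ∈ J.powerset,
        |walshAt τ J U (labelInd k i) x ^ 2 - walshAt τ J U (labelInd k' i) x ^ 2| *
          walshWeight U γ := by
        refine Finset.sum_le_sum fun γ _ => ?_
        simp only [reiterDensity]
        rw [← Finset.sum_sub_distrib]
        refine (Finset.abs_sum_le_sum_abs _ _).trans (Finset.sum_le_sum fun i _ => ?_)
        rw [← Finset.sum_sub_distrib]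
        refine (Finset.abs_sum_le_sum_abs _ _).trans (Finset.sum_le_sum fun U _ => ?_)
        rw [← sub_mul, abs_mul, abs_of_nonneg (walshWeight_nonneg U γ)]
    _ = ∑ i ∈ Finset.range N, ∑ U ∈ J.powerset,
        |walshAt τ J U (labelInd k i) x ^ 2 - walshAt τ J U (labelInd k' i) x ^ 2| *
          ∑ γ ∈ G, walshWeight U γ := by
        rw [Finset.sum_comm]
        refine Finset.sum_congr rfl fun i _ => ?_
        rw [Finset.sum_comm]
        simp only [Finset.mul_sum]
    _ ≤ ∑ i ∈ Finset.range N, ∑ U ∈ J.powerset,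
        |walshAt τ J U (labelInd k i) x ^ 2 - walshAt τ J U (labelInd k' i) x ^ 2| := by
        refine Finset.sum_le_sum fun i _ => Finset.sum_le_sum fun U _ => ?_
        exact mul_le_of_le_one_right (abs_nonneg _) (sum_walshWeight_le U G)
    _ ≤ ∑ i ∈ Finset.range N, ((2 * l)⁻¹ * walshNoise τ J ∅ (fun z =>
          (labelInd k i (flipCoords z x) - labelInd k' i (flipCoords z x)) ^ 2) +
        l * walshNoise τ J ∅ (fun z => labelInd k i (flipCoords z x)) +
        l * walshNoise τ J ∅ (fun z => labelInd k' i (flipCoords z x))) := by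
        refine Finset.sum_le_sum fun i _ => ?_
        have := sum_abs_walshNoise_sq_sub_le h0 h1 hl J
          (fun z => labelInd k i (flipCoords z x)) (fun z => labelInd k' i (flipCoords z x))
        simpa only [labelInd_sq, walshAt] using this
    _ ≤ _ := by
        rw [Finset.sum_add_distrib, Finset.sum_add_distrib, ← Finset.mul_sum, ← Finset.mul_sum,
          ← Finset.mul_sum, sum_walshNoise_fun, sum_walshNoise_fun, sum_walshNoise_fun]
        have a1 : (fun z => ∑ i ∈ Finset.range N, labelInd k i (flipCoords z x)) = fun _ => 1 := by
          ext z; exact sum_labelInd (hkN _)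
        have a2 : (fun z => ∑ i ∈ Finset.range N, labelInd k' i (flipCoords z x)) = fun _ => 1 := by
          ext z; exact sum_labelInd (hkN _)
        rw [a1, a2, walshNoise_empty_one]
        have a3 : walshNoise τ J ∅ (fun z => ∑ i ∈ Finset.range N,
            (labelInd k i (flipCoords z x) - labelInd k' i (flipCoords z x)) ^ 2) ≤
            2 * walshAt τ J ∅ (fun y => if k y ≠ k (bitShift s y) then 1 else 0) x := by
          rw [walshAt, walshNoise, walshNoise, Finset.mul_sum]
          refine Finset.sum_le_sum fun z _ => ?_
          rw [mul_left_comm]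
          exact mul_le_mul_of_nonneg_left (sum_labelInd_sub_sq_le k k' N _)
            (noiseCoeff_empty_nonneg h0 h1 J z)
        have := mul_le_mul_of_nonneg_left a3 (show 0 ≤ (2 * l)⁻¹ by positivity)
        rw [mul_inv] at this ⊢
        linarith
end

section
variable {I : Type*} [DecidableEq I] {τ : ℝ}

lemma setIntegral_walshAt_ite_le (h0 : 0 ≤ τ) (h1 : τ ≤ 1) (J K : Finset I)
    {E E' D : Set (I → Fin 2)} [DecidablePred (· ∈ D)] (hE : MeasurableSet E)
    (hD : MeasurableSet D) (hE' : ∀ x y, (∀ j ∈ K, x j = y j) → (x ∈ E' ↔ y ∈ E')) :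
    ∫ x in E, walshAt τ J ∅ (fun y => if y ∈ D then 1 else 0) x ∂coinMeasure I ≤
      (coinMeasure I).real (E ∩ D) + 2 * (coinMeasure I).real (symmDiff E' E) + K.card * τ := by
  set ν := coinMeasure I
  have hpre : ∀ z : Finset I, MeasurableSet (flipCoords z ⁻¹' D) := fun z =>
    measurable_flipCoords z hD
  have hind : ∀ z : Finset I, (fun x : I → Fin 2 => if flipCoords z x ∈ D then (1 : ℝ) else 0) =
      (flipCoords z ⁻¹' D).indicator 1 := fun z => by
    ext x; simp [indicator]
  have hbd : ∀ z : Finset I, ν.real (E ∩ flipCoords z ⁻¹' D) ≤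
      (ν.real (E ∩ D) + 2 * ν.real (symmDiff E' E)) + if (z ∩ K).Nonempty then 1 else 0 := by
    intro z
    split_ifs with hz
    · have := measureReal_nonneg (μ := ν) (s := E ∩ D)
      have := measureReal_nonneg (μ := ν) (s := symmDiff E' E)
      have := measureReal_le_one (μ := ν) (s := E ∩ flipCoords z ⁻¹' D)
      linarith
    · have hp := measurePreserving_flipCoords z
      have hinv : ∀ x : I → Fin 2, flipCoords z (flipCoords z x) = x := fun x => by
        rw [flipCoords_flipCoords, symmDiff_self]; exact flipCoords_empty x
      have e1 : ν.real (E ∩ flipCoords z ⁻¹' D) = ν.real (flipCoords z ⁻¹' E ∩ D) := by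
        rw [← hp.measureReal_preimage (hE.inter (hpre z)).nullMeasurableSet, preimage_inter]
        congr 2
        ext x
        simp [hinv]
      have hEE : ∀ x, flipCoords z x ∈ E' ↔ x ∈ E' := fun x => hE' _ _ fun j hj => by
        have : j ∉ z := fun h => hz ⟨j, Finset.mem_inter.2 ⟨h, hj⟩⟩
        simp [flipCoords, this]
      have e2 : flipCoords z ⁻¹' E ∩ D ⊆
          (E ∩ D) ∪ (symmDiff E' E ∪ flipCoords z ⁻¹' (symmDiff E' E)) := by
        rintro x ⟨hx, hxD⟩
        by_cases hxE : x ∈ E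
        · exact Or.inl ⟨hxE, hxD⟩
        · right
          by_cases hx' : x ∈ E'
          · exact Or.inl (Or.inl ⟨hx', hxE⟩)
          · exact Or.inr (Or.inr ⟨hx, fun h => hx' ((hEE x).1 h)⟩)
      have e3 : ν.real (flipCoords z ⁻¹' (symmDiff E' E)) = ν.real (symmDiff E' E) := by
        refine hp.measureReal_preimage (MeasurableSet.nullMeasurableSet ?_)
        refine MeasurableSet.symmDiff ?_ hE
        have hd : DependsOn (fun x => x ∈ E') (K : Set I) := fun x y hxy => propext (hE' x y hxy)
        exact measurableSet_setOfPred.2 (measurable_of_dependsOn_finset hd)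
      rw [e1]
      refine (measureReal_mono e2).trans ((measureReal_union_le _ _).trans ?_)
      have := measureReal_union_le (μ := ν) (symmDiff E' E) (flipCoords z ⁻¹' (symmDiff E' E))
      rw [e3] at this
      linarith
  calc ∫ x in E, walshAt τ J ∅ (fun y => if y ∈ D then 1 else 0) x ∂ν
      = ∑ z ∈ J.powerset, noiseCoeff τ J ∅ z * ν.real (E ∩ flipCoords z ⁻¹' D) := by
        simp only [walshAt, walshNoise]
        rw [integral_finsetSum]
        · refine Finset.sum_congr rfl fun z _ => ?_
          rw [integral_const_mul, hind, integral_indicator_one (hpre z),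
            measureReal_restrict_apply (hpre z), inter_comm]
        · intro z _
          refine Integrable.const_mul ?_ _
          rw [hind]
          exact (integrable_const (1 : ℝ)).indicator (hpre z)
    _ ≤ ∑ z ∈ J.powerset, (noiseCoeff τ J ∅ z * ((ν.real (E ∩ D) + 2 * ν.real (symmDiff E' E)) *
          1) + noiseCoeff τ J ∅ z * if (z ∩ K).Nonempty then 1 else 0) := by
        refine Finset.sum_le_sum fun z _ => ?_
        rw [← mul_add, mul_one]
        exact mul_le_mul_of_nonneg_left (hbd z) (noiseCoeff_empty_nonneg h0 h1 J z)
    _ = (ν.real (E ∩ D) + 2 * ν.real (symmDiff E' E)) * walshNoise τ J ∅ (fun _ => 1) +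
          walshNoise τ J ∅ (fun z => if (z ∩ K).Nonempty then 1 else 0) := by
        rw [Finset.sum_add_distrib, walshNoise, walshNoise, Finset.mul_sum]
        congr 1
        exact Finset.sum_congr rfl fun z _ => by ring
    _ ≤ _ := by
        rw [walshNoise_empty_one, mul_one]
        gcongr
        exact walshNoise_inter_nonempty_le h0 h1 J K

omit [DecidableEq I] in
lemma exists_label_approx {k : (I → Fin 2) → ℕ} (hk : Measurable k) {N : ℕ} (hN : ∀ x, k x < N)
    {ρ : ℝ} (hρ : 0 < ρ) : ∃ (J : Finset I) (l : (I → Fin 2) → ℕ), DependsOn l (J : Set I) ∧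
      (∀ x, l x < N) ∧ (coinMeasure I).real {x | k x ≠ l x} ≤ ρ := by
  classical
  have hN0 : 0 < N := (Nat.zero_le _).trans_lt (hN fun _ => 0)
  choose J C _ hC hCk using fun i => exists_cylinder_approx
    (measurableSet_eq_fun hk (measurable_const (a := i))) (show 0 < ρ / N by positivity)
  set l : (I → Fin 2) → ℕ := fun x => sInf {i | i < N ∧ x ∈ C i}
  refine ⟨(Finset.range N).biUnion J, l, fun x y hxy => ?_, fun x => ?_, ?_⟩
  · simp only [l]
    congr 1
    ext i
    refine and_congr_right fun hi => hC i x y fun j hj => hxy j ?_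
    simp only [Finset.coe_biUnion, mem_iUnion]
    exact ⟨i, Finset.mem_coe.2 (Finset.mem_range.2 hi), hj⟩
  · rcases Set.eq_empty_or_nonempty {i | i < N ∧ x ∈ C i} with h | h
    · simp only [l, h, Nat.sInf_empty, hN0]
    · exact (Nat.sInf_mem h).1
  · have hsub : {x | k x ≠ l x} ⊆ ⋃ i ∈ Finset.range N, symmDiff (C i) {x | k x = i} := by
      intro x hx
      by_contra hcon
      refine hx ?_
      simp only [mem_iUnion, not_exists, Finset.mem_range] at hcon
      have : ∀ i < N, (x ∈ C i ↔ k x = i) := fun i hi => by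
        have := hcon i hi
        simp only [mem_symmDiff, mem_ofPred_eq] at this
        tauto
      have hs : {i | i < N ∧ x ∈ C i} = {k x} := by
        ext i
        constructor
        · rintro ⟨h1, h2⟩; exact ((this i h1).1 h2).symm
        · rintro rfl; exact ⟨hN x, (this _ (hN x)).2 rfl⟩
      simp only [l, hs, csInf_singleton]
    calc _ ≤ (coinMeasure I).real (⋃ i ∈ Finset.range N, symmDiff (C i) {x | k x = i}) :=
          measureReal_mono hsub (measure_ne_top _ _)
      _ ≤ ∑ i ∈ Finset.range N, (coinMeasure I).real (symmDiff (C i) {x | k x = i}) :=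
          measureReal_biUnion_finset_le _ _
      _ ≤ ∑ i ∈ Finset.range N, ρ / N := Finset.sum_le_sum fun i _ => (hCk i).le
      _ = ρ := by
          rw [Finset.sum_const, Finset.card_range, nsmul_eq_mul]
          field_simp

end

section
variable {I : Type*} [DecidableEq I] {τ : ℝ}

lemma abs_walshAt_le (J U : Finset I) {f : (I → Fin 2) → ℝ} (hf : ∀ x, |f x| ≤ 1)
    (x : I → Fin 2) : |walshAt τ J U f x| ≤ ∑ z ∈ J.powerset, |noiseCoeff τ J U z| :=
  (Finset.abs_sum_le_sum_abs _ _).trans <| Finset.sum_le_sum fun z _ => by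
    rw [abs_mul]; exact mul_le_of_le_one_right (abs_nonneg _) (hf _)

lemma integrable_walshAt (J U : Finset I) {f : (I → Fin 2) → ℝ} (hf : ∀ x, |f x| ≤ 1)
    (hm : Measurable f) (ν : Measure (I → Fin 2)) [IsFiniteMeasure ν] :
    Integrable (walshAt τ J U f) ν :=
  Integrable.of_bound (measurable_walshAt hm).aestronglyMeasurable _
    (Eventually.of_forall fun x => abs_walshAt_le J U hf x)

lemma integrable_walshAt_sq (J U : Finset I) {f : (I → Fin 2) → ℝ} (hf : ∀ x, |f x| ≤ 1)
    (hm : Measurable f) (ν : Measure (I → Fin 2)) [IsFiniteMeasure ν] :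
    Integrable (fun x => walshAt τ J U f x ^ 2) ν :=
  Integrable.of_bound ((measurable_walshAt hm).pow_const 2).aestronglyMeasurable
    ((∑ z ∈ J.powerset, |noiseCoeff τ J U z|) ^ 2)
    (Eventually.of_forall fun x => by
      rw [norm_pow]; exact pow_le_pow_left₀ (norm_nonneg _) (abs_walshAt_le J U hf x) 2)

omit [DecidableEq I] in
lemma abs_labelInd_le {Y : Type*} (k : Y → ℕ) (i : ℕ) (x : Y) : |labelInd k i x| ≤ 1 := by
  unfold labelInd; split_ifs <;> simp

end

section
variable {Γ : Type*} [DecidableEq Γ]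

lemma reiterDensity_nonneg (τ : ℝ) (J : Finset (Γ × ℕ)) (N : ℕ) (k : (Γ × ℕ → Fin 2) → ℕ)
    (x : Γ × ℕ → Fin 2) (γ : Γ) : 0 ≤ reiterDensity τ J N k x γ :=
  Finset.sum_nonneg fun _ _ => Finset.sum_nonneg fun _ _ =>
    mul_nonneg (sq_nonneg _) (walshWeight_nonneg _ _)

lemma reiterDensity_eq_zero (τ : ℝ) {J : Finset (Γ × ℕ)} (N : ℕ) (k : (Γ × ℕ → Fin 2) → ℕ)
    (x : Γ × ℕ → Fin 2) {γ : Γ} (hγ : γ ∉ J.image Prod.fst) : reiterDensity τ J N k x γ = 0 :=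
  Finset.sum_eq_zero fun _ _ => Finset.sum_eq_zero fun U hU => by
    have : U.filter (fun i => i.1 = γ) = ∅ := Finset.filter_eq_empty_iff.2 fun i hi h =>
      hγ (Finset.mem_image.2 ⟨i, Finset.mem_powerset.1 hU hi, h⟩)
    simp [walshWeight, this]

lemma sum_reiterDensity {τ : ℝ} (h0 : 0 ≤ τ) (h1 : τ ≤ 1) (J : Finset (Γ × ℕ)) {N : ℕ}
    {k : (Γ × ℕ → Fin 2) → ℕ} (hN : ∀ x, k x < N) (x : Γ × ℕ → Fin 2) :
    ∑ γ ∈ J.image Prod.fst, reiterDensity τ J N k x γ =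
      1 - ∑ i ∈ Finset.range N, walshAt τ J ∅ (labelInd k i) x ^ 2 := by
  have hw : ∀ U ∈ J.powerset, ∑ γ ∈ J.image Prod.fst, walshWeight U γ =
      1 - if U = ∅ then 1 else 0 := fun U hU => by
    split_ifs with h
    · subst h; simp [walshWeight]
    · rw [sum_walshWeight_eq (Finset.nonempty_iff_ne_empty.2 h)
        (Finset.image_subset_image (Finset.mem_powerset.1 hU)), sub_zero]
  calc ∑ γ ∈ J.image Prod.fst, reiterDensity τ J N k x γ
      = ∑ i ∈ Finset.range N, ∑ U ∈ J.powerset, walshAt τ J U (labelInd k i) x ^ 2 *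
          ∑ γ ∈ J.image Prod.fst, walshWeight U γ := by
        simp only [reiterDensity]
        rw [Finset.sum_comm]
        refine Finset.sum_congr rfl fun i _ => ?_
        rw [Finset.sum_comm]
        simp only [Finset.mul_sum]
    _ = ∑ i ∈ Finset.range N, (walshNoise τ J ∅ (fun z => labelInd k i (flipCoords z x)) -
          walshAt τ J ∅ (labelInd k i) x ^ 2) := by
        refine Finset.sum_congr rfl fun i _ => ?_
        rw [Finset.sum_congr rfl fun U hU => by rw [hw U hU, mul_sub, mul_one],
          Finset.sum_sub_distrib]
        have := sum_walshNoise_sq h0 h1 J fun z => labelInd k i (flipCoords z x)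
        simp only [labelInd_sq] at this
        simp only [walshAt, this]
        simp
    _ = _ := by
        rw [Finset.sum_sub_distrib, sum_walshNoise_fun]
        simp only [sum_labelInd (hN _)]
        rw [walshNoise_empty_one]

variable [Group Γ]

/-- Small almost invariant partitions produce almost invariant maps to `ℓ¹(Γ)`. -/
lemma exists_reiter (S : Finset Γ) {E : Γ → Set (Γ × ℕ → Fin 2)} (hE : ∀ s, MeasurableSet (E s))
    (hSP : ∀ ε > 0, ∀ δ > 0, ∃ (N : ℕ) (k : (Γ × ℕ → Fin 2) → ℕ), Measurable k ∧ (∀ x, k x < N) ∧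
      (∀ i, (coinMeasure (Γ × ℕ)).real {x | k x = i} ≤ ε) ∧
      ∀ s ∈ S, (coinMeasure (Γ × ℕ)).real {x | x ∈ E s ∧ k x ≠ k (bitShift s x)} ≤ δ)
    {η : ℝ} (hη : 0 < η) :
    ∃ (G : Finset Γ) (p : (Γ × ℕ → Fin 2) → Γ → ℝ), (∀ γ, Measurable fun x => p x γ) ∧
      (∀ x γ, 0 ≤ p x γ) ∧ (∀ x, ∀ γ ∉ G, p x γ = 0) ∧ (∀ x, ∑ γ ∈ G, p x γ ≤ 1) ∧
      1 - η ≤ ∫ x, ∑ γ ∈ G, p x γ ∂coinMeasure (Γ × ℕ) ∧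
      ∀ s ∈ S, ∀ G' : Finset Γ, ∫ x in E s, ∑ γ ∈ G', |p x γ - p (bitShift s x) (s * γ)|
        ∂coinMeasure (Γ × ℕ) ≤ η := by
  set ν := coinMeasure (Γ × ℕ)
  have hq : 0 < η ^ 2 / 64 := by positivity
  choose K E' _ hE' hEE using fun s => exists_cylinder_approx (hE s) hq
  obtain ⟨C, hC, hC0⟩ : ∃ C : ℝ, (∀ s ∈ S, ((K s).card : ℝ) ≤ C) ∧ 0 ≤ C :=
    ⟨∑ s ∈ S, ((K s).card : ℝ), fun s hs =>
      Finset.single_le_sum (f := fun s => ((K s).card : ℝ)) (fun _ _ => Nat.cast_nonneg _) hs,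
      Finset.sum_nonneg fun _ _ => Nat.cast_nonneg _⟩
  have hC1 : 0 < C + 1 := by linarith
  obtain ⟨τ, hτ⟩ : ∃ τ : ℝ, τ = min (1 / 4) (η ^ 2 / 64 / (C + 1)) := ⟨_, rfl⟩
  have hτ0 : 0 < τ := hτ ▸ lt_min (by norm_num) (div_pos hq hC1)
  have hτ1 : τ ≤ 1 / 4 := hτ ▸ min_le_left _ _
  have hτC : ∀ s ∈ S, (K s).card * τ ≤ η ^ 2 / 64 := fun s hs => by
    calc (K s).card * τ ≤ (C + 1) * (η ^ 2 / 64 / (C + 1)) := by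
          gcongr
          · linarith [hC s hs]
          · exact hτ ▸ min_le_right _ _
      _ = η ^ 2 / 64 := mul_div_cancel₀ _ hC1.ne'
  obtain ⟨M, hM⟩ := exists_pow_lt_of_lt_one (show (0 : ℝ) < 1 / 3 by norm_num)
    (show (1 - 2 * τ) ^ 2 < 1 by nlinarith)
  have hηM : 0 < η ^ (2 * M) := by positivity
  obtain ⟨N, k, hk, hkN, hkat, hkinv⟩ := hSP (η ^ (2 * M) / 2) (by positivity) (η ^ 2 / 64) hq
  set ρ := min (η ^ (2 * M) / 2) (η ^ 2 / 64 / 2)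
  obtain ⟨J, l, hl, hlN, hlk⟩ := exists_label_approx hk hkN
    (show 0 < ρ from lt_min (by positivity) (by positivity))
  have hlm : Measurable l := measurable_of_dependsOn_finset hl
  have hflm : ∀ i, Measurable (labelInd l i) := fun i =>
    Measurable.ite (measurableSet_eq_fun hlm measurable_const) measurable_const measurable_const
  have hfli : ∀ i, Integrable (labelInd l i) ν := fun i =>
    Integrable.of_bound (hflm i).aestronglyMeasurable 1
      (Eventually.of_forall fun x => abs_labelInd_le l i x)
  have hInt : ∀ i, ∫ x, labelInd l i x ∂ν = ν.real {x | l x = i} := fun i => by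
    have : labelInd l i = {x | l x = i}.indicator 1 := by ext x; simp [labelInd, indicator]
    rw [this, integral_indicator_one (measurableSet_eq_fun hlm measurable_const)]
  have hlat : ∀ i, ν.real {x | l x = i} ≤ η ^ (2 * M) := fun i => by
    have hs : {x | l x = i} ⊆ {x | k x = i} ∪ {x | k x ≠ l x} := fun x (hx : l x = i) => by
      by_cases h : k x = i
      · exact Or.inl h
      · exact Or.inr fun h' => h (h'.trans hx)
    have := (measureReal_mono hs (measure_ne_top ν _)).trans (measureReal_union_le _ _)
    linarith [hkat i, hlk.trans (min_le_left _ _)]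
  refine ⟨J.image Prod.fst, reiterDensity τ J N l, fun γ => ?_,
    reiterDensity_nonneg _ _ _ _, fun x γ => reiterDensity_eq_zero _ _ _ _, fun x => ?_, ?_,
    fun s hs G' => ?_⟩
  · exact Finset.measurable_sum _ fun i _ => Finset.measurable_sum _ fun U _ =>
      ((measurable_walshAt (hflm i)).pow_const 2).mul_const _
  · rw [sum_reiterDensity hτ0.le (by linarith) J hlN]
    linarith [Finset.sum_nonneg fun i (_ : i ∈ Finset.range N) =>
      sq_nonneg (walshAt τ J ∅ (labelInd l i) x)]
  · simp only [sum_reiterDensity hτ0.le (by linarith : τ ≤ 1) J hlN]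
    have hi : ∀ i ∈ Finset.range N, Integrable (fun x => walshAt τ J ∅ (labelInd l i) x ^ 2) ν :=
      fun i _ => integrable_walshAt_sq J ∅ (abs_labelInd_le l i) (hflm i) ν
    rw [integral_sub (integrable_const _) (integrable_finsetSum _ hi), integral_finsetSum _ hi]
    have hb : ∀ i ∈ Finset.range N, ∫ x, walshAt τ J ∅ (labelInd l i) x ^ 2 ∂ν ≤
        η * ∫ x, labelInd l i x ∂ν := fun i hiN => by
      refine integral_walshAt_empty_sq_le hM.le hη.le (fun x y hxy => ?_) (hfli i) (hi i hiN)
        (fun x => ?_) ?_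
      · simp only [labelInd, hl hxy]
      · unfold labelInd; split_ifs <;> simp
      · rw [hInt]; exact hlat i
    have := Finset.sum_le_sum hb
    rw [← Finset.mul_sum, ← integral_finsetSum _ fun i _ => hfli i] at this
    simp only [sum_labelInd (hlN _)] at this
    simp at this ⊢
    linarith
  · obtain ⟨J', hJ'⟩ := sum_abs_reiterDensity_sub_le hτ0.le (by linarith : τ ≤ 1)
      (show 0 < η / 4 by positivity) hl hlN s
    have hDm : MeasurableSet {x | l x ≠ l (bitShift s x)} := (measurableSet_eq_fun hlm
      (hlm.comp (measurePreserving_bitShift s).measurable)).compl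
    have hD : ν.real (E s ∩ {x | l x ≠ l (bitShift s x)}) ≤ 2 * (η ^ 2 / 64) := by
      have hs' : E s ∩ {x | l x ≠ l (bitShift s x)} ⊆ {x | x ∈ E s ∧ k x ≠ k (bitShift s x)} ∪
          ({x | k x ≠ l x} ∪ bitShift s ⁻¹' {x | k x ≠ l x}) := by
        rintro x ⟨hx, hx'⟩
        by_cases h1 : k x = l x
        · by_cases h2 : k (bitShift s x) = l (bitShift s x)
          · exact Or.inl ⟨hx, by rw [h1, h2]; exact hx'⟩
          · exact Or.inr (Or.inr h2)
        · exact Or.inr (Or.inl h1)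
      have e := (measurePreserving_bitShift s).measureReal_preimage
        (measurableSet_eq_fun hk hlm).compl.nullMeasurableSet
      have e' : ν.real (bitShift s ⁻¹' {x | k x ≠ l x}) = ν.real {x | k x ≠ l x} := e
      have := (measureReal_mono hs' (measure_ne_top ν _)).trans (measureReal_union_le _ _)
      have := measureReal_union_le (μ := ν) {x | k x ≠ l x} (bitShift s ⁻¹' {x | k x ≠ l x})
      have := hkinv s hs
      have := hlk.trans (min_le_right _ _)
      linarith
    have hW := setIntegral_walshAt_ite_le hτ0.le (by linarith : τ ≤ 1) J' (K s) (hE s) hDm (hE' s)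
    have hWi : Integrable (walshAt τ J' ∅ fun y => if l y ≠ l (bitShift s y) then 1 else 0)
        (ν.restrict (E s)) := by
      refine integrable_walshAt J' ∅ (fun x => ?_) ?_ _
      · split_ifs <;> simp
      · exact Measurable.ite hDm measurable_const measurable_const
    calc ∫ x in E s, ∑ γ ∈ G', |reiterDensity τ J N l x γ -
          reiterDensity τ J N l (bitShift s x) (s * γ)| ∂ν
        ≤ ∫ x in E s, ((η / 4)⁻¹ * walshAt τ J' ∅
            (fun y => if l y ≠ l (bitShift s y) then 1 else 0) x + 2 * (η / 4)) ∂ν :=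
          integral_mono_of_nonneg (Eventually.of_forall fun x =>
            Finset.sum_nonneg fun _ _ => abs_nonneg _) ((hWi.const_mul _).add (integrable_const _))
            (Eventually.of_forall fun x => hJ' G' x)
      _ = (η / 4)⁻¹ * ∫ x in E s, walshAt τ J' ∅
            (fun y => if l y ≠ l (bitShift s y) then 1 else 0) x ∂ν +
            ν.real (E s) * (2 * (η / 4)) := by
          rw [integral_add (hWi.const_mul _) (integrable_const _), integral_const_mul]
          simp
      _ ≤ (η / 4)⁻¹ * (8 * (η ^ 2 / 64)) + 1 * (2 * (η / 4)) := by
          gcongr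
          · refine le_trans hW ?_
            linarith [hτC s hs, hEE s]
          · exact measureReal_le_one
      _ = η := by field_simp; ring
end

section
open Classical
variable {Γ : Type*} [Group Γ]

/-- A finitely supported nonnegative function on a group has large total variation if all finite
sets have large boundary. -/
lemma mul_sum_le_sum_posPart {B : Γ → Prop} {r : Γ → Γ → Prop} (hr : Equivalence r) (S : Finset Γ)
    {ε : ℝ} (G : Finset Γ)
    (h : ∀ T ⊆ G, T.Nonempty → (∀ γ ∈ T, B γ) → (∀ γ ∈ T, ∀ γ' ∈ T, r γ γ') → ∃ s ∈ S,
      ε * T.card ≤ (T.filter fun γ => s * γ ∉ T ∧ B (s * γ) ∧ r γ (s * γ)).card) :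
    ∀ (n : ℕ) (P : Γ → ℝ), (G.filter fun γ => B γ ∧ P γ ≠ 0).card = n → (∀ γ, 0 ≤ P γ) →
      (∀ γ ∉ G, P γ = 0) → ε * ∑ γ ∈ G, (if B γ then P γ else 0) ≤
        ∑ s ∈ S, ∑ γ ∈ G, if B γ ∧ B (s * γ) ∧ r γ (s * γ) then max (P γ - P (s * γ)) 0 else 0 := by
  intro n
  induction n using Nat.strong_induction_on with | _ n ih => ?_
  intro P hn hP hPG
  rcases (G.filter fun γ => B γ ∧ P γ ≠ 0).eq_empty_or_nonempty with he | hne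
  · have : ∀ γ ∈ G, (if B γ then P γ else 0) = 0 := fun γ hγ => by
      by_contra h0
      have : γ ∈ (∅ : Finset Γ) := by
        rw [← he, Finset.mem_filter]
        split_ifs at h0 with hB
        · exact ⟨hγ, hB, h0⟩
        · exact absurd rfl h0
      simp at this
    rw [Finset.sum_eq_zero this, mul_zero]
    exact Finset.sum_nonneg fun _ _ => Finset.sum_nonneg fun _ _ => by
      split_ifs
      · exact le_max_right _ _
      · exact le_rfl
  obtain ⟨γ₀, hγ₀, hmin⟩ := Finset.exists_min_image _ P hne
  simp only [Finset.mem_filter] at hγ₀ hmin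
  set m := P γ₀
  have hm : 0 ≤ m := hP _
  set T := G.filter fun γ => (B γ ∧ P γ ≠ 0) ∧ r γ₀ γ
  have hTm : ∀ γ, γ ∈ T ↔ γ ∈ G ∧ (B γ ∧ P γ ≠ 0) ∧ r γ₀ γ := fun γ => Finset.mem_filter
  have hγT : γ₀ ∈ T := (hTm _).2 ⟨hγ₀.1, hγ₀.2, hr.refl _⟩
  set P' : Γ → ℝ := fun γ => if γ ∈ T then P γ - m else P γ
  have hP'0 : ∀ γ, 0 ≤ P' γ := fun γ => by
    by_cases hγ : γ ∈ T
    · simp only [P', if_pos hγ, sub_nonneg]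
      exact hmin γ ⟨((hTm γ).1 hγ).1, ((hTm γ).1 hγ).2.1⟩
    · simp only [P', if_neg hγ]; exact hP γ
  have hP'le : ∀ γ, P' γ ≤ P γ := fun γ => by
    simp only [P']; split_ifs <;> linarith
  have hP'G : ∀ γ ∉ G, P' γ = 0 := fun γ hγ => by
    rw [← hPG γ hγ]; exact if_neg fun h => hγ ((hTm γ).1 h).1
  have hcard : (G.filter fun γ => B γ ∧ P' γ ≠ 0).card < n := by
    rw [← hn]
    refine Finset.card_lt_card ⟨fun γ hγ => ?_, fun hs => ?_⟩
    · rw [Finset.mem_filter] at hγ ⊢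
      exact ⟨hγ.1, hγ.2.1, fun h0 => hγ.2.2 (le_antisymm (h0 ▸ hP'le γ) (hP'0 γ))⟩
    · have := hs (Finset.mem_filter.2 hγ₀)
      rw [Finset.mem_filter] at this
      exact this.2.2 (by simp only [P', if_pos hγT, m, sub_self])
  have hI := ih _ hcard P' rfl hP'0 hP'G
  obtain ⟨s₀, hs₀, hs₀T⟩ := h T (Finset.filter_subset _ _) ⟨γ₀, hγT⟩
    (fun γ hγ => ((hTm γ).1 hγ).2.1.1)
    (fun γ hγ γ' hγ' => hr.trans (hr.symm ((hTm γ).1 hγ).2.2) ((hTm γ').1 hγ').2.2)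
  have hL : ∑ γ ∈ G, (if B γ then P γ else 0) =
      ∑ γ ∈ G, (if B γ then P' γ else 0) + m * T.card := by
    have : ∀ γ ∈ G, (if B γ then P γ else 0) =
        (if B γ then P' γ else 0) + if γ ∈ T then m else 0 := fun γ hγ => by
      by_cases hT : γ ∈ T
      · have := ((hTm γ).1 hT).2.1.1
        simp [P', hT, this]
      · simp [P', hT]
    have hT : ∑ γ ∈ G, (if γ ∈ T then m else 0) = m * T.card := by
      rw [← Finset.sum_filter, Finset.filter_mem_eq_inter,
        Finset.inter_eq_right.2 (Finset.filter_subset _ _), Finset.sum_const,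
        nsmul_eq_mul, mul_comm]
    rw [Finset.sum_congr rfl this, Finset.sum_add_distrib, hT]
  have key : ∀ s, ∀ γ ∈ G,
      (if B γ ∧ B (s * γ) ∧ r γ (s * γ) then max (P' γ - P' (s * γ)) 0 else 0) +
        (if γ ∈ T ∧ s * γ ∉ T ∧ B (s * γ) ∧ r γ (s * γ) then m else 0) ≤
      if B γ ∧ B (s * γ) ∧ r γ (s * γ) then max (P γ - P (s * γ)) 0 else 0 := fun s γ hγ => by
    by_cases hc : B γ ∧ B (s * γ) ∧ r γ (s * γ)
    · rw [if_pos hc, if_pos hc]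
      by_cases hT : γ ∈ T <;> by_cases hT' : s * γ ∈ T
      · simp [P', hT, hT']
      · have h0 : P (s * γ) = 0 := by
          by_contra h0
          refine hT' ((hTm _).2 ⟨?_, ⟨hc.2.1, h0⟩, hr.trans ((hTm γ).1 hT).2.2 hc.2.2⟩)
          by_contra hG; exact h0 (hPG _ hG)
        have := hP'0 γ
        have h1 : P' γ = P γ - m := if_pos hT
        have h2 : P' (s * γ) = 0 := (if_neg hT').trans h0
        rw [if_pos ⟨hT, hT', hc.2⟩, h0, h2, h1, sub_zero, sub_zero, max_eq_left (by linarith),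
          max_eq_left (hP γ), sub_add_cancel]
      · have h0 : P γ = 0 := by
          by_contra h0
          exact hT ((hTm _).2 ⟨hγ, ⟨hc.1, h0⟩,
            hr.trans ((hTm _).1 hT').2.2 (hr.symm hc.2.2)⟩)
        have h1 : P' γ = 0 := (if_neg hT).trans h0
        have := hP'0 (s * γ)
        rw [if_neg (fun h => hT h.1), h1, max_eq_right (by linarith), add_zero]
        exact le_max_right _ _
      · simp [P', hT, hT']
    · rw [if_neg hc, if_neg hc, if_neg, add_zero]
      exact fun h' => hc ⟨((hTm γ).1 h'.1).2.1.1, h'.2.2⟩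
  have hR := Finset.sum_le_sum fun s (_ : s ∈ S) => Finset.sum_le_sum (key s)
  simp only [Finset.sum_add_distrib] at hR
  have hs : m * (ε * T.card) ≤ ∑ s ∈ S, ∑ γ ∈ G,
      if γ ∈ T ∧ s * γ ∉ T ∧ B (s * γ) ∧ r γ (s * γ) then m else 0 := by
    refine le_trans (mul_le_mul_of_nonneg_left hs₀T hm) (le_trans (le_of_eq ?_)
      (Finset.single_le_sum (f := fun s => ∑ γ ∈ G,
        if γ ∈ T ∧ s * γ ∉ T ∧ B (s * γ) ∧ r γ (s * γ) then m else 0)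
        (fun _ _ => Finset.sum_nonneg fun _ _ => by split_ifs <;> simp [hm]) hs₀))
    rw [← Finset.sum_filter, Finset.sum_const, nsmul_eq_mul, mul_comm]
    congr 3
    ext γ
    simp only [Finset.mem_filter]
    exact ⟨fun h => ⟨((hTm γ).1 h.1).1, h⟩, fun h => h.2⟩
  rw [hL]
  nlinarith

/-- The points `y` for which `T • y` is a piece of an `R`-class, inside `B`, with small
boundary. -/
def tileSet [MulAction Γ X] (R : Set (X × X)) (B : Set X) (S : Finset Γ) (ε : ℝ) (T : Finset Γ) :
    Set X :=
  {y | (∀ γ ∈ T, γ • y ∈ B) ∧ (∀ γ ∈ T, ∀ γ' ∈ T, (γ • y, γ' • y) ∈ R) ∧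
    ∀ s ∈ S, ((T.filter fun γ => s * γ ∉ T ∧ (s * γ) • y ∈ B ∧ (γ • y, (s * γ) • y) ∈ R).card : ℝ) ≤
      ε * T.card}

lemma measurableSet_smul_rel [MulAction Γ X] [MeasurableConstSMul Γ X] {R : Set (X × X)}
    (hR : MeasurableSet R) (g h : Γ) : MeasurableSet {y : X | (g • y, h • y) ∈ R} :=
  ((measurable_const_smul g).prodMk (measurable_const_smul h)) hR

lemma measurableSet_tileSet [Countable Γ] [MulAction Γ X] [MeasurableConstSMul Γ X]
    {R : Set (X × X)} (hR : MeasurableSet R) {B : Set X} (hB : MeasurableSet B) (S : Finset Γ)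
    (ε : ℝ) (T : Finset Γ) : MeasurableSet (tileSet R B S ε T) := by
  have hBm : ∀ γ : Γ, Measurable fun y : X => γ • y ∈ B := fun γ =>
    measurableSet_setOfPred.1 (measurable_const_smul γ hB)
  have hRm : ∀ γ γ' : Γ, Measurable fun y : X => (γ • y, γ' • y) ∈ R := fun γ γ' =>
    measurableSet_setOfPred.1 (measurableSet_smul_rel hR γ γ')
  refine measurableSet_setOfPred.2 (Measurable.and (Measurable.forall fun γ =>
    measurable_const.imp (hBm γ)) (Measurable.and (Measurable.forall fun γ =>
      measurable_const.imp (Measurable.forall fun γ' => measurable_const.imp (hRm γ γ')))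
      (Measurable.forall fun s => measurable_const.imp ?_)))
  simp only [Finset.card_filter, Nat.cast_sum]
  refine measurableSet_setOfPred.1 (measurableSet_le (Finset.measurable_sum _ fun γ _ =>
    measurable_from_top.comp (Measurable.ite (measurableSet_setOfPred.2 ?_) measurable_const
      measurable_const)) measurable_const)
  exact measurable_const.and ((hBm _).and (hRm _ _))

/-- If the action admits almost `R`-invariant maps to `ℓ¹(Γ)`, then every non-null set contains
many finite pieces of `R`-classes with small boundary. -/
lemma exists_tile [Countable Γ] [MulAction Γ X] [MeasurableConstSMul Γ X] {ν : Measure X}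
    [IsProbabilityMeasure ν] [SMulInvariantMeasure Γ X ν] {R : Set (X × X)}
    (hRm : MeasurableSet R) (hR : IsEquivRelSet R) (S : Finset Γ)
    (hRe : ∀ η > 0, ∃ (G : Finset Γ) (p : X → Γ → ℝ), (∀ γ, Measurable fun x => p x γ) ∧
      (∀ x γ, 0 ≤ p x γ) ∧ (∀ x, ∀ γ ∉ G, p x γ = 0) ∧ (∀ x, ∑ γ ∈ G, p x γ ≤ 1) ∧
      1 - η ≤ ∫ x, ∑ γ ∈ G, p x γ ∂ν ∧
      ∀ s ∈ S, ∀ G' : Finset Γ, ∫ x in {x | (x, s • x) ∈ R},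
        ∑ γ ∈ G', |p x γ - p (s • x) (s * γ)| ∂ν ≤ η)
    {B : Set X} (hB : MeasurableSet B) (hB0 : ν B ≠ 0) {ε : ℝ} (hε : 0 < ε) :
    ∃ T : Finset Γ, T.Nonempty ∧ ν (tileSet R B S ε T) ≠ 0 := by
  by_contra! hcon
  have hBpos : 0 < ν.real B := (measureReal_nonneg).lt_of_ne' fun h =>
    hB0 ((measureReal_eq_zero_iff).1 h)
  obtain ⟨η, hη, hηlt⟩ : ∃ η > 0, S.card * η < ε * (ν.real B - η) := by
    refine ⟨ε * ν.real B / 2 / (S.card + ε), by positivity, ?_⟩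
    have : ε * ν.real B / 2 / (S.card + ε) * (S.card + ε) = ε * ν.real B / 2 :=
      div_mul_cancel₀ _ (by positivity)
    have h2 : 0 < ε * ν.real B := by positivity
    nlinarith
  obtain ⟨G, p, hpm, hp0, hpG, hp1, hpint, hpinv⟩ := hRe η hη
  have hple : ∀ x γ, p x γ ≤ 1 := fun x γ => by
    by_cases h : γ ∈ G
    · exact (Finset.single_le_sum (f := fun γ => p x γ) (fun γ _ => hp0 x γ) h).trans (hp1 x)
    · rw [hpG x γ h]; exact zero_le_one
  have hae : ∀ᵐ y ∂ν, ∀ T : Finset Γ, T.Nonempty → y ∉ tileSet R B S ε T :=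
    ae_all_iff.2 fun T => by
      by_cases hT : T.Nonempty
      · filter_upwards [measure_eq_zero_iff_ae_notMem.1 (hcon T hT)] with y hy _ using hy
      · exact Eventually.of_forall fun _ h => absurd h hT
  have hptw : ∀ᵐ y ∂ν, ε * ∑ γ ∈ G, B.indicator (fun x => p x γ) (γ • y) ≤
      ∑ s ∈ S, ∑ γ ∈ G, {x | (x, s • x) ∈ R}.indicator
        (fun x => |p x γ - p (s • x) (s * γ)|) (γ • y) := by
    filter_upwards [hae] with y hy
    have := mul_sum_le_sum_posPart (B := fun γ => γ • y ∈ B)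
      (r := fun γ γ' => (γ • y, γ' • y) ∈ R)
      ⟨fun γ => hR.1 _, fun h => hR.2.1 _ _ h, fun h h' => hR.2.2 _ _ _ h h'⟩ S (ε := ε) G
      (fun T _ hT hTB hTR => by
        by_contra! hc
        exact hy T hT ⟨hTB, hTR, fun s hs => (hc s hs).le⟩) _ (fun γ => p (γ • y) γ) rfl
      (fun γ => hp0 _ _) (fun γ hγ => hpG _ _ hγ)
    refine le_trans (le_of_eq ?_) (this.trans (Finset.sum_le_sum fun s _ =>
      Finset.sum_le_sum fun γ _ => ?_))
    · simp [indicator]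
    · rw [mul_smul]
      by_cases h : γ • y ∈ {x : X | (x, s • x) ∈ R}
      · rw [indicator_of_mem h]
        split_ifs
        · exact max_le (le_abs_self _) (abs_nonneg _)
        · exact abs_nonneg _
      · rw [indicator_of_notMem h, if_neg fun h' => h h'.2.2]
  have hEm : ∀ s : Γ, MeasurableSet {x : X | (x, s • x) ∈ R} := fun s => by
    simpa using measurableSet_smul_rel hRm 1 s
  have hfm : ∀ s γ, Measurable fun x => |p x γ - p (s • x) (s * γ)| := fun s γ =>
    ((hpm γ).sub ((hpm (s * γ)).comp (measurable_const_smul s))).abs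
  have hfi : ∀ s γ, Integrable (fun x => |p x γ - p (s • x) (s * γ)|) ν := fun s γ =>
    Integrable.of_bound (hfm s γ).aestronglyMeasurable 1 (Eventually.of_forall fun x => by
      rw [Real.norm_eq_abs, abs_abs, abs_le]
      constructor <;> linarith [hp0 x γ, hp0 (s • x) (s * γ), hple x γ, hple (s • x) (s * γ)])
  have hpi : ∀ γ, Integrable (fun x => p x γ) ν := fun γ =>
    Integrable.of_bound (hpm γ).aestronglyMeasurable 1 (Eventually.of_forall fun x => by
      rw [Real.norm_eq_abs, abs_of_nonneg (hp0 x γ)]; exact hple x γ)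
  have hLi : ∀ γ ∈ G, Integrable (fun y => B.indicator (fun x => p x γ) (γ • y)) ν := fun γ _ =>
    (measurePreserving_smul γ ν).integrable_comp_of_integrable ((hpi γ).indicator hB)
  have hRi : ∀ s ∈ S, ∀ γ ∈ G, Integrable (fun y => {x | (x, s • x) ∈ R}.indicator
      (fun x => |p x γ - p (s • x) (s * γ)|) (γ • y)) ν := fun s _ γ _ =>
    (measurePreserving_smul γ ν).integrable_comp_of_integrable ((hfi s γ).indicator (hEm s))
  have hcomp : ∀ (γ : Γ) (f : X → ℝ), Measurable f → ∫ y, f (γ • y) ∂ν = ∫ x, f x ∂ν :=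
    fun γ f hf => (measurePreserving_smul γ ν).integral_comp' (f := MeasurableEquiv.smul γ) f
  have hInt := integral_mono_ae ((integrable_finsetSum _ hLi).const_mul ε)
    (integrable_finsetSum _ fun s hs => integrable_finsetSum _ (hRi s hs)) hptw
  rw [integral_const_mul, integral_finsetSum _ hLi,
    integral_finsetSum _ fun s hs => integrable_finsetSum _ (hRi s hs)] at hInt
  have hle : ∑ s ∈ S, ∫ y, ∑ γ ∈ G, {x | (x, s • x) ∈ R}.indicator
      (fun x => |p x γ - p (s • x) (s * γ)|) (γ • y) ∂ν ≤ S.card * η := by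
    rw [← nsmul_eq_mul]
    refine Finset.sum_le_card_nsmul _ _ _ fun s hs => ?_
    rw [integral_finsetSum _ (hRi s hs)]
    refine le_trans (le_of_eq ?_) (hpinv s hs G)
    rw [integral_finsetSum _ fun γ _ => (hfi s γ).integrableOn]
    refine Finset.sum_congr rfl fun γ _ => ?_
    rw [hcomp γ _ ((hfm s γ).indicator (hEm s)), integral_indicator (hEm s)]
  have hge : ν.real B - η ≤ ∑ γ ∈ G, ∫ y, B.indicator (fun x => p x γ) (γ • y) ∂ν := by
    have : ∀ γ ∈ G, ∫ y, B.indicator (fun x => p x γ) (γ • y) ∂ν = ∫ x in B, p x γ ∂ν :=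
      fun γ _ => by rw [hcomp γ _ ((hpm γ).indicator hB), integral_indicator hB]
    rw [Finset.sum_congr rfl this, ← integral_finsetSum _ fun γ _ => (hpi γ).integrableOn]
    have hs := integrable_finsetSum G fun γ _ => hpi γ
    have h1 := integral_add_compl hB hs
    have h2 : ∫ x in Bᶜ, ∑ γ ∈ G, p x γ ∂ν ≤ ν.real Bᶜ := by
      refine (integral_mono hs.integrableOn (integrable_const 1) fun x => hp1 x).trans ?_
      simp
    rw [probReal_compl_eq_one_sub hB] at h2
    linarith
  nlinarith

end

section
variable {Γ : Type*} [Group Γ]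

lemma measurableSet_rel_smul [MulAction Γ X] [MeasurableConstSMul Γ X] {R : Set (X × X)}
    (hR : MeasurableSet R) (g : Γ) : MeasurableSet {x : X | (x, g • x) ∈ R} :=
  (measurable_id.prodMk (measurable_const_smul g)) hR

variable (Γ) in
/-- There are partitions into small pieces that are almost invariant under the part of the action
of `Γ` contained in `R`. -/
def HasSmallPartitions [MulAction Γ X] (μ : Measure X) (R : Set (X × X)) : Prop :=
  ∀ S : Finset Γ, ∀ ε > 0, ∀ δ > 0, ∃ (N : ℕ) (k : X → ℕ), Measurable k ∧ (∀ x, k x < N) ∧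
    (∀ i, μ.real {x | k x = i} ≤ ε) ∧
    ∀ s ∈ S, μ.real {x | (x, s • x) ∈ R ∧ k x ≠ k (s • x)} ≤ δ

/-- The Bernoulli shift as an action. -/
@[reducible] def bernoulliAction : MulAction Γ (Γ → ℝ) where
  smul := bernoulliShift
  one_smul x := funext fun h => by simp [bernoulliShift, HSMul.hSMul]
  mul_smul a b x := funext fun h => by simp [bernoulliShift, HSMul.hSMul, mul_assoc]

/-- The shift of random bits as an action. -/
@[reducible] def bitAction : MulAction Γ (Γ × ℕ → Fin 2) where
  smul := bitShift
  one_smul x := funext fun h => by simp [bitShift, HSMul.hSMul]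
  mul_smul a b x := funext fun h => by simp [bitShift, HSMul.hSMul, mul_assoc]

attribute [local instance] bernoulliAction bitAction

lemma measurableConstSMul_bernoulli : MeasurableConstSMul Γ (Γ → ℝ) :=
  ⟨fun g => measurable_pi_lambda _ fun h => measurable_pi_apply (g⁻¹ * h)⟩

lemma measurableConstSMul_bit : MeasurableConstSMul Γ (Γ × ℕ → Fin 2) :=
  ⟨fun g => (measurePreserving_bitShift g).measurable⟩

lemma smulInvariantMeasure_bit : SMulInvariantMeasure Γ (Γ × ℕ → Fin 2) (coinMeasure (Γ × ℕ)) :=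
  ⟨fun g _ hs => (measurePreserving_bitShift g).measure_preimage hs.nullMeasurableSet⟩

attribute [local instance] measurableConstSMul_bernoulli measurableConstSMul_bit
  smulInvariantMeasure_bit

lemma smulInvariantMeasure_bernoulli [Countable Γ] {μ : Measure (Γ → ℝ)}
    (hμ : IsBernoulliLebProduct μ) : SMulInvariantMeasure Γ (Γ → ℝ) μ := by
  refine ⟨fun g s hs => ?_⟩
  have hΦ := measurePreserving_assembleBits hμ
  rw [← hΦ.measure_preimage hs.nullMeasurableSet,
    ← hΦ.measure_preimage (measurable_const_smul g hs).nullMeasurableSet]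
  exact (measurePreserving_smul g (coinMeasure (Γ × ℕ))).measure_preimage
    (hΦ.measurable hs).nullMeasurableSet

lemma exists_tile_bernoulli [Countable Γ] {μ : Measure (Γ → ℝ)}
    (hμ : IsBernoulliLebProduct μ) {R : Set ((Γ → ℝ) × (Γ → ℝ))} (hRm : MeasurableSet R)
    (hR : IsEquivRelSet R) (hSP : HasSmallPartitions Γ μ R) (S : Finset Γ)
    {B : Set (Γ → ℝ)} (hB : MeasurableSet B) (hB0 : μ B ≠ 0) {ε : ℝ} (hε : 0 < ε) :
    ∃ T : Finset Γ, T.Nonempty ∧ μ (tileSet R B S ε T) ≠ 0 := by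
  classical
  have hΦ := measurePreserving_assembleBits hμ
  set ν := coinMeasure (Γ × ℕ)
  have hΦ2 : Measurable fun q : (Γ × ℕ → Fin 2) × (Γ × ℕ → Fin 2) =>
      (assembleBits q.1, assembleBits q.2) :=
    (hΦ.measurable.comp measurable_fst).prodMk (hΦ.measurable.comp measurable_snd)
  set R' := (fun q : (Γ × ℕ → Fin 2) × (Γ × ℕ → Fin 2) =>
      (assembleBits q.1, assembleBits q.2)) ⁻¹' R
  have hR'm : MeasurableSet R' := hΦ2 hRm
  have hR' : IsEquivRelSet R' := ⟨fun x => hR.1 _, fun x y h => hR.2.1 _ _ h,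
    fun x y z h h' => hR.2.2 _ _ _ h h'⟩
  have hEm : ∀ s : Γ, MeasurableSet {x : Γ × ℕ → Fin 2 | (x, s • x) ∈ R'} :=
    measurableSet_rel_smul hR'm
  obtain ⟨T, hT, hT0⟩ := exists_tile (ν := ν) hR'm hR' S (B := assembleBits ⁻¹' B)
    (fun η hη => exists_reiter S hEm (fun e he δ hδ => by
      obtain ⟨N, k, hk, hkN, hke, hkδ⟩ := hSP S e he δ hδ
      refine ⟨N, k ∘ assembleBits, hk.comp hΦ.measurable, fun x => hkN _, fun i => ?_,
        fun s hs => ?_⟩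
      · have := hΦ.measureReal_preimage (measurableSet_eq_fun hk
          (measurable_const (a := i))).nullMeasurableSet
        exact (le_of_eq this).trans (hke i)
      · have := hΦ.measureReal_preimage (s := {x | (x, s • x) ∈ R ∧ k x ≠ k (s • x)})
          ((measurableSet_rel_smul hRm s).inter
          (measurableSet_eq_fun hk (hk.comp (measurable_const_smul s))).compl).nullMeasurableSet
        exact (le_of_eq this).trans (hkδ s hs)) hη)
    (hΦ.measurable hB) (by rwa [hΦ.measure_preimage hB.nullMeasurableSet]) hε
  refine ⟨T, hT, ?_⟩
  rwa [← hΦ.measure_preimage (measurableSet_tileSet hRm hB S ε T).nullMeasurableSet]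

lemma ae_smul_ne_bernoulli {μ : Measure (Γ → ℝ)} (hμ : IsBernoulliLebProduct μ) {g : Γ}
    (hg : g ≠ 1) : ∀ᵐ x ∂μ, g • x ≠ x := by
  classical
  have hg' : (1 : Γ) ≠ g⁻¹ := fun h => hg (by rw [← inv_inv g, ← h, inv_one])
  set l : Measure ℝ := volume.restrict (Icc 0 1)
  have hm : Measurable fun x : Γ → ℝ => (x 1, x g⁻¹) :=
    (measurable_pi_apply _).prodMk (measurable_pi_apply _)
  have hprod : l.prod l = μ.map fun x : Γ → ℝ => (x 1, x g⁻¹) := by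
    refine Measure.prod_eq fun s t hs ht => ?_
    rw [Measure.map_apply hm (hs.prod ht), Measure.restrict_apply hs, Measure.restrict_apply ht]
    have := hμ.2 {1, g⁻¹} (fun i => if i = 1 then s else t)
      (fun i => by split_ifs <;> assumption)
    rw [Finset.prod_pair hg', if_pos rfl, if_neg hg'.symm] at this
    rw [← this]
    congr 1
    ext x
    simp [hg'.symm]
  have hdiag : (l.prod l) {q | q.1 = q.2} = 0 := by
    rw [Measure.measure_prod_null (measurableSet_eq_fun measurable_fst measurable_snd)]
    refine Eventually.of_forall fun x => ?_
    have : Prod.mk x ⁻¹' {q : ℝ × ℝ | q.1 = q.2} = {x} := by ext y; simp [eq_comm]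
    change l (Prod.mk x ⁻¹' {q : ℝ × ℝ | q.1 = q.2}) = 0
    rw [this]
    simp
  rw [hprod, Measure.map_apply hm (measurableSet_eq_fun measurable_fst measurable_snd)] at hdiag
  refine measure_mono_null (fun x hx => ?_) hdiag
  have hx' : g • x = x := not_not.1 hx
  have := congrFun hx' 1
  change x (g⁻¹ * 1) = x 1 at this
  rw [mul_one] at this
  exact this.symm

end

section

/-- A bounded monotone function on a nonempty preorder with upper bounds for monotone sequences is
eventually constant. -/
lemma exists_forall_ge_le_of_monotone {α : Type*} [Preorder α] [Nonempty α] (m : α → ℝ)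
    (hm : Monotone m) (hb : BddAbove (range m))
    (hs : ∀ u : ℕ → α, Monotone u → ∃ a, ∀ n, u n ≤ a) : ∃ a, ∀ b, a ≤ b → m b ≤ m a := by
  have hbs : ∀ a, BddAbove (m '' Ici a) := fun a => hb.mono (image_subset_range _ _)
  have step : ∀ (n : ℕ) (a : α), ∃ b, a ≤ b ∧ ∀ c, a ≤ c → m c ≤ m b + 1 / (n + 1) := fun n a => by
    obtain ⟨_, ⟨b, hab, rfl⟩, hlt⟩ := exists_lt_of_lt_csSup (s := m '' Ici a)
      ⟨_, a, self_mem_Ici, rfl⟩ (sub_lt_self (sSup (m '' Ici a)) (Nat.one_div_pos_of_nat (n := n)))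
    exact ⟨b, hab, fun c hc => by linarith [le_csSup (hbs a) ⟨c, hc, rfl⟩]⟩
  choose f hf hf' using step
  obtain ⟨a₀⟩ := ‹Nonempty α›
  let u : ℕ → α := fun n => Nat.rec a₀ f n
  have hu : Monotone u := monotone_nat_of_le_succ fun n => hf n (u n)
  obtain ⟨a, ha⟩ := hs u hu
  refine ⟨a, fun b hb => le_of_forall_pos_le_add fun ε hε => ?_⟩
  obtain ⟨n, hn⟩ := exists_nat_one_div_lt hε
  have h1 := hf' n (u n) b ((ha n).trans hb)
  have h2 : m (f n (u n)) ≤ m a := hm (ha (n + 1))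
  linarith

variable {Γ : Type*} [Group Γ] [MulAction Γ X]

/-- A non-null set of points moved by finitely many group elements contains a non-null set that is
disjoint from its translates. -/
lemma exists_subset_disjoint_smul [MeasurableConstSMul Γ X]
    [MeasurableSpace.CountablySeparated X] (μ : Measure X) (L : Finset Γ) {Y : Set X}
    (hY : MeasurableSet Y) (hY0 : μ Y ≠ 0) (hmove : ∀ g ∈ L, ∀ x ∈ Y, g • x ≠ x) :
    ∃ Z ⊆ Y, MeasurableSet Z ∧ μ Z ≠ 0 ∧ ∀ g ∈ L, ∀ x ∈ Z, g • x ∉ Z := by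
  classical
  induction L using Finset.induction_on with
  | empty => exact ⟨Y, Subset.rfl, hY, hY0, by simp⟩
  | insert g L _ ih =>
    obtain ⟨Z, hZY, hZ, hZ0, hZd⟩ := ih fun g hg => hmove g (Finset.mem_insert_of_mem hg)
    obtain ⟨U, hU, hUs⟩ := exists_seq_separating (α := X) MeasurableSet.univ univ
    have hcover : Z ⊆
        ⋃ n, ((Z ∩ (U n ∩ (g • ·) ⁻¹' (U n)ᶜ)) ∪ (Z ∩ ((U n)ᶜ ∩ (g • ·) ⁻¹' U n))) := by
      intro x hx
      by_contra hc
      refine hmove g (Finset.mem_insert_self _ _) x (hZY hx)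
        (hUs _ trivial _ trivial fun n => ⟨fun h => ?_, fun h => ?_⟩)
      · by_contra h'; exact hc (mem_iUnion_of_mem n (Or.inr ⟨hx, h', h⟩))
      · by_contra h'; exact hc (mem_iUnion_of_mem n (Or.inl ⟨hx, h, h'⟩))
    have hg := measurable_const_smul (α := X) g
    by_contra! hcon
    refine hZ0 (measure_mono_null hcover (measure_iUnion_null fun n => measure_union_null ?_ ?_))
    · by_contra h0
      obtain ⟨g', hg', x, hx, hgx⟩ := hcon _ (inter_subset_left.trans hZY)
        (hZ.inter ((hU n).inter (hg (hU n).compl))) h0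
      rcases Finset.mem_insert.1 hg' with rfl | h
      · exact hx.2.2 hgx.2.1
      · exact hZd g' h x hx.1 hgx.1
    · by_contra h0
      obtain ⟨g', hg', x, hx, hgx⟩ := hcon _ (inter_subset_left.trans hZY)
        (hZ.inter ((hU n).compl.inter (hg (hU n)))) h0
      rcases Finset.mem_insert.1 hg' with rfl | h
      · exact hgx.2.1 hx.2.2
      · exact hZd g' h x hx.1 hgx.1

variable (Γ) in
/-- An invariant finite equivalence relation on part of the space that is almost invariant
under `S`. -/
structure PartialTiling (μ : Measure X) (R : Set (X × X)) (S : Finset Γ) (c : ENNReal) where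
  dom : Set X
  rel : Set (X × X)
  measurableSet_dom : MeasurableSet dom
  measurableSet_rel : MeasurableSet rel
  isEquivRelOn : IsEquivRelOn rel dom
  rel_subset : rel ⊆ R
  finite_class : ∀ x, {y | (x, y) ∈ rel}.Finite
  measure_boundary_le : ∀ s ∈ S, μ {x | (x, s • x) ∈ R ∧ (x ∈ dom ∨ s • x ∈ dom) ∧
    (x, s • x) ∉ rel} ≤ c * μ dom

namespace PartialTiling
variable {μ : Measure X} {R : Set (X × X)} {S : Finset Γ} {c : ENNReal}

instance : Preorder (PartialTiling Γ μ R S c) where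
  le t t' := t.dom ⊆ t'.dom ∧ ∀ x ∈ t.dom, ∀ y, (x, y) ∈ t'.rel ↔ (x, y) ∈ t.rel
  le_refl t := ⟨Subset.rfl, fun _ _ _ => Iff.rfl⟩
  le_trans t t' t'' h h' := ⟨h.1.trans h'.1, fun x hx y => (h'.2 x (h.1 hx) y).trans (h.2 x hx y)⟩

lemma rel_subset_of_le {t t' : PartialTiling Γ μ R S c} (h : t ≤ t') : t.rel ⊆ t'.rel :=
  fun ⟨x, y⟩ hq => (h.2 x (t.isEquivRelOn.1 hq).1 y).2 hq

instance : Nonempty (PartialTiling Γ μ R S c) :=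
  ⟨{  dom := ∅
      rel := ∅
      measurableSet_dom := .empty
      measurableSet_rel := .empty
      isEquivRelOn := by simp [IsEquivRelOn]
      rel_subset := empty_subset _
      finite_class := by simp
      measure_boundary_le := by simp }⟩

lemma exists_upper_bound (u : ℕ → PartialTiling Γ μ R S c) (hu : Monotone u) :
    ∃ t, ∀ n, u n ≤ t := by
  have hrel : ∀ n x, x ∈ (u n).dom → ∀ y, (x, y) ∈ (⋃ i, (u i).rel) ↔ (x, y) ∈ (u n).rel := by
    intro n x hx y
    refine ⟨fun h => ?_, fun h => mem_iUnion_of_mem n h⟩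
    obtain ⟨m, hm⟩ := mem_iUnion.1 h
    rcases le_total n m with h | h
    · exact ((hu h).2 x hx y).1 hm
    · exact rel_subset_of_le (hu h) hm
  refine ⟨{  dom := ⋃ i, (u i).dom
             rel := ⋃ i, (u i).rel
             measurableSet_dom := .iUnion fun i => (u i).measurableSet_dom
             measurableSet_rel := .iUnion fun i => (u i).measurableSet_rel
             isEquivRelOn := ⟨fun q hq => ?_, fun x hx => ?_, fun x y h => ?_, fun x y z h h' => ?_⟩
             rel_subset := iUnion_subset fun i => (u i).rel_subset
             finite_class := fun x => ?_
             measure_boundary_le := fun s hs => ?_ },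
    fun n => ⟨subset_iUnion (fun i => (u i).dom) n, hrel n⟩⟩
  · obtain ⟨i, hi⟩ := mem_iUnion.1 hq
    have := (u i).isEquivRelOn.1 hi
    exact ⟨mem_iUnion_of_mem i this.1, mem_iUnion_of_mem i this.2⟩
  · obtain ⟨i, hi⟩ := mem_iUnion.1 hx
    exact mem_iUnion_of_mem i ((u i).isEquivRelOn.2.1 x hi)
  · obtain ⟨i, hi⟩ := mem_iUnion.1 h
    exact mem_iUnion_of_mem i ((u i).isEquivRelOn.2.2.1 x y hi)
  · obtain ⟨i, hi⟩ := mem_iUnion.1 h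
    have hx := ((u i).isEquivRelOn.1 hi).1
    have hy := ((u i).isEquivRelOn.1 hi).2
    exact mem_iUnion_of_mem i ((u i).isEquivRelOn.2.2.2 x y z hi ((hrel i y hy z).1 h'))
  · by_cases hx : x ∈ ⋃ i, (u i).dom
    · obtain ⟨i, hi⟩ := mem_iUnion.1 hx
      exact ((u i).finite_class x).subset fun y hy => (hrel i x hi y).1 hy
    · convert finite_empty
      refine eq_empty_of_forall_notMem fun y hy => hx ?_
      obtain ⟨i, hi⟩ := mem_iUnion.1 (show (x, y) ∈ ⋃ i, (u i).rel from hy)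
      exact mem_iUnion_of_mem i ((u i).isEquivRelOn.1 hi).1
  · have hsub : {x | (x, s • x) ∈ R ∧ (x ∈ (⋃ i, (u i).dom) ∨ s • x ∈ ⋃ i, (u i).dom) ∧
        (x, s • x) ∉ ⋃ i, (u i).rel} ⊆ ⋃ i, {x | (x, s • x) ∈ R ∧
        (x ∈ (u i).dom ∨ s • x ∈ (u i).dom) ∧ (x, s • x) ∉ ⋃ i, (u i).rel} := by
      rintro x ⟨h1, h2, h3⟩
      rcases h2 with h2 | h2 <;> obtain ⟨i, hi⟩ := mem_iUnion.1 h2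
      · exact mem_iUnion_of_mem i ⟨h1, Or.inl hi, h3⟩
      · exact mem_iUnion_of_mem i ⟨h1, Or.inr hi, h3⟩
    refine (measure_mono hsub).trans ?_
    have hmono : Monotone fun i => {x | (x, s • x) ∈ R ∧
        (x ∈ (u i).dom ∨ s • x ∈ (u i).dom) ∧ (x, s • x) ∉ ⋃ i, (u i).rel} := fun i j hij x hx =>
      ⟨hx.1, hx.2.1.imp (fun h => (hu hij).1 h) (fun h => (hu hij).1 h), hx.2.2⟩
    rw [hmono.measure_iUnion]
    refine iSup_le fun i => ((measure_mono ?_).trans ((u i).measure_boundary_le s hs)).trans ?_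
    · exact fun x hx => ⟨hx.1, hx.2.1, fun h => hx.2.2 (mem_iUnion_of_mem i h)⟩
    · gcongr
      exact subset_iUnion (fun i => (u i).dom) i

end PartialTiling
end

section
open Classical
variable {Γ : Type*} [Group Γ] [MulAction Γ X]

omit [Group Γ] [MulAction Γ X] in
/-- Averaging a family of sets over a finite set. -/
lemma sum_measure_inter_le {Y : Set X} (μ : Measure X) (T : Finset Γ)
    {W : Γ → Set X} (hW : ∀ γ, MeasurableSet (W γ)) {ε : ℝ}
    (h : ∀ y ∈ Y, ((T.filter fun γ => y ∈ W γ).card : ℝ) ≤ ε * T.card) :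
    ∑ γ ∈ T, μ (Y ∩ W γ) ≤ ENNReal.ofReal ε * (T.card * μ Y) := by
  have : ∀ γ ∈ T, μ (Y ∩ W γ) = ∫⁻ y in Y, (W γ).indicator 1 y ∂μ := fun γ _ => by
    rw [lintegral_indicator_one (hW γ), Measure.restrict_apply (hW γ), inter_comm]
  rw [Finset.sum_congr rfl this, ← lintegral_finsetSum _ fun γ _ =>
    measurable_one.indicator (hW γ), ← mul_assoc, ← setLIntegral_const]
  refine setLIntegral_mono measurable_const fun y hy => ?_
  have h1 : ∑ γ ∈ T, (W γ).indicator (1 : X → ENNReal) y =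
      ((T.filter fun γ => y ∈ W γ).card : ENNReal) := by
    rw [Finset.card_filter]
    push_cast
    rfl
  rw [h1, ← ENNReal.ofReal_natCast, ← ENNReal.ofReal_natCast (n := T.card),
    ← ENNReal.ofReal_mul' (Nat.cast_nonneg _)]
  exact ENNReal.ofReal_le_ofReal (h y hy)

/-- The equivalence relation whose classes are the translates `T • y`, for `y ∈ Y`. -/
def translateRel (T : Finset Γ) (Y : Set X) : Set (X × X) :=
  {q | ∃ γ ∈ T, ∃ γ' ∈ T, γ⁻¹ • q.1 ∈ Y ∧ q.2 = (γ' * γ⁻¹) • q.1}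

/-- The union of the translates of `Y` by elements of `T`. -/
def translateDom (T : Finset Γ) (Y : Set X) : Set X := ⋃ γ ∈ T, (γ⁻¹ • ·) ⁻¹' Y

section
variable {T : Finset Γ} {Y : Set X}

omit [MeasurableSpace X] in
lemma mem_translateDom {x : X} : x ∈ translateDom T Y ↔ ∃ γ ∈ T, γ⁻¹ • x ∈ Y := by
  simp [translateDom]

lemma measurableSet_translateDom [MeasurableConstSMul Γ X] (hY : MeasurableSet Y) :
    MeasurableSet (translateDom T Y) :=
  Finset.measurableSet_biUnion _ fun γ _ => measurable_const_smul γ⁻¹ hY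

lemma measurableSet_translateRel [MeasurableConstSMul Γ X] [MeasurableEq X]
    (hY : MeasurableSet Y) : MeasurableSet (translateRel T Y) := by
  have : translateRel T Y = ⋃ γ ∈ T, ⋃ γ' ∈ T,
      {q : X × X | γ⁻¹ • q.1 ∈ Y} ∩ {q | q.2 = (γ' * γ⁻¹) • q.1} := by
    ext q; simp only [translateRel, mem_iUnion, mem_inter_iff, mem_ofPred_eq, exists_prop]
  rw [this]
  exact Finset.measurableSet_biUnion _ fun γ _ => Finset.measurableSet_biUnion _ fun γ' _ =>
    (((measurable_const_smul γ⁻¹).comp measurable_fst) hY).inter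
      (measurableSet_eq_fun measurable_snd ((measurable_const_smul _).comp measurable_fst))

omit [MeasurableSpace X] in
lemma isEquivRelOn_translateRel
    (hY : ∀ γ ∈ T, ∀ γ' ∈ T, γ ≠ γ' → ∀ y ∈ Y, (γ⁻¹ * γ') • y ∉ Y) :
    IsEquivRelOn (translateRel T Y) (translateDom T Y) := by
  refine ⟨?_, fun x hx => ?_, ?_, ?_⟩
  · rintro ⟨x, y⟩ ⟨γ, hγ, γ', hγ', h, e⟩
    obtain rfl : y = (γ' * γ⁻¹) • x := e
    exact ⟨mem_translateDom.2 ⟨γ, hγ, h⟩, mem_translateDom.2 ⟨γ', hγ', by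
      simpa [smul_smul] using h⟩⟩
  · obtain ⟨γ, hγ, h⟩ := mem_translateDom.1 hx
    exact ⟨γ, hγ, γ, hγ, h, by simp⟩
  · rintro x y ⟨γ, hγ, γ', hγ', h, e⟩
    obtain rfl : y = (γ' * γ⁻¹) • x := e
    exact ⟨γ', hγ', γ, hγ, by simpa [smul_smul] using h, by simp [smul_smul]⟩
  · rintro x y z ⟨γ, hγ, γ', hγ', h, e⟩ ⟨γ₁, hγ₁, γ₂, hγ₂, h', e'⟩
    obtain rfl : y = (γ' * γ⁻¹) • x := e
    obtain rfl : z = (γ₂ * γ₁⁻¹) • (γ' * γ⁻¹) • x := e'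
    have : γ' = γ₁ := by
      by_contra hne
      refine hY γ₁ hγ₁ γ' hγ' (Ne.symm hne) _ h ?_
      simpa [smul_smul, mul_assoc] using h'
    subst this
    exact ⟨γ, hγ, γ₂, hγ₂, h, by simp [smul_smul]⟩

omit [MeasurableSpace X] in
lemma finite_translateRel (x : X) : {y | (x, y) ∈ translateRel T Y}.Finite := by
  refine ((T ×ˢ T).finite_toSet.image fun q => (q.2 * q.1⁻¹) • x).subset ?_
  rintro y ⟨γ, hγ, γ', hγ', -, h⟩
  exact ⟨(γ, γ'), by simp [hγ, hγ'], h.symm⟩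

lemma measure_translateDom [MeasurableConstSMul Γ X] {μ : Measure X} [SMulInvariantMeasure Γ X μ]
    (hYm : MeasurableSet Y) (hY : ∀ γ ∈ T, ∀ γ' ∈ T, γ ≠ γ' → ∀ y ∈ Y, (γ⁻¹ * γ') • y ∉ Y) :
    μ (translateDom T Y) = T.card * μ Y := by
  rw [translateDom, measure_biUnion_finset]
  · simp [(measurePreserving_smul _ μ).measure_preimage hYm.nullMeasurableSet]
  · intro γ hγ γ' hγ' hne
    refine Set.disjoint_left.2 fun x hx hx' => ?_
    refine hY γ' hγ' γ hγ hne.symm _ hx ?_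
    simpa [smul_smul] using hx'
  · exact fun γ _ => measurable_const_smul γ⁻¹ hYm

lemma measure_boundary_translateDom_le [Countable Γ] [MeasurableConstSMul Γ X] {μ : Measure X}
    [SMulInvariantMeasure Γ X μ] {R : Set (X × X)} (hR : MeasurableSet R) {B : Set X}
    (hB : MeasurableSet B) (hYm : MeasurableSet Y) {S : Finset Γ} {ε : ℝ}
    (hYT : Y ⊆ tileSet R B S ε T) {s : Γ} (hs : s ∈ S) :
    μ {x | x ∈ translateDom T Y ∧ (x, s • x) ∈ R ∧ s • x ∈ B ∧ (x, s • x) ∉ translateRel T Y} ≤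
      ENNReal.ofReal ε * (T.card * μ Y) := by
  set W : Γ → Set X := fun γ => {y | s * γ ∉ T ∧ (s * γ) • y ∈ B ∧ (γ • y, (s * γ) • y) ∈ R}
  have hW : ∀ γ, MeasurableSet (W γ) := fun γ =>
    (MeasurableSet.const _).inter ((measurable_const_smul (s * γ) hB).inter
      (measurableSet_smul_rel hR γ (s * γ)))
  refine le_trans ?_ (sum_measure_inter_le μ T hW fun y hy => by
    convert (hYT hy).2.2 s hs
    rfl)
  have hsub : {x | x ∈ translateDom T Y ∧ (x, s • x) ∈ R ∧ s • x ∈ B ∧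
      (x, s • x) ∉ translateRel T Y} ⊆ ⋃ γ ∈ T, (γ⁻¹ • ·) ⁻¹' (Y ∩ W γ) := by
    rintro x ⟨hx, hxR, hxB, hxT⟩
    obtain ⟨γ, hγ, h⟩ := mem_translateDom.1 hx
    refine mem_biUnion (x := γ) hγ ⟨h, fun hsγ => hxT ⟨γ, hγ, _, hsγ, h, by simp⟩, ?_, ?_⟩
    · simpa [smul_smul] using hxB
    · simpa [smul_smul] using hxR
  refine (measure_mono hsub).trans ((measure_biUnion_finset_le _ _).trans (le_of_eq ?_))
  exact Finset.sum_congr rfl fun γ _ =>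
    (measurePreserving_smul γ⁻¹ μ).measure_preimage (hYm.inter (hW γ)).nullMeasurableSet

end

end

section
open Classical Pointwise
variable {Γ : Type*} [Group Γ] [MulAction Γ X]

omit [MeasurableSpace X] in
lemma isEquivRelOn_union {F F' : Set (X × X)} {D D' : Set X} (hF : IsEquivRelOn F D)
    (hF' : IsEquivRelOn F' D') (hd : Disjoint D D') : IsEquivRelOn (F ∪ F') (D ∪ D') := by
  refine ⟨?_, ?_, ?_, ?_⟩
  · rintro q (hq | hq)
    · exact ⟨Or.inl (hF.1 hq).1, Or.inl (hF.1 hq).2⟩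
    · exact ⟨Or.inr (hF'.1 hq).1, Or.inr (hF'.1 hq).2⟩
  · rintro x (hx | hx)
    · exact Or.inl (hF.2.1 x hx)
    · exact Or.inr (hF'.2.1 x hx)
  · rintro x y (h | h)
    · exact Or.inl (hF.2.2.1 x y h)
    · exact Or.inr (hF'.2.2.1 x y h)
  · rintro x y z (h | h) (h' | h')
    · exact Or.inl (hF.2.2.2 x y z h h')
    · exact (Set.disjoint_left.1 hd (hF.1 h).2 (hF'.1 h').1).elim
    · exact (Set.disjoint_left.1 hd (hF.1 h').1 (hF'.1 h).2).elim
    · exact Or.inr (hF'.2.2.2 x y z h h')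

variable [Countable Γ] [StandardBorelSpace X] [MeasurableConstSMul Γ X] {μ : Measure X}
  [IsProbabilityMeasure μ] [SMulInvariantMeasure Γ X μ] {R : Set (X × X)}

lemma PartialTiling.exists_extension (hRm : MeasurableSet R) (hR : IsEquivRelSet R)
    (hfree : ∀ g : Γ, g ≠ 1 → ∀ᵐ x ∂μ, g • x ≠ x) {ε : ℝ}
    (htile : ∀ (S : Finset Γ) (B : Set X), MeasurableSet B → μ B ≠ 0 →
      ∃ T : Finset Γ, T.Nonempty ∧ μ (tileSet R B S ε T) ≠ 0)
    {S : Finset Γ} (t : PartialTiling Γ μ R S (2 * ENNReal.ofReal ε)) (ht : μ t.domᶜ ≠ 0) :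
    ∃ t' : PartialTiling Γ μ R S (2 * ENNReal.ofReal ε), t ≤ t' ∧ μ t.dom < μ t'.dom := by
  obtain ⟨T, hT, hT0⟩ := htile (S ∪ S⁻¹) t.domᶜ t.measurableSet_dom.compl ht
  set G := tileSet R t.domᶜ (S ∪ S⁻¹) ε T
  have hGm : MeasurableSet G := measurableSet_tileSet hRm t.measurableSet_dom.compl _ _ _
  set Y₀ := G ∩ {x | ∀ g : Γ, g ≠ 1 → g • x ≠ x}
  have hFm : MeasurableSet {x : X | ∀ g : Γ, g ≠ 1 → g • x ≠ x} :=
    measurableSet_setOfPred.2 (Measurable.forall fun g => measurable_const.imp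
      (measurableSet_setOfPred.1 (measurableSet_eq_fun (measurable_const_smul g)
        measurable_id).compl))
  have hFae : ∀ᵐ x ∂μ, ∀ g : Γ, g ≠ 1 → g • x ≠ x := ae_all_iff.2 fun g => by
    by_cases hg : g = 1
    · exact Eventually.of_forall fun _ h => absurd hg h
    · filter_upwards [hfree g hg] with x hx _ using hx
  have hY₀0 : μ Y₀ ≠ 0 := by
    rwa [measure_inter_conull (mem_ae_iff.1 hFae)]
  obtain ⟨Y, hYsub, hYm, hY0, hYd⟩ := exists_subset_disjoint_smul μ
    (((T ×ˢ T).image fun q => q.1⁻¹ * q.2).erase 1) (hGm.inter hFm) hY₀0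
    (fun g hg x hx => hx.2 g (Finset.ne_of_mem_erase hg))
  have hYG : Y ⊆ G := hYsub.trans inter_subset_left
  have hYT : ∀ γ ∈ T, ∀ γ' ∈ T, γ ≠ γ' → ∀ y ∈ Y, (γ⁻¹ * γ') • y ∉ Y := by
    intro γ hγ γ' hγ' hne y hy
    refine hYd _ (Finset.mem_erase.2 ⟨fun h => hne (inv_mul_eq_one.1 h),
      Finset.mem_image.2 ⟨(γ, γ'), by simp [hγ, hγ'], rfl⟩⟩) y hy
  have hdom : translateDom T Y ⊆ t.domᶜ := fun x hx => by
    obtain ⟨γ, hγ, h⟩ := mem_translateDom.1 hx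
    simpa using (hYG h).1 γ hγ
  have hdisj : Disjoint t.dom (translateDom T Y) :=
    Set.disjoint_left.2 fun x hx hx' => hdom hx' hx
  have hμ' : μ (t.dom ∪ translateDom T Y) = μ t.dom + T.card * μ Y := by
    rw [measure_union hdisj (measurableSet_translateDom hYm), measure_translateDom hYm hYT]
  have hEq := isEquivRelOn_union t.isEquivRelOn (isEquivRelOn_translateRel hYT) hdisj
  have hbd : ∀ s ∈ S ∪ S⁻¹, μ {x | x ∈ translateDom T Y ∧ (x, s • x) ∈ R ∧ s • x ∈ t.domᶜ ∧
      (x, s • x) ∉ translateRel T Y} ≤ ENNReal.ofReal ε * (T.card * μ Y) := fun s hs =>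
    measure_boundary_translateDom_le hRm t.measurableSet_dom.compl hYm hYG hs
  refine ⟨{  dom := t.dom ∪ translateDom T Y
             rel := t.rel ∪ translateRel T Y
             measurableSet_dom := t.measurableSet_dom.union (measurableSet_translateDom hYm)
             measurableSet_rel := t.measurableSet_rel.union (measurableSet_translateRel hYm)
             isEquivRelOn := hEq
             rel_subset := union_subset t.rel_subset ?_
             finite_class := fun x => (t.finite_class x).union (finite_translateRel x)
             measure_boundary_le := fun s hs => ?_ },
    ⟨subset_union_left, fun x hx y => ⟨fun h => h.resolve_right fun h' => ?_, Or.inl⟩⟩, ?_⟩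
  · rintro ⟨x, y⟩ ⟨γ, hγ, γ', hγ', h, e⟩
    obtain rfl : y = (γ' * γ⁻¹) • x := e
    simpa [smul_smul] using (hYG h).2.1 γ hγ γ' hγ'
  · have hsub : {x | (x, s • x) ∈ R ∧ (x ∈ t.dom ∪ translateDom T Y ∨
        s • x ∈ t.dom ∪ translateDom T Y) ∧ (x, s • x) ∉ t.rel ∪ translateRel T Y} ⊆
        {x | (x, s • x) ∈ R ∧ (x ∈ t.dom ∨ s • x ∈ t.dom) ∧ (x, s • x) ∉ t.rel} ∪
        ({x | x ∈ translateDom T Y ∧ (x, s • x) ∈ R ∧ s • x ∈ t.domᶜ ∧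
          (x, s • x) ∉ translateRel T Y} ∪
        (s • ·) ⁻¹' {x | x ∈ translateDom T Y ∧ (x, s⁻¹ • x) ∈ R ∧ s⁻¹ • x ∈ t.domᶜ ∧
          (x, s⁻¹ • x) ∉ translateRel T Y}) := by
      rintro x ⟨h1, h2, h3⟩
      by_cases h4 : x ∈ t.dom ∨ s • x ∈ t.dom
      · exact Or.inl ⟨h1, h4, fun h => h3 (Or.inl h)⟩
      push Not at h4
      rcases h2 with (h2 | h2) | (h2 | h2)
      · exact absurd h2 h4.1
      · exact Or.inr (Or.inl ⟨h2, h1, h4.2, fun h => h3 (Or.inr h)⟩)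
      · exact absurd h2 h4.2
      · refine Or.inr (Or.inr ?_)
        simp only [mem_preimage, mem_ofPred_eq, inv_smul_smul]
        exact ⟨h2, hR.2.1 _ _ h1, h4.1, fun h => h3 (Or.inr ((isEquivRelOn_translateRel
          hYT).2.2.1 _ _ h))⟩
    have hinv : μ ((s • ·) ⁻¹' {x | x ∈ translateDom T Y ∧ (x, s⁻¹ • x) ∈ R ∧ s⁻¹ • x ∈ t.domᶜ ∧
        (x, s⁻¹ • x) ∉ translateRel T Y}) ≤ ENNReal.ofReal ε * (T.card * μ Y) := by
      rw [measure_preimage_smul]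
      exact hbd s⁻¹ (Finset.mem_union_right _ (Finset.inv_mem_inv hs))
    refine (measure_mono hsub).trans ((measure_union_le _ _).trans ((add_le_add
      (t.measure_boundary_le s hs) ((measure_union_le _ _).trans (add_le_add
        (hbd s (Finset.mem_union_left _ hs)) hinv))).trans (le_of_eq ?_)))
    rw [hμ']
    ring
  · exact Set.disjoint_left.1 hdisj hx ((isEquivRelOn_translateRel hYT).1 h').1
  · change μ t.dom < μ (t.dom ∪ translateDom T Y)
    rw [hμ']
    exact ENNReal.lt_add_right (measure_ne_top _ _)
      (mul_ne_zero (by simpa using hT.ne_empty) hY0)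

/-- `R` is approximated by equivalence relations with finite classes. -/
lemma exists_finite_approx (hRm : MeasurableSet R) (hR : IsEquivRelSet R)
    (hfree : ∀ g : Γ, g ≠ 1 → ∀ᵐ x ∂μ, g • x ≠ x) {ε : ℝ}
    (htile : ∀ (S : Finset Γ) (B : Set X), MeasurableSet B → μ B ≠ 0 →
      ∃ T : Finset Γ, T.Nonempty ∧ μ (tileSet R B S ε T) ≠ 0) (S : Finset Γ) :
    ∃ F : Set (X × X), MeasurableSet F ∧ IsEquivRelSet F ∧ F ⊆ R ∧
      (∀ x, {y | (x, y) ∈ F}.Finite) ∧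
      ∀ s ∈ S, μ {x | (x, s • x) ∈ R ∧ (x, s • x) ∉ F} ≤ 2 * ENNReal.ofReal ε := by
  obtain ⟨t, ht⟩ := exists_forall_ge_le_of_monotone
    (fun t : PartialTiling Γ μ R S (2 * ENNReal.ofReal ε) => μ.real t.dom)
    (fun t t' h => measureReal_mono (And.left h) (measure_ne_top _ _))
    ⟨1, by rintro _ ⟨t, rfl⟩; exact measureReal_le_one⟩
    PartialTiling.exists_upper_bound
  have ht0 : μ t.domᶜ = 0 := by
    by_contra h0
    obtain ⟨t', htt', hlt⟩ := t.exists_extension hRm hR hfree htile h0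
    exact absurd (ht t' htt') (not_le.2 ((ENNReal.toReal_lt_toReal (measure_ne_top _ _)
      (measure_ne_top _ _)).2 hlt))
  refine ⟨t.rel ∪ diagonal X, t.measurableSet_rel.union measurableSet_diagonal,
    ⟨fun x => Or.inr rfl, fun x y h => ?_, fun x y z h h' => ?_⟩, union_subset t.rel_subset ?_,
    fun x => ?_, fun s hs => ?_⟩
  · rcases h with h | h
    · exact Or.inl (t.isEquivRelOn.2.2.1 _ _ h)
    · exact Or.inr (Eq.symm h)
  · rcases h with h | h
    · rcases h' with h' | h'
      · exact Or.inl (t.isEquivRelOn.2.2.2 _ _ _ h h')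
      · obtain rfl : y = z := h'
        exact Or.inl h
    · obtain rfl : x = y := h
      exact h'
  · rintro ⟨x, y⟩ h
    obtain rfl : x = y := h
    exact hR.1 x
  · refine ((t.finite_class x).union (finite_singleton x)).subset ?_
    rintro y (h | h)
    · exact Or.inl h
    · exact Or.inr (Eq.symm h)
  · have hsub : {x | (x, s • x) ∈ R ∧ (x, s • x) ∉ t.rel ∪ diagonal X} ⊆
        {x | (x, s • x) ∈ R ∧ (x ∈ t.dom ∨ s • x ∈ t.dom) ∧ (x, s • x) ∉ t.rel} ∪ t.domᶜ := by
      rintro x ⟨h1, h2⟩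
      by_cases hx : x ∈ t.dom
      · exact Or.inl ⟨h1, Or.inl hx, fun h => h2 (Or.inl h)⟩
      · exact Or.inr hx
    refine (measure_mono hsub).trans ((measure_union_le _ _).trans ?_)
    rw [ht0, add_zero]
    refine (t.measure_boundary_le s hs).trans ?_
    exact (mul_le_mul_right prob_le_one _).trans (mul_one _).le

end

section
variable {Γ : Type*} [Group Γ] [MulAction Γ X] [Countable Γ] [StandardBorelSpace X]
  [MeasurableConstSMul Γ X] {μ : Measure X} {R : Set (X × X)}

omit [StandardBorelSpace X] in
/-- A relation approximated by finite relations is hyperfinite. -/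
lemma hyperfiniteOn_univ_of_approx
    (hRm : MeasurableSet R) (hsub : ∀ q ∈ R, ∃ g : Γ, q.2 = g • q.1)
    (h : ∀ (S : Finset Γ), ∀ ε > 0, ∃ F : Set (X × X), MeasurableSet F ∧ IsEquivRelSet F ∧ F ⊆ R ∧
      (∀ x, {y | (x, y) ∈ F}.Finite) ∧
      ∀ s ∈ S, μ {x | (x, s • x) ∈ R ∧ (x, s • x) ∉ F} ≤ 2 * ENNReal.ofReal ε) :
    HyperfiniteOn μ R univ := by
  classical
  obtain ⟨e, he⟩ := exists_surjective_nat Γ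
  choose F hFm hF hFR hFf hFμ using fun n : ℕ =>
    h ((Finset.range n).image e) ((1 / 2) ^ n) (by positivity)
  set Y : Set X := {x | ∀ g : Γ, (x, g • x) ∈ R → ∃ n, ∀ m, n ≤ m → (x, g • x) ∈ F m}
  have hYm : MeasurableSet Y := measurableSet_setOfPred.2 (Measurable.forall fun g =>
    (measurableSet_setOfPred.1 (measurableSet_rel_smul hRm g)).imp (Measurable.exists fun n =>
      Measurable.forall fun m => measurable_const.imp
        (measurableSet_setOfPred.1 (measurableSet_rel_smul (hFm m) g))))
  have hY : ∀ᵐ x ∂μ, x ∈ Y := by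
    refine ae_all_iff.2 fun g => ?_
    obtain ⟨k, rfl⟩ := he g
    set s : ℕ → Set X := fun n => if k < n then {x | (x, e k • x) ∈ R ∧ (x, e k • x) ∉ F n} else ∅
    have hs : ∀ n, μ (s n) ≤ 2 * ENNReal.ofReal ((1 / 2) ^ n) := fun n => by
      by_cases hk : k < n
      · simp only [s, if_pos hk]
        exact hFμ n _ (Finset.mem_image_of_mem e (Finset.mem_range.2 hk))
      · simp [s, if_neg hk]
    have hsum : ∑' n, μ (s n) ≠ ⊤ := by
      refine ne_top_of_le_ne_top ?_ (ENNReal.tsum_le_tsum hs)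
      rw [ENNReal.tsum_mul_left, ← ENNReal.ofReal_tsum_of_nonneg (fun n => by positivity)
        summable_geometric_two]
      exact ENNReal.mul_ne_top (by simp) ENNReal.ofReal_ne_top
    filter_upwards [ae_eventually_notMem hsum] with x hx hxR
    obtain ⟨n, hn⟩ := eventually_atTop.1 hx
    refine ⟨max n (k + 1), fun m hm => ?_⟩
    by_contra hc
    refine hn m ((le_max_left _ _).trans hm) ?_
    simp only [s, if_pos (show k < m from (le_max_right n (k + 1)).trans hm)]
    exact ⟨hxR, hc⟩
  refine ⟨Y, hYm, subset_univ _, ?_, fun n => {q | q ∈ Y ×ˢ Y ∧ ∀ m, n ≤ m → q ∈ F m},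
    fun n n' hn q hq => ⟨hq.1, fun m hm => hq.2 m (hn.trans hm)⟩, fun n => ⟨?_, ⟨?_, ?_, ?_, ?_⟩,
      fun x => (hFf n x).subset fun y hy => hy.2 n le_rfl⟩, ?_⟩
  · rw [← compl_eq_univ_sdiff]
    exact hY
  · exact (hYm.prod hYm).inter (measurableSet_setOfPred.2 (Measurable.forall fun m =>
      measurable_const.imp (measurableSet_setOfPred.1 (hFm m))))
  · exact fun q hq => hq.1
  · exact fun x hx => ⟨⟨hx, hx⟩, fun m _ => (hF m).1 x⟩
  · exact fun x y h => ⟨⟨h.1.2, h.1.1⟩, fun m hm => (hF m).2.1 x y (h.2 m hm)⟩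
  · exact fun x y z h h' => ⟨⟨h.1.1, h'.1.2⟩, fun m hm =>
      (hF m).2.2 x y z (h.2 m hm) (h'.2 m hm)⟩
  · ext ⟨x, y⟩
    simp only [mem_inter_iff, mem_iUnion, mem_ofPred_eq]
    constructor
    · rintro ⟨hR, hxy⟩
      obtain ⟨g, rfl : y = g • x⟩ := hsub _ hR
      obtain ⟨n, hn⟩ := hxy.1 g hR
      exact ⟨n, hxy, hn⟩
    · rintro ⟨n, hxy, hn⟩
      exact ⟨hFR n (hn n le_rfl), hxy⟩

end

section
variable {Γ : Type*} [Group Γ] [Countable Γ]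

attribute [local instance] bernoulliAction measurableConstSMul_bernoulli

/-- A subrelation of the orbit relation of the Bernoulli shift with almost invariant partitions
into small pieces is hyperfinite. -/
theorem hyperfiniteOn_univ_of_hasSmallPartitions {μ : Measure (Γ → ℝ)}
    (hμ : IsBernoulliLebProduct μ) {R : Set ((Γ → ℝ) × (Γ → ℝ))} (hRm : MeasurableSet R)
    (hR : IsEquivRelSet R) (hsub : ∀ q ∈ R, ∃ g : Γ, q.2 = g • q.1)
    (hSP : HasSmallPartitions Γ μ R) : HyperfiniteOn μ R univ :=
  have := smulInvariantMeasure_bernoulli hμ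
  have := hμ.1
  hyperfiniteOn_univ_of_approx hRm hsub fun S _ hε =>
    exists_finite_approx hRm hR (fun _ hg => ae_smul_ne_bernoulli hμ hg)
      (fun S _ hB hB0 => exists_tile_bernoulli hμ hRm hR hSP S hB hB0 hε) S

end

section
variable {μ : Measure X} {R : Set (X × X)}

/-- A measurable set that is a union of `R`-classes. -/
def IsInvariantSet (R : Set (X × X)) (A : Set X) : Prop :=
  MeasurableSet A ∧ ∀ x y, (x, y) ∈ R → (x ∈ A ↔ y ∈ A)

namespace IsInvariantSet
variable {A B : Set X}

lemma empty : IsInvariantSet R ∅ := ⟨.empty, fun _ _ _ => Iff.rfl⟩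

lemma compl (hA : IsInvariantSet R A) : IsInvariantSet R Aᶜ :=
  ⟨hA.1.compl, fun x y h => not_congr (hA.2 x y h)⟩

lemma union (hA : IsInvariantSet R A) (hB : IsInvariantSet R B) : IsInvariantSet R (A ∪ B) :=
  ⟨hA.1.union hB.1, fun x y h => or_congr (hA.2 x y h) (hB.2 x y h)⟩

lemma inter (hA : IsInvariantSet R A) (hB : IsInvariantSet R B) : IsInvariantSet R (A ∩ B) :=
  ⟨hA.1.inter hB.1, fun x y h => and_congr (hA.2 x y h) (hB.2 x y h)⟩

lemma sdiff (hA : IsInvariantSet R A) (hB : IsInvariantSet R B) : IsInvariantSet R (A \ B) :=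
  hA.inter hB.compl

lemma iUnion {f : ℕ → Set X} (hf : ∀ n, IsInvariantSet R (f n)) : IsInvariantSet R (⋃ n, f n) :=
  ⟨.iUnion fun n => (hf n).1, fun x y h => by
    simp only [mem_iUnion]; exact exists_congr fun n => (hf n).2 x y h⟩

lemma disjointed {f : ℕ → Set X} (hf : ∀ n, IsInvariantSet R (f n)) (n : ℕ) :
    IsInvariantSet R (disjointed f n) :=
  disjointedRec (p := IsInvariantSet R) (fun _ i h => h.sdiff (hf i)) (hf n)

end IsInvariantSet

lemma HyperfiniteOn.mono_invariant {A A' : Set X} (h : HyperfiniteOn μ R A) (hA : A' ⊆ A)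
    (hA' : MeasurableSet A') : HyperfiniteOn μ R A' := by
  obtain ⟨Y, hYm, hYA, hY0, Rn, hRn, hRn', hU⟩ := h
  refine ⟨Y ∩ A', hYm.inter hA', inter_subset_right, measure_mono_null (fun x hx => ?_) hY0,
    fun n => Rn n ∩ A' ×ˢ A', fun m n hmn => inter_subset_inter_left _ (hRn hmn), fun n =>
    ⟨(hRn' n).1.inter (hA'.prod hA'), ⟨?_, ?_, ?_, ?_⟩, fun x => ?_⟩, ?_⟩
  · exact ⟨hA hx.1, fun h => hx.2 ⟨h, hx.1⟩⟩
  · exact fun q hq => ⟨⟨((hRn' n).2.1.1 hq.1).1, hq.2.1⟩, ⟨((hRn' n).2.1.1 hq.1).2, hq.2.2⟩⟩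
  · exact fun x hx => ⟨(hRn' n).2.1.2.1 x hx.1, hx.2, hx.2⟩
  · exact fun x y h => ⟨(hRn' n).2.1.2.2.1 x y h.1, h.2.2, h.2.1⟩
  · exact fun x y z h h' => ⟨(hRn' n).2.1.2.2.2 x y z h.1 h'.1, h.2.1, h'.2.2⟩
  · exact ((hRn' n).2.2 x).subset fun y hy => hy.1
  · rw [← iUnion_inter, ← hU, prod_inter_prod.symm, inter_assoc]

lemma HyperfiniteOn.of_ae {A A' : Set X} (h : HyperfiniteOn μ R A) (hA : A ⊆ A')
    (h0 : μ (A' \ A) = 0) : HyperfiniteOn μ R A' := by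
  obtain ⟨Y, hYm, hYA, hY0, hRn⟩ := h
  refine ⟨Y, hYm, hYA.trans hA, measure_mono_null (fun x hx => ?_) (measure_union_null h0 hY0), hRn⟩
  by_cases h : x ∈ A
  · exact Or.inr ⟨h, hx.2⟩
  · exact Or.inl ⟨hx.1, h⟩

lemma hyperfiniteOn_empty : HyperfiniteOn μ R ∅ :=
  ⟨∅, .empty, Subset.rfl, by simp, fun _ => ∅, fun _ _ _ => Subset.rfl,
    fun _ => ⟨.empty, by simp [IsEquivRelOn], by simp⟩, by simp⟩

lemma hyperfiniteOn_iUnion {f : ℕ → Set X} (hf : ∀ n, IsInvariantSet R (f n))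
    (h : ∀ n, HyperfiniteOn μ R (f n)) : HyperfiniteOn μ R (⋃ n, f n) := by
  have hd := fun n => (h n).mono_invariant (disjointed_subset f n)
    (IsInvariantSet.disjointed hf n).1
  have hinv := fun n => (IsInvariantSet.disjointed hf n).2
  have hdis := disjoint_disjointed f
  rw [← iUnion_disjointed]
  generalize disjointed f = D at *
  choose Y hYm hYD hY0 Rn hRn hRn' hU using hd
  have huniq : ∀ {i j x}, x ∈ Y i → x ∈ Y j → i = j := fun {i j x} hi hj => by
    by_contra hne
    exact Set.disjoint_left.1 (hdis hne) (hYD i hi) (hYD j hj)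
  refine ⟨⋃ i, Y i, .iUnion hYm, iUnion_mono hYD, ?_, fun n => ⋃ i, Rn i n,
    fun m n hmn => iUnion_mono fun i => hRn i hmn, fun n => ⟨.iUnion fun i => (hRn' i n).1,
      ⟨?_, ?_, ?_, ?_⟩, fun x => ?_⟩, ?_⟩
  · refine measure_mono_null (fun x hx => ?_) (measure_iUnion_null hY0)
    obtain ⟨i, hi⟩ := mem_iUnion.1 hx.1
    exact mem_iUnion_of_mem i ⟨hi, fun h => hx.2 (mem_iUnion_of_mem i h)⟩
  · refine iUnion_subset fun i q hq => ?_
    have := (hRn' i n).2.1.1 hq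
    exact ⟨mem_iUnion_of_mem i this.1, mem_iUnion_of_mem i this.2⟩
  · intro x hx
    obtain ⟨i, hi⟩ := mem_iUnion.1 hx
    exact mem_iUnion_of_mem i ((hRn' i n).2.1.2.1 x hi)
  · intro x y hx
    obtain ⟨i, hi⟩ := mem_iUnion.1 hx
    exact mem_iUnion_of_mem i ((hRn' i n).2.1.2.2.1 x y hi)
  · intro x y z hx hy
    obtain ⟨i, hi⟩ := mem_iUnion.1 hx
    obtain ⟨j, hj⟩ := mem_iUnion.1 hy
    obtain rfl := huniq ((hRn' i n).2.1.1 hi).2 ((hRn' j n).2.1.1 hj).1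
    exact mem_iUnion_of_mem i ((hRn' i n).2.1.2.2.2 x y z hi hj)
  · by_cases hx : x ∈ ⋃ i, Y i
    · obtain ⟨i, hi⟩ := mem_iUnion.1 hx
      refine ((hRn' i n).2.2 x).subset fun y hy => ?_
      obtain ⟨j, hj⟩ := mem_iUnion.1 (show (x, y) ∈ ⋃ i, Rn i n from hy)
      obtain rfl := huniq hi ((hRn' j n).2.1.1 hj).1
      exact hj
    · convert finite_empty
      refine eq_empty_of_forall_notMem fun y hy => hx ?_
      obtain ⟨j, hj⟩ := mem_iUnion.1 (show (x, y) ∈ ⋃ i, Rn i n from hy)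
      exact mem_iUnion_of_mem j ((hRn' j n).2.1.1 hj).1
  · ext ⟨x, y⟩
    constructor
    · rintro ⟨hR, hx, hy⟩
      obtain ⟨i, hi⟩ := mem_iUnion.1 hx
      obtain ⟨j, hj⟩ := mem_iUnion.1 hy
      obtain rfl : i = j := by
        by_contra hne
        exact Set.disjoint_left.1 (hdis hne) ((hinv i x y hR).1 (hYD i hi)) (hYD j hj)
      obtain ⟨n, hn⟩ := mem_iUnion.1 ((hU i).subset ⟨hR, hi, hj⟩)
      exact mem_iUnion_of_mem n (mem_iUnion_of_mem i hn)
    · intro h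
      obtain ⟨n, hn⟩ := mem_iUnion.1 h
      obtain ⟨i, hi⟩ := mem_iUnion.1 hn
      have := (hU i).superset (mem_iUnion_of_mem n hi)
      exact ⟨this.1, mem_iUnion_of_mem i this.2.1, mem_iUnion_of_mem i this.2.2⟩

lemma ErgodicOnRel.mono_invariant {A A' : Set X} (h : ErgodicOnRel μ R A) (hA : A' ⊆ A)
    (hA' : IsInvariantSet R A') : ErgodicOnRel μ R A' := by
  intro B hB hBA hinv
  refine (h B hB (hBA.trans hA) fun x y hx hy hR => ?_).imp_right
    (measure_mono_null (sdiff_subset_sdiff_left hA))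
  by_cases hxA : x ∈ A'
  · exact hinv x y hxA ((hA'.2 x y hR).1 hxA) hR
  · exact iff_of_false (fun h => hxA (hBA h)) fun h => hxA ((hA'.2 x y hR).2 (hBA h))

/-- A class of measurable sets closed under countable unions has a largest element modulo null
sets. -/
lemma exists_maximal_mod_null [IsFiniteMeasure μ] {P : Set X → Prop}
    (hP : ∀ A, P A → MeasurableSet A) (h0 : P ∅)
    (hU : ∀ f : ℕ → Set X, (∀ n, P (f n)) → P (⋃ n, f n)) :
    ∃ A, P A ∧ ∀ B, P B → μ (B \ A) = 0 := by
  have : Nonempty {A : Set X // P A} := ⟨⟨∅, h0⟩⟩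
  obtain ⟨A, hA⟩ := exists_forall_ge_le_of_monotone (α := {A : Set X // P A})
    (fun A => μ.real A) (fun A B h => measureReal_mono h (measure_ne_top _ _))
    ⟨μ.real univ, by rintro _ ⟨t, rfl⟩; exact measureReal_mono (subset_univ _)⟩
    fun u _ => ⟨⟨_, hU _ fun n => (u n).2⟩, fun n => subset_iUnion (fun n => (u n : Set X)) n⟩
  refine ⟨A, A.2, fun B hB => ?_⟩
  have hAB : P (A ∪ B) := by
    convert hU (fun n => if n = 0 then A else B) fun n => by split_ifs <;> [exact A.2; exact hB]
    ext x
    simp only [mem_union, mem_iUnion]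
    refine ⟨fun h => h.elim (fun h => ⟨0, by simpa⟩) fun h => ⟨1, by simpa⟩, fun ⟨n, hn⟩ => ?_⟩
    split_ifs at hn
    · exact Or.inl hn
    · exact Or.inr hn
  have := hA ⟨_, hAB⟩ (show (A : Set X) ⊆ A ∪ B from subset_union_left)
  change μ.real (A ∪ B) ≤ μ.real A at this
  rw [← union_sdiff_self,
    measureReal_union disjoint_sdiff_right ((hP _ hB).diff (hP _ A.2))] at this
  exact (measureReal_eq_zero_iff).1 (le_antisymm (by linarith) measureReal_nonneg)

end

section
variable (Γ : Type*) [Group Γ]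

/-- The set `A` has partitions into small pieces that are almost invariant under the part of the
action of `Γ` contained in `R`. -/
def HasSmallPartitionsOn [MulAction Γ X] (μ : Measure X) (R : Set (X × X)) (A : Set X) : Prop :=
  ∀ S : Finset Γ, ∀ ε > 0, ∀ δ > 0, ∃ (N : ℕ) (k : X → ℕ), Measurable k ∧ (∀ x, k x < N) ∧
    (∀ i, μ.real {x | x ∈ A ∧ k x = i} ≤ ε) ∧
    ∀ s ∈ S, μ.real {x | x ∈ A ∧ (x, s • x) ∈ R ∧ k x ≠ k (s • x)} ≤ δ

end

section
variable {Γ : Type*} [Group Γ]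

lemma exists_partition_bernoulli {μ : Measure (Γ → ℝ)} (hμ : IsBernoulliLebProduct μ) {ε : ℝ}
    (hε : 0 < ε) : ∃ (N : ℕ) (k : (Γ → ℝ) → ℕ), Measurable k ∧ (∀ x, k x < N) ∧
      ∀ i, μ.real {x | k x = i} ≤ ε := by
  have := hμ.1
  obtain ⟨M, hM⟩ := exists_nat_gt (1 / ε)
  have hM0 : (0 : ℝ) < M := (by positivity : 0 < 1 / ε).trans hM
  refine ⟨M + 1, fun x => min ⌊M * x 1⌋₊ M, ?_, fun x => by dsimp only; omega, fun i => ?_⟩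
  · exact (Nat.measurable_floor.comp ((measurable_pi_apply 1).const_mul _)).min measurable_const
  have hI : ∀ a b : ℝ, μ {x | x 1 ∈ Icc a b} ≤ ENNReal.ofReal (b - a) := fun a b => by
    have := hμ.2 {1} (fun _ => Icc a b) fun _ => measurableSet_Icc
    simp only [Finset.mem_singleton, forall_eq, Finset.prod_singleton] at this
    rw [this]
    exact (measure_mono inter_subset_left).trans (by simp)
  have hout : μ {x | x 1 ∉ Icc (0 : ℝ) 1} = 0 := by
    have := hμ.2 {1} (fun _ => (Icc (0 : ℝ) 1)ᶜ) fun _ => measurableSet_Icc.compl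
    simpa using this
  have hsub : {x : Γ → ℝ | min ⌊M * x 1⌋₊ M = i} ⊆
      {x | x 1 ∈ Icc ((i : ℝ) / M) ((i + 1 : ℝ) / M)} ∪ {x | x 1 ∉ Icc (0 : ℝ) 1} := by
    intro x hx
    by_cases h : x 1 ∈ Icc (0 : ℝ) 1
    · left
      have hle : (M : ℝ) * x 1 ≤ M := by nlinarith [h.2]
      have h1 : ⌊(M : ℝ) * x 1⌋₊ ≤ M := Nat.floor_le_of_le hle
      have h2 : ⌊(M : ℝ) * x 1⌋₊ = i := by
        have : min ⌊(M : ℝ) * x 1⌋₊ M = i := hx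
        omega
      have h3 := (Nat.floor_eq_iff (mul_nonneg hM0.le h.1)).1 h2
      constructor
      · rw [div_le_iff₀ hM0]; linarith
      · rw [le_div_iff₀ hM0]; linarith
    · exact Or.inr h
  have h1 : μ {x : Γ → ℝ | min ⌊M * x 1⌋₊ M = i} ≤ ENNReal.ofReal ε := by
    refine (measure_mono hsub).trans ((measure_union_le _ _).trans ?_)
    rw [hout, add_zero]
    refine (hI _ _).trans (ENNReal.ofReal_le_ofReal ?_)
    rw [← sub_div, add_sub_cancel_left]
    rw [div_lt_iff₀ hε] at hM
    rw [div_le_iff₀ hM0]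
    linarith
  exact ENNReal.toReal_le_of_le_ofReal hε.le h1

attribute [local instance] bernoulliAction measurableConstSMul_bernoulli

theorem hyperfiniteOn_of_hasSmallPartitionsOn [Countable Γ] {μ : Measure (Γ → ℝ)}
    (hμ : IsBernoulliLebProduct μ) {R : Set ((Γ → ℝ) × (Γ → ℝ))} (hRm : MeasurableSet R)
    (hR : IsEquivRelSet R) (hsub : ∀ q ∈ R, ∃ g : Γ, q.2 = g • q.1) {A : Set (Γ → ℝ)}
    (hA : IsInvariantSet R A) (hSP : HasSmallPartitionsOn Γ μ R A) : HyperfiniteOn μ R A := by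
  classical
  have := hμ.1
  set R' : Set ((Γ → ℝ) × (Γ → ℝ)) := {q | q.1 = q.2 ∨ q ∈ R ∧ q.1 ∈ A} with hR'
  have hR'm : MeasurableSet R' := (measurableSet_eq_fun measurable_fst measurable_snd).union
    (hRm.inter (measurable_fst hA.1))
  have hR'R : R' ⊆ R := by
    rintro ⟨x, y⟩ (h | h)
    · obtain rfl : x = y := h
      exact hR.1 x
    · exact h.1
  have hR'e : IsEquivRelSet R' := by
    refine ⟨fun x => Or.inl rfl, ?_, ?_⟩
    · rintro x y (h | h)
      · exact Or.inl h.symm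
      · exact Or.inr ⟨hR.2.1 _ _ h.1, (hA.2 _ _ h.1).1 h.2⟩
    · rintro x y z (h | h) h'
      · obtain rfl : x = y := h
        exact h'
      · exact Or.inr ⟨hR.2.2 _ _ _ h.1 (hR'R h'), h.2⟩
  have hSP' : HasSmallPartitions Γ μ R' := by
    intro S ε hε δ hδ
    obtain ⟨N, k, hk, hkN, hkε, hkδ⟩ := hSP S ε hε δ hδ
    obtain ⟨N₀, k₀, hk₀, hkN₀, hkε₀⟩ := exists_partition_bernoulli hμ hε
    refine ⟨N + N₀, fun x => if x ∈ A then k x else N + k₀ x,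
      Measurable.ite hA.1 hk (measurable_const.add hk₀), fun x => ?_, fun i => ?_, fun s hs => ?_⟩
    · have := hkN x
      have := hkN₀ x
      dsimp only
      split_ifs <;> omega
    · by_cases hi : i < N
      · refine (measureReal_mono ?_ (measure_ne_top _ _)).trans (hkε i)
        intro x hx
        change (if x ∈ A then k x else N + k₀ x) = i at hx
        split_ifs at hx with h
        · exact ⟨h, hx⟩
        · omega
      · refine (measureReal_mono ?_ (measure_ne_top _ _)).trans (hkε₀ (i - N))
        intro x hx
        change (if x ∈ A then k x else N + k₀ x) = i at hx
        change k₀ x = i - N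
        have := hkN x
        split_ifs at hx with h <;> omega
    · refine (measureReal_mono ?_ (measure_ne_top _ _)).trans (hkδ s hs)
      rintro x ⟨h | h, hne⟩
      · exact absurd (by rw [show s • x = x from h.symm]) hne
      · have h2 := (hA.2 _ _ h.1).1 h.2
        simp only [if_pos h.2, if_pos h2] at hne
        exact ⟨h.2, h.1, hne⟩
  have := (hyperfiniteOn_univ_of_hasSmallPartitions hμ hR'm hR'e (fun q hq => hsub q (hR'R hq))
    hSP').mono_invariant (subset_univ A) hA.1
  obtain ⟨Y, hY, hYA, hY0, Rn, hRn, hRn', hU⟩ := this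
  refine ⟨Y, hY, hYA, hY0, Rn, hRn, hRn', ?_⟩
  rw [← hU]
  ext q
  exact ⟨fun h => ⟨Or.inr ⟨h.1, hYA h.2.1⟩, h.2⟩, fun h => ⟨hR'R h.1, h.2⟩⟩

end

section
variable {μ : Measure X}

lemma tendsto_measureReal_inter_iUnion [IsFiniteMeasure μ] {ι : Type*} {l : Filter ι}
    {V : ι → Set X} (hV : ∀ i, MeasurableSet (V i)) {E : ℕ → Set X}
    (hE : ∀ j, MeasurableSet (E j)) (hd : Pairwise (Function.onFun Disjoint E)) {g : ℕ → ℝ}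
    (h : ∀ j, Tendsto (fun i => μ.real (V i ∩ E j)) l (nhds (g j))) :
    Tendsto (fun i => μ.real (V i ∩ ⋃ j, E j)) l (nhds (∑' j, g j)) := by
  have hS : ∀ D : ℕ → Set X, (∀ j, MeasurableSet (D j)) → Pairwise (Function.onFun Disjoint D) →
      HasSum (fun j => μ.real (D j)) (μ.real (⋃ j, D j)) := fun D hD hDd => by
    have h2 := measure_iUnion (μ := μ) hDd hD
    have := ENNReal.hasSum_toReal (f := fun j => μ (D j)) (by
      rw [← h2]; exact measure_ne_top _ _)
    rwa [← ENNReal.tsum_toReal_eq fun j => measure_ne_top _ _, ← h2] at this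
  have h1 : ∀ i, μ.real (V i ∩ ⋃ j, E j) = ∑' j, μ.real (V i ∩ E j) := fun i => by
    rw [inter_iUnion]
    exact (hS _ (fun j => (hV i).inter (hE j))
      fun a b hab => (hd hab).mono inter_subset_right inter_subset_right).tsum_eq.symm
  simp_rw [h1]
  refine tendsto_tsum_of_dominated_convergence (hS E hE hd).summable h
    (Eventually.of_forall fun i j => ?_)
  rw [Real.norm_of_nonneg measureReal_nonneg]
  exact measureReal_mono inter_subset_right

variable {Γ : Type*} [Group Γ] [MulAction Γ X] [MeasurableConstSMul Γ X]

open Classical in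
/-- The involution exchanging `E` and its translate by `s`, for `E` disjoint from `s • E`. -/
def swapTranslate (s : Γ) (E : Set X) (hE : ∀ x ∈ E, s • x ∉ E) : X ≃ X :=
  have h : Function.Involutive fun x =>
      if x ∈ E then s • x else if s⁻¹ • x ∈ E then s⁻¹ • x else x := by
    intro x
    by_cases h1 : x ∈ E
    · simp [h1, hE x h1]
    · by_cases h2 : s⁻¹ • x ∈ E
      · simp [h1, h2]
      · simp [h1, h2]
  h.toPerm

lemma measurable_swapTranslate (s : Γ) {E : Set X} (hE : ∀ x ∈ E, s • x ∉ E)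
    (hEm : MeasurableSet E) : Measurable (swapTranslate s E hE) := by
  classical
  exact Measurable.ite hEm (measurable_const_smul s)
    (Measurable.ite (measurable_const_smul s⁻¹ hEm) (measurable_const_smul s⁻¹) measurable_id)

lemma tendsto_measureReal_symmDiff_smul [IsFiniteMeasure μ] {R : Set (X × X)} {A : Set X}
    (hR : IsEquivRelSet R) (hA : IsInvariantSet R A) {B : ℕ → Set X}
    (hBR : ∀ φ : X ≃ X, Measurable ⇑φ → Measurable ⇑φ.symm →
      (∀ x ∈ A, (x, φ x) ∈ R ∧ φ x ∈ A) → (∀ x ∉ A, φ x = x) →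
      Tendsto (fun n => μ (symmDiff (B n) (⇑φ '' B n))) atTop (nhds 0)) (s : Γ) {E : Set X}
    (hE : MeasurableSet E) (hEA : E ⊆ A) (hER : ∀ x ∈ E, (x, s • x) ∈ R)
    (hEs : ∀ x ∈ E, s • x ∉ E) :
    Tendsto (fun n => μ.real ({x | ¬(x ∈ B n ↔ s • x ∈ B n)} ∩ E)) atTop (nhds 0) := by
  classical
  set φ := swapTranslate s E hEs
  have hφdef : ∀ x, φ x = if x ∈ E then s • x else if s⁻¹ • x ∈ E then s⁻¹ • x else x :=
    fun x => rfl
  have hsymm : φ.symm = φ := rfl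
  have hφm : Measurable φ := measurable_swapTranslate s hEs hE
  have hφR : ∀ x, (x, φ x) ∈ R := fun x => by
    rw [hφdef]
    split_ifs with h1 h2
    · exact hER x h1
    · have := hR.2.1 _ _ (hER _ h2)
      rwa [smul_inv_smul] at this
    · exact hR.1 x
  have h := hBR φ hφm (by rwa [hsymm]) (fun x hx => ⟨hφR x, (hA.2 _ _ (hφR x)).1 hx⟩)
    fun x hx => by
      rw [hφdef, if_neg fun h => hx (hEA h), if_neg fun h => hx ?_]
      have := (hA.2 _ _ (hER _ h)).1 (hEA h)
      rwa [smul_inv_smul] at this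
  have h0 : Tendsto (fun n => μ.real (symmDiff (B n) (⇑φ '' B n))) atTop (nhds 0) := by
    have := (ENNReal.tendsto_toReal (ENNReal.zero_ne_top)).comp h
    simpa [Measure.real, Function.comp_def] using this
  refine squeeze_zero (fun _ => measureReal_nonneg) (fun n => measureReal_mono ?_) h0
  rintro x ⟨hx, hxE⟩
  have h1 : s • x ∈ B n ↔ x ∈ φ '' B n := by
    rw [← φ.symm_symm, Equiv.image_symm_eq_preimage, hsymm, mem_preimage, hφdef, if_pos hxE]
  rw [mem_ofPred_eq, h1] at hx
  rw [mem_symmDiff]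
  tauto

lemma tendsto_measureReal_not_iff_smul [IsFiniteMeasure μ]
    [MeasurableSpace.CountablySeparated X] {R : Set (X × X)} {A : Set X} (hRm : MeasurableSet R)
    (hR : IsEquivRelSet R) (hA : IsInvariantSet R A)
    {B : ℕ → Set X} (hB : ∀ n, MeasurableSet (B n) ∧ B n ⊆ A)
    (hBR : ∀ φ : X ≃ X, Measurable ⇑φ → Measurable ⇑φ.symm →
      (∀ x ∈ A, (x, φ x) ∈ R ∧ φ x ∈ A) → (∀ x ∉ A, φ x = x) →
      Tendsto (fun n => μ (symmDiff (B n) (⇑φ '' B n))) atTop (nhds 0)) (s : Γ) :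
    Tendsto (fun n => μ.real {x | x ∈ A ∧ (x, s • x) ∈ R ∧ ¬(x ∈ B n ↔ s • x ∈ B n)}) atTop
      (nhds 0) := by
  obtain ⟨p, hp, hsep⟩ := exists_seq_separating X MeasurableSet.empty univ
  set W : Set X := {x | x ∈ A ∧ (x, s • x) ∈ R}
  have hW : MeasurableSet W := hA.1.inter (measurableSet_rel_smul hRm s)
  set F : ℕ → Set X := fun m => if m % 2 = 0 then
    {x | x ∈ W ∧ x ∈ p (m / 2) ∧ s • x ∉ p (m / 2)} else
    {x | x ∈ W ∧ x ∉ p (m / 2) ∧ s • x ∈ p (m / 2)} with hFdef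
  have hFm : ∀ m, MeasurableSet (F m) := fun m => by
    simp only [hFdef]
    split_ifs
    · exact hW.inter ((hp _).inter (measurable_const_smul s (hp _)).compl)
    · exact hW.inter ((hp _).compl.inter (measurable_const_smul s (hp _)))
  have hFW : ∀ m, F m ⊆ W := fun m x hx => by
    simp only [hFdef] at hx
    split_ifs at hx <;> exact hx.1
  have hFs : ∀ m, ∀ x ∈ F m, s • x ∉ F m := fun m x hx h => by
    simp only [hFdef] at hx h
    split_ifs at hx h with h0
    · exact hx.2.2 h.2.1
    · exact h.2.1 hx.2.2
  have hV : ∀ n, MeasurableSet {x | ¬(x ∈ B n ↔ s • x ∈ B n)} := fun n =>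
    measurableSet_setOfPred.2 ((measurableSet_setOfPred.1 (hB n).1).iff
      (measurableSet_setOfPred.1 (measurable_const_smul s (hB n).1))).not
  have key := tendsto_measureReal_inter_iUnion (μ := μ) (l := atTop) hV
    (E := disjointed F) (fun j => MeasurableSet.disjointed hFm j) (disjoint_disjointed F)
    (g := fun _ => 0) fun j => tendsto_measureReal_symmDiff_smul hR hA hBR s
      (MeasurableSet.disjointed hFm j)
      (fun x hx => (hFW j (disjointed_subset F j hx)).1)
      (fun x hx => (hFW j (disjointed_subset F j hx)).2)
      fun x hx h => hFs j x (disjointed_subset F j hx) (disjointed_subset F j h)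
  rw [tsum_zero, iUnion_disjointed] at key
  refine squeeze_zero (fun _ => measureReal_nonneg) (fun n => measureReal_mono ?_) key
  rintro x ⟨hxA, hxR, hx⟩
  refine ⟨hx, ?_⟩
  have hne : ¬ ∀ m, x ∈ p m ↔ s • x ∈ p m := fun h => by
    have := hsep x (mem_univ _) (s • x) (mem_univ _) h
    rw [← this] at hx
    exact hx Iff.rfl
  push Not at hne
  obtain ⟨m, ⟨h1, h2⟩ | ⟨h1, h2⟩⟩ := hne
  · refine mem_iUnion_of_mem (2 * m) ?_
    simp only [hFdef, Nat.mul_mod_right, if_true, Nat.mul_div_cancel_left m two_pos]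
    exact ⟨⟨hxA, hxR⟩, h1, h2⟩
  · refine mem_iUnion_of_mem (2 * m + 1) ?_
    have e1 : (2 * m + 1) % 2 ≠ 0 := by omega
    have e2 : (2 * m + 1) / 2 = m := by omega
    simp only [hFdef, if_neg e1, e2]
    exact ⟨⟨hxA, hxR⟩, h1, h2⟩

end

section
variable {μ : Measure X}

/-- Along an ultrafilter, a sequence of sets converges weakly to a density. -/
lemma exists_tendsto_setLIntegral [IsFiniteMeasure μ] {ι : Type*} (𝒰 : Ultrafilter ι)
    {B : ι → Set X} (hB : ∀ i, MeasurableSet (B i)) :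
    ∃ f : X → ENNReal, Measurable f ∧ ∀ D, MeasurableSet D →
      Tendsto (fun i => μ (B i ∩ D)) 𝒰 (nhds (∫⁻ x in D, f x ∂μ)) := by
  have hex : ∀ D : Set X, ∃ L, Tendsto (fun i => μ (B i ∩ D)) 𝒰 (nhds L) := fun D =>
    ⟨_, (𝒰.map fun i => μ (B i ∩ D)).le_nhds_lim⟩
  choose L hL using hex
  have hle : ∀ D, L D ≤ μ D := fun D =>
    le_of_tendsto (hL D) (Eventually.of_forall fun i => measure_mono inter_subset_right)
  have hfin : ∀ D, L D ≠ ⊤ := fun D => ne_top_of_le_ne_top (measure_ne_top _ _) (hle D)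
  have hLr : ∀ D, Tendsto (fun i => μ.real (B i ∩ D)) 𝒰 (nhds (L D).toReal) := fun D =>
    (ENNReal.tendsto_toReal (hfin D)).comp (hL D)
  set lam : Measure X := Measure.ofMeasurable (fun D _ => L D)
    (le_antisymm ((hle ∅).trans (by simp)) zero_le) fun E hE hd => by
      have h1 := tendsto_nhds_unique (hLr (⋃ j, E j))
        (tendsto_measureReal_inter_iUnion hB hE hd fun j => hLr (E j))
      have h2 : ∑' j, L (E j) ≠ ⊤ := by
        refine ne_top_of_le_ne_top (measure_ne_top μ (⋃ j, E j)) ?_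
        rw [measure_iUnion hd hE]
        exact ENNReal.tsum_le_tsum fun j => hle _
      rw [← ENNReal.tsum_toReal_eq fun j => hfin _] at h1
      exact (ENNReal.toReal_eq_toReal_iff' (hfin _) h2).1 h1
  have hlam : ∀ D, MeasurableSet D → lam D = L D := fun D hD => Measure.ofMeasurable_apply D hD
  have hfl : IsFiniteMeasure lam := ⟨by rw [hlam _ .univ]; exact (hfin _).lt_top⟩
  have hac : lam ≪ μ := Measure.AbsolutelyContinuous.mk fun D hD h0 => by
    rw [hlam D hD]
    exact le_antisymm ((hle D).trans h0.le) zero_le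
  refine ⟨lam.rnDeriv μ, Measure.measurable_rnDeriv _ _, fun D hD => ?_⟩
  rw [← withDensity_apply _ hD, Measure.withDensity_rnDeriv_eq _ _ hac, hlam D hD]
  exact hL D

variable {Γ : Type*} [Group Γ] [MulAction Γ X] [MeasurableConstSMul Γ X]

lemma ae_eq_smul_of_tendsto [IsFiniteMeasure μ] [SMulInvariantMeasure Γ X μ] {ι : Type*}
    {l : Filter ι} [l.NeBot] {B : ι → Set X}
    {W : Set X} (hW : MeasurableSet W) {f : X → ENNReal} (hf : Measurable f)
    (hfB : ∀ D, MeasurableSet D → Tendsto (fun i => μ (B i ∩ D)) l (nhds (∫⁻ x in D, f x ∂μ)))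
    (s : Γ) (hs : Tendsto (fun i => μ.real {x | x ∈ W ∧ ¬(x ∈ B i ↔ s • x ∈ B i)}) l (nhds 0)) :
    ∀ᵐ x ∂μ, x ∈ W → f (s • x) = f x := by
  have hs' : Tendsto (fun i => μ {x | x ∈ W ∧ ¬(x ∈ B i ↔ s • x ∈ B i)}) l (nhds 0) := by
    have := ENNReal.tendsto_ofReal hs
    simpa [Measure.real] using this
  rw [← ae_restrict_iff' hW]
  refine ae_eq_of_forall_setLIntegral_eq_of_sigmaFinite (f := fun x => f (s • x))
    (hf.comp (measurable_const_smul s)) hf fun D hD _ => ?_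
  rw [Measure.restrict_restrict hD]
  set E := D ∩ W
  have hE : MeasurableSet E := hD.inter hW
  have hpre : (fun x : X => s • x) ⁻¹' ((fun x => s⁻¹ • x) ⁻¹' E) = E := by
    ext x; simp
  have hEm : MeasurableSet ((fun x : X => s⁻¹ • x) ⁻¹' E) := measurable_const_smul s⁻¹ hE
  have h1 : ∫⁻ x in E, f (s • x) ∂μ = ∫⁻ x in (fun x => s⁻¹ • x) ⁻¹' E, f x ∂μ := by
    rw [← (measurePreserving_smul s μ).setLIntegral_comp_preimage hEm hf, hpre]
  have h2 : ∀ i, μ (B i ∩ (fun x => s⁻¹ • x) ⁻¹' E) = μ ((fun x => s • x) ⁻¹' B i ∩ E) := by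
    intro i
    rw [← measure_preimage_smul μ s (B i ∩ (fun x => s⁻¹ • x) ⁻¹' E), preimage_inter, hpre]
  have h3 := hfB _ hEm
  simp_rw [h2] at h3
  rw [h1]
  have hE' := hfB E hE
  refine le_antisymm ?_ ?_
  · have := hE'.add hs'
    rw [add_zero] at this
    refine le_of_tendsto_of_tendsto' h3 this fun i =>
      (measure_mono fun x hx => ?_).trans (measure_union_le _ _)
    by_cases h : x ∈ B i
    · exact Or.inl ⟨h, hx.2⟩
    · exact Or.inr ⟨hx.2.2, fun h' => h (h'.2 hx.1)⟩
  · have := h3.add hs'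
    rw [add_zero] at this
    refine le_of_tendsto_of_tendsto' hE' this fun i =>
      (measure_mono fun x hx => ?_).trans (measure_union_le _ _)
    by_cases h : s • x ∈ B i
    · exact Or.inl ⟨h, hx.2⟩
    · exact Or.inr ⟨hx.2.2, fun h' => h (h'.1 hx.1)⟩

lemma ErgodicOnRel.ae_eq_const [Countable Γ] {R : Set (X × X)}
    {A : Set X} (hRm : MeasurableSet R) (hR : IsEquivRelSet R)
    (hsub : ∀ q ∈ R, ∃ g : Γ, q.2 = g • q.1) (hA : MeasurableSet A) (hAe : ErgodicOnRel μ R A)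
    {f : X → ENNReal} (hf : Measurable f)
    (hfR : ∀ g : Γ, ∀ᵐ x ∂μ, x ∈ A ∧ (x, g • x) ∈ R → f (g • x) = f x) :
    ∃ c, ∀ᵐ x ∂μ, x ∈ A → f x = c := by
  have hall : ∀ᵐ x ∂μ, ∀ g : Γ, x ∈ A ∧ (x, g • x) ∈ R → f (g • x) = f x := ae_all_iff.2 hfR
  obtain ⟨c, hc⟩ := exists_eventuallyEq_const_of_forall_separating (l := ae (μ.restrict A))
    (f := f) MeasurableSet fun U hU => by
      set P : Set X := {x | x ∈ A ∧ ∃ g : Γ, (x, g • x) ∈ R ∧ f (g • x) ∈ U}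
      have hP : MeasurableSet P := hA.inter (measurableSet_setOfPred.2 <|
        Measurable.exists fun g => (measurableSet_setOfPred.1 (measurableSet_rel_smul hRm g)).and
          (measurableSet_setOfPred.1 ((hf.comp (measurable_const_smul g)) hU)))
      have hiff : ∀ᵐ x ∂μ, x ∈ A → (x ∈ P ↔ f x ∈ U) := by
        filter_upwards [hall] with x hx hxA
        constructor
        · rintro ⟨-, g, hg, hgU⟩
          rwa [← hx g ⟨hxA, hg⟩]
        · exact fun h => ⟨hxA, 1, by simpa using hR.1 x, by simpa using h⟩
      have hstep : ∀ x y, x ∈ A → y ∈ A → (x, y) ∈ R → x ∈ P → y ∈ P := by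
        rintro x y - hy hxy ⟨-, g, hg, hgU⟩
        obtain ⟨h, rfl : y = h • x⟩ := hsub _ hxy
        refine ⟨hy, g * h⁻¹, ?_, ?_⟩ <;> rw [mul_smul, inv_smul_smul]
        · exact hR.2.2 _ _ _ (hR.2.1 _ _ hxy) hg
        · exact hgU
      rw [ae_restrict_iff' hA, ae_restrict_iff' hA]
      obtain h | h := hAe P hP (fun x hx => hx.1) fun x y hx hy hxy =>
        ⟨hstep x y hx hy hxy, hstep y x hy hx (hR.2.1 _ _ hxy)⟩
      · right
        filter_upwards [hiff, measure_eq_zero_iff_ae_notMem.1 h] with x h1 h2 hx h3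
        exact h2 ((h1 hx).2 h3)
      · left
        filter_upwards [hiff, measure_eq_zero_iff_ae_notMem.1 h] with x h1 h2 hx
        exact (h1 hx).1 (not_not.1 fun h => h2 ⟨hx, h⟩)
  exact ⟨c, (ae_restrict_iff' hA).1 hc⟩

/-- If an ergodic restriction is not strongly ergodic, then some almost invariant sequence of sets
is equidistributed along an ultrafilter with nontrivial density. -/
lemma exists_ultrafilter_of_not_stronglyErgodic [Countable Γ] [IsFiniteMeasure μ]
    [SMulInvariantMeasure Γ X μ] [MeasurableSpace.CountablySeparated X] {R : Set (X × X)}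
    {A : Set X} (hRm : MeasurableSet R) (hR : IsEquivRelSet R)
    (hsub : ∀ q ∈ R, ∃ g : Γ, q.2 = g • q.1) (hA : IsInvariantSet R A)
    (hAe : ErgodicOnRel μ R A) (hAs : ¬ StronglyErgodicOnRel μ R A) :
    ∃ (B : ℕ → Set X) (l : Filter ℕ) (c : ℝ), l.NeBot ∧ 0 < c ∧ c < 1 ∧
      (∀ n, MeasurableSet (B n)) ∧
      (∀ D, MeasurableSet D → D ⊆ A →
        Tendsto (fun n => μ.real (B n ∩ D)) l (nhds (c * μ.real D))) ∧
      ∀ s : Γ, Tendsto (fun n => μ.real {x | x ∈ A ∧ (x, s • x) ∈ R ∧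
        ¬(x ∈ B n ↔ s • x ∈ B n)}) l (nhds 0) := by
  unfold StronglyErgodicOnRel at hAs
  push Not at hAs
  obtain ⟨B, hB, hBR, hBn⟩ := hAs
  have hai := tendsto_measureReal_not_iff_smul (Γ := Γ) hRm hR hA hB hBR
  obtain ⟨V, hV, hfr⟩ := not_tendsto_iff_exists_frequently_notMem.1 hBn
  have hne : (atTop ⊓ 𝓟 {n | μ (B n) * (μ A - μ (B n)) ∉ V}).NeBot := by
    exact frequently_iff_neBot.1 hfr
  set 𝒰 := Ultrafilter.of (atTop ⊓ 𝓟 {n | μ (B n) * (μ A - μ (B n)) ∉ V})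
  have hle := Ultrafilter.of_le (atTop ⊓ 𝓟 {n | μ (B n) * (μ A - μ (B n)) ∉ V})
  have h𝒰 : (𝒰 : Filter ℕ) ≤ atTop := hle.trans inf_le_left
  obtain ⟨f, hf, hfB⟩ := exists_tendsto_setLIntegral (μ := μ) 𝒰 fun n => (hB n).1
  obtain ⟨c, hc⟩ := hAe.ae_eq_const hRm hR hsub hA.1 hf fun g =>
    ae_eq_smul_of_tendsto (W := {x | x ∈ A ∧ (x, g • x) ∈ R})
      (hA.1.inter (measurableSet_rel_smul hRm g)) hf hfB g
      (by simpa only [mem_ofPred_eq, and_assoc] using (hai g).mono_left h𝒰)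
  have hD : ∀ D, MeasurableSet D → D ⊆ A →
      Tendsto (fun n => μ (B n ∩ D)) 𝒰 (nhds (c * μ D)) := fun D hDm hDA => by
    have h1 := hfB D hDm
    rwa [setLIntegral_congr_fun_ae (g := fun _ => c) hDm
      (by filter_upwards [hc] with x hx h using hx (hDA h)), setLIntegral_const] at h1
  have hBA : Tendsto (fun n => μ (B n)) 𝒰 (nhds (c * μ A)) := by
    simpa only [inter_eq_self_of_subset_left (hB _).2] using hD A hA.1 Subset.rfl
  have hcA : c * μ A ≤ μ A := le_of_tendsto hBA (Eventually.of_forall fun n =>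
    measure_mono (hB n).2)
  have hcfin : c * μ A ≠ ⊤ := ne_top_of_le_ne_top (measure_ne_top _ _) hcA
  have hprod : Tendsto (fun n => μ (B n) * (μ A - μ (B n))) 𝒰
      (nhds (c * μ A * (μ A - c * μ A))) :=
    ENNReal.Tendsto.mul hBA (Or.inr (ne_top_of_le_ne_top (measure_ne_top _ _) tsub_le_self))
      (ENNReal.Tendsto.sub tendsto_const_nhds hBA (Or.inl (measure_ne_top _ _))) (Or.inr hcfin)
  have hnz : c * μ A * (μ A - c * μ A) ≠ 0 := fun h => by
    rw [h] at hprod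
    have h1 : ∀ᶠ n in (𝒰 : Filter ℕ), μ (B n) * (μ A - μ (B n)) ∉ V :=
      hle (mem_inf_of_right (mem_principal_self _))
    obtain ⟨n, hn, hn'⟩ := (h1.and (hprod hV)).exists
    exact hn hn'
  have hA0 : μ A ≠ 0 := fun h => hnz (by simp [h])
  have hc0 : c ≠ 0 := fun h => hnz (by simp [h])
  have hc1 : c < 1 := by
    by_contra h
    refine hnz ?_
    rw [tsub_eq_zero_of_le, mul_zero]
    exact le_mul_of_one_le_left zero_le (not_lt.1 h)
  have hct : c ≠ ⊤ := (hc1.trans ENNReal.one_lt_top).ne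
  refine ⟨B, 𝒰, c.toReal, inferInstance, ENNReal.toReal_pos hc0 hct, ?_, fun n => (hB n).1,
    fun D hDm hDA => ?_, fun s => (hai s).mono_left h𝒰⟩
  · simpa using (ENNReal.toReal_lt_toReal hct ENNReal.one_ne_top).2 hc1
  · have := (ENNReal.tendsto_toReal (ENNReal.mul_ne_top hct (measure_ne_top μ D))).comp
      (hD D hDm hDA)
    simpa [Measure.real, Function.comp_def] using this

end

section
variable {μ : Measure X} {Γ : Type*} [Group Γ] [MulAction Γ X]

/-- An almost invariant sequence of sets of nontrivial density splits the space into small almost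
invariant pieces. -/
lemma hasSmallPartitionsOn_of_density [IsProbabilityMeasure μ] {R : Set (X × X)} {A : Set X}
    (hA : IsInvariantSet R A)
    {B : ℕ → Set X} {l : Filter ℕ} [l.NeBot] {c : ℝ} (hc0 : 0 < c) (hc1 : c < 1)
    (hB : ∀ n, MeasurableSet (B n))
    (hD : ∀ D, MeasurableSet D → D ⊆ A →
        Tendsto (fun n => μ.real (B n ∩ D)) l (nhds (c * μ.real D)))
    (hs : ∀ s : Γ, Tendsto (fun n => μ.real {x | x ∈ A ∧ (x, s • x) ∈ R ∧
        ¬(x ∈ B n ↔ s • x ∈ B n)}) l (nhds 0)) : HasSmallPartitionsOn Γ μ R A := by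
  classical
  obtain ⟨θ, hθ, hθ1⟩ := exists_between (max_lt hc1 (show 1 - c < 1 by linarith))
  have hcθ : c < θ := (le_max_left _ _).trans_lt hθ
  have hcθ' : 1 - c < θ := (le_max_right _ _).trans_lt hθ
  have hθ0 : 0 < θ := hc0.trans hcθ
  intro S ε hε δ hδ
  obtain ⟨m, hm⟩ := exists_pow_lt_of_lt_one hε hθ1
  suffices H : ∀ m : ℕ, ∀ δ > 0, ∃ k : X → ℕ, Measurable k ∧ (∀ x, k x < 2 ^ m) ∧
      (∀ i, μ.real {x | x ∈ A ∧ k x = i} ≤ θ ^ m) ∧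
      ∀ s ∈ S, μ.real {x | x ∈ A ∧ (x, s • x) ∈ R ∧ k x ≠ k (s • x)} ≤ δ by
    obtain ⟨k, h1, h2, h3, h4⟩ := H m δ hδ
    exact ⟨2 ^ m, k, h1, h2, fun i => (h3 i).trans hm.le, h4⟩
  clear hm m hδ δ
  intro m
  induction m with
  | zero =>
    exact fun δ hδ => ⟨fun _ => 0, measurable_const, by simp, fun i => by simp,
      fun s _ => by simpa using hδ.le⟩
  | succ m ih =>
    intro δ hδ
    obtain ⟨k, hk, hkm, hki, hkS⟩ := ih (δ / 2) (by positivity)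
    have hDm : ∀ i, MeasurableSet {x | x ∈ A ∧ k x = i} := fun i =>
      hA.1.inter (measurableSet_eq_fun hk measurable_const)
    have hDA : ∀ i, {x | x ∈ A ∧ k x = i} ⊆ A := fun i x hx => hx.1
    have hmul : ∀ i, ∀ a < θ, 0 < a → a * μ.real {x | x ∈ A ∧ k x = i} < θ ^ (m + 1) :=
      fun i a ha ha0 => by
        rw [pow_succ']
        exact (mul_le_mul_of_nonneg_left (hki i) ha0.le).trans_lt
          (mul_lt_mul_of_pos_right ha (by positivity))
    have e1 : ∀ i, ∀ᶠ n in l, μ.real (B n ∩ {x | x ∈ A ∧ k x = i}) < θ ^ (m + 1) := fun i =>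
      (hD _ (hDm i) (hDA i)).eventually_lt_const (hmul i c hcθ hc0)
    have e2 : ∀ i, ∀ᶠ n in l, μ.real ({x | x ∈ A ∧ k x = i} \ B n) < θ ^ (m + 1) := fun i => by
      have h1 : ∀ n, μ.real ({x | x ∈ A ∧ k x = i} \ B n) =
          μ.real {x | x ∈ A ∧ k x = i} - μ.real (B n ∩ {x | x ∈ A ∧ k x = i}) := fun n => by
        rw [inter_comm, ← measureReal_inter_add_sdiff (s := {x | x ∈ A ∧ k x = i}) (hB n)]
        ring
      simp_rw [h1]
      refine ((hD _ (hDm i) (hDA i)).const_sub _).eventually_lt_const ?_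
      have := hmul i (1 - c) hcθ' (by linarith)
      linarith
    have e3 : ∀ᶠ n in l, ∀ s ∈ S, μ.real {x | x ∈ A ∧ (x, s • x) ∈ R ∧
        ¬(x ∈ B n ↔ s • x ∈ B n)} < δ / 2 :=
      (Finset.eventually_all S).2 fun s _ => (hs s).eventually_lt_const (by positivity)
    have e4 := (Finset.eventually_all (Finset.range (2 ^ m))).2 fun i _ => (e1 i).and (e2 i)
    obtain ⟨n, hn3, hn4⟩ := (e3.and e4).exists
    refine ⟨fun x => 2 * k x + if x ∈ B n then 1 else 0,
      (hk.const_mul 2).add (Measurable.ite (hB n) measurable_const measurable_const),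
      fun x => ?_, fun i => ?_, fun s hsS => ?_⟩
    · have := hkm x
      dsimp only
      split_ifs <;> omega
    · by_cases hi : i / 2 < 2 ^ m
      · have hi4 := hn4 (i / 2) (Finset.mem_range.2 hi)
        by_cases h2 : i % 2 = 0
        · refine (measureReal_mono ?_).trans hi4.2.le
          rintro x ⟨hxA, hx⟩
          dsimp only at hx
          split_ifs at hx with h
          · omega
          · exact ⟨⟨hxA, by omega⟩, h⟩
        · refine (measureReal_mono ?_).trans hi4.1.le
          rintro x ⟨hxA, hx⟩
          dsimp only at hx
          split_ifs at hx with h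
          · exact ⟨h, hxA, by omega⟩
          · omega
      · refine le_trans (le_of_eq ?_) (pow_nonneg hθ0.le (m + 1))
        convert measureReal_empty
        refine eq_empty_of_forall_notMem ?_
        rintro x ⟨-, hx⟩
        have := hkm x
        dsimp only at hx
        split_ifs at hx <;> omega
    · have h1 := hkS s hsS
      have h2 := (hn3 s hsS).le
      refine (measureReal_mono (s₂ := {x | x ∈ A ∧ (x, s • x) ∈ R ∧ k x ≠ k (s • x)} ∪
        {x | x ∈ A ∧ (x, s • x) ∈ R ∧ ¬(x ∈ B n ↔ s • x ∈ B n)}) ?_).trans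
        ((measureReal_union_le _ _).trans (by linarith))
      rintro x ⟨hxA, hxR, hx⟩
      by_cases h : k x = k (s • x)
      · refine Or.inr ⟨hxA, hxR, fun h' => hx ?_⟩
        simp only [h, h']
      · exact Or.inl ⟨hxA, hxR, h⟩

/-- Countably many sets from a given class can be chosen to cover every set in the class modulo
null sets. -/
lemma exists_seq_maximal_mod_null [IsFiniteMeasure μ] {Q : Set X → Prop}
    (hQ : ∀ A, Q A → MeasurableSet A) (h0 : Q ∅) :
    ∃ f : ℕ → Set X, (∀ n, Q (f n)) ∧ ∀ B, Q B → μ (B \ ⋃ n, f n) = 0 := by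
  obtain ⟨A, ⟨f, hf, rfl⟩, hA⟩ := exists_maximal_mod_null (μ := μ)
    (P := fun A => ∃ f : ℕ → Set X, (∀ n, Q (f n)) ∧ A = ⋃ n, f n)
    (by rintro _ ⟨f, hf, rfl⟩; exact .iUnion fun n => hQ _ (hf n))
    ⟨fun _ => ∅, fun _ => h0, by simp⟩ fun F hF => by
      choose f hf hU using hF
      refine ⟨fun n => f n.unpair.1 n.unpair.2, fun n => hf _ _, ?_⟩
      simp_rw [hU]
      exact (iUnion_unpair f).symm
  exact ⟨f, hf, fun B hB => hA B ⟨fun _ => B, fun _ => hB, (iUnion_const B).symm⟩⟩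

lemma exists_small_invariant [IsFiniteMeasure μ] {R : Set (X × X)} {Z : Set X}
    (hZe : ∀ W ⊆ Z, IsInvariantSet R W → μ W ≠ 0 → ¬ ErgodicOnRel μ R W) {W : Set X}
    (hW : IsInvariantSet R W) (hWZ : W ⊆ Z) (hW0 : μ W ≠ 0) {ε : ℝ} (hε : 0 < ε) :
    ∃ V ⊆ W, IsInvariantSet R V ∧ μ V ≠ 0 ∧ μ.real V ≤ ε := by
  have H : ∀ n : ℕ, ∃ V ⊆ W, IsInvariantSet R V ∧ μ V ≠ 0 ∧
      μ.real V ≤ (1 / 2) ^ n * μ.real W := by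
    intro n
    induction n with
    | zero => exact ⟨W, Subset.rfl, hW, hW0, by simp⟩
    | succ n ih =>
      obtain ⟨V, hVW, hV, hV0, hVn⟩ := ih
      have := hZe V (hVW.trans hWZ) hV hV0
      unfold ErgodicOnRel at this
      push Not at this
      obtain ⟨B, hBm, hBV, hBi, hB0, hB1⟩ := this
      have hB : IsInvariantSet R B := ⟨hBm, fun x y hxy => by
        by_cases hx : x ∈ V
        · exact hBi x y hx ((hV.2 x y hxy).1 hx) hxy
        · exact iff_of_false (fun h => hx (hBV h)) fun h => hx ((hV.2 x y hxy).2 (hBV h))⟩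
      have hadd : μ.real (V \ B) = μ.real V - μ.real B := measureReal_sdiff hBV hBm
      rw [pow_succ]
      by_cases hle : μ.real B ≤ μ.real V / 2
      · exact ⟨B, hBV.trans hVW, hB, hB0, by linarith⟩
      · exact ⟨V \ B, sdiff_subset.trans hVW, hV.sdiff hB, hB1, by linarith⟩
  obtain ⟨n, hn⟩ := exists_pow_lt_of_lt_one (show 0 < ε / (μ.real W + 1) by positivity)
    (show (1 / 2 : ℝ) < 1 by norm_num)
  obtain ⟨V, h1, h2, h3, h4⟩ := H n
  refine ⟨V, h1, h2, h3, h4.trans ?_⟩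
  rw [lt_div_iff₀ (by positivity)] at hn
  have : (0 : ℝ) < (1 / 2) ^ n := by positivity
  linarith

lemma hasSmallPartitionsOn_of_forall_not_ergodic [IsFiniteMeasure μ] {R : Set (X × X)} {Z : Set X}
    (hZ : IsInvariantSet R Z)
    (hZe : ∀ W ⊆ Z, IsInvariantSet R W → μ W ≠ 0 → ¬ ErgodicOnRel μ R W) :
    HasSmallPartitionsOn Γ μ R Z := by
  classical
  intro S ε hε δ hδ
  obtain ⟨f, hf, hmax⟩ := exists_seq_maximal_mod_null (μ := μ)
    (Q := fun V => IsInvariantSet R V ∧ V ⊆ Z ∧ μ.real V ≤ ε) (fun A h => h.1.1)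
    ⟨.empty, empty_subset _, by simpa using hε.le⟩
  have hcov : μ (Z \ ⋃ n, f n) = 0 := by
    by_contra h
    obtain ⟨V, hVW, hV, hV0, hVε⟩ := exists_small_invariant hZe
      (hZ.sdiff (IsInvariantSet.iUnion fun n => (hf n).1)) sdiff_subset h hε
    refine hV0 ?_
    have := hmax V ⟨hV, hVW.trans sdiff_subset, hVε⟩
    rwa [sdiff_eq_left.2 (disjoint_left.2 fun x hx => (hVW hx).2)] at this
  have hlim : Tendsto (fun N => μ.real (Z \ accumulate f N)) atTop (nhds 0) := by
    have h1 : Tendsto (fun N => μ (Z \ accumulate f N)) atTop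
        (nhds (μ (⋂ N, Z \ accumulate f N))) :=
      tendsto_measure_iInter_atTop (fun N => (hZ.1.diff
        (.biUnion (to_countable {j | j ≤ N}) fun n _ => (hf n).1.1)).nullMeasurableSet)
        (fun a b hab => sdiff_subset_sdiff_right (monotone_accumulate hab))
        ⟨0, measure_ne_top _ _⟩
    rw [← sdiff_iUnion, iUnion_accumulate, hcov] at h1
    simpa [Measure.real, Function.comp_def] using
      (ENNReal.tendsto_toReal ENNReal.zero_ne_top).comp h1
  obtain ⟨N, hN⟩ := (hlim.eventually_le_const hε).exists
  have hex : ∀ x, ∃ n, N < n ∨ x ∈ f n := fun x => ⟨N + 1, Or.inl (by omega)⟩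
  have hmem : ∀ x n, Nat.find (hex x) = n → N < n ∨ x ∈ f n :=
    fun x n h => h ▸ Nat.find_spec (hex x)
  refine ⟨N + 2, fun x => Nat.find (hex x), measurable_find hex fun n => ?_, fun x => ?_,
    fun i => ?_, fun s _ => ?_⟩
  · exact (MeasurableSet.const _).union (hf n).1.1
  · have := Nat.find_min' (hex x) (Or.inl (Nat.lt_succ_self N))
    dsimp only
    omega
  · by_cases hi : N < i
    · refine (measureReal_mono ?_).trans hN
      rintro x ⟨hxZ, hx⟩
      refine ⟨hxZ, fun h => ?_⟩
      obtain ⟨j, hj, hjx⟩ := mem_accumulate.1 h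
      have := Nat.find_min' (hex x) (Or.inr hjx)
      dsimp only at hx
      omega
    · refine (measureReal_mono ?_).trans (hf i).2.2
      rintro x ⟨-, hx⟩
      exact (hmem x i hx).resolve_left hi
  · refine le_trans (le_of_eq ?_) hδ.le
    convert measureReal_empty
    refine eq_empty_of_forall_notMem ?_
    rintro x ⟨-, hxR, hx⟩
    exact hx (Nat.find_congr' fun {n} => or_congr Iff.rfl ((hf n).1.2 _ _ hxR))

end

section
variable {Γ : Type*} [Group Γ] [Countable Γ]

attribute [local instance] bernoulliAction measurableConstSMul_bernoulli

lemma stronglyErgodicOnRel_or_hyperfiniteOn {μ : Measure (Γ → ℝ)} (hμ : IsBernoulliLebProduct μ)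
    {R : Set ((Γ → ℝ) × (Γ → ℝ))} (hRm : MeasurableSet R) (hR : IsEquivRelSet R)
    (hsub : ∀ q ∈ R, ∃ g : Γ, q.2 = g • q.1) {A : Set (Γ → ℝ)} (hA : IsInvariantSet R A)
    (hAe : ErgodicOnRel μ R A) : StronglyErgodicOnRel μ R A ∨ HyperfiniteOn μ R A := by
  have := smulInvariantMeasure_bernoulli hμ
  have := hμ.1
  refine or_iff_not_imp_left.2 fun hAs => ?_
  obtain ⟨B, l, c, hl, hc0, hc1, hB, hD, hs⟩ :=
    exists_ultrafilter_of_not_stronglyErgodic hRm hR hsub hA hAe hAs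
  exact hyperfiniteOn_of_hasSmallPartitionsOn hμ hRm hR hsub hA
    (hasSmallPartitionsOn_of_density hA hc0 hc1 hB hD hs)

end

/-- Chifan–Ioana dichotomy: every countable pmp subequivalence relation `R` of the orbit
equivalence relation of the Bernoulli shift `Γ ↷ ([0,1]^Γ, Leb^Γ)` of an infinite countable
group `Γ` admits a measurable partition `{X_n}` of the space into `R`-invariant subsets such
that `R|X_0` is hyperfinite and `R|X_n` is (ergodic and) strongly ergodic for every `n ≥ 1`
with `X_n` non-null. -/
theorem dichotomy_subequivalence_bernoulli (Γ : Type) [Group Γ] [Countable Γ] [Infinite Γ]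
    (μ : Measure (Γ → ℝ)) (hμ : IsBernoulliLebProduct μ)
    (R : Set ((Γ → ℝ) × (Γ → ℝ))) (hpmp : IsCountablePmpRel μ R)
    (hsub : R ⊆ {q | ∃ g : Γ, q.2 = bernoulliShift g q.1}) :
    ∃ Xn : ℕ → Set (Γ → ℝ),
      (∀ n, MeasurableSet (Xn n)) ∧
      Pairwise (fun m n => Disjoint (Xn m) (Xn n)) ∧
      (⋃ n, Xn n) = univ ∧
      (∀ n x y, (x, y) ∈ R → (x ∈ Xn n ↔ y ∈ Xn n)) ∧
      HyperfiniteOn μ R (Xn 0) ∧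
      (∀ n, 1 ≤ n → μ (Xn n) ≠ 0 →
        ErgodicOnRel μ R (Xn n) ∧ StronglyErgodicOnRel μ R (Xn n)) := by
  let _ : MulAction Γ (Γ → ℝ) := bernoulliAction
  have hmeas : MeasurableConstSMul Γ (Γ → ℝ) := measurableConstSMul_bernoulli
  have hprob := hμ.1
  obtain ⟨hR, hRm, -, -⟩ := hpmp
  replace hsub : ∀ q ∈ R, ∃ g : Γ, q.2 = g • q.1 := hsub
  obtain ⟨F, hF, hFmax⟩ := exists_seq_maximal_mod_null (μ := μ)
    (Q := fun A => IsInvariantSet R A ∧ HyperfiniteOn μ R A) (fun A h => h.1.1)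
    ⟨.empty, hyperfiniteOn_empty⟩
  obtain ⟨f, hf, hfmax⟩ := exists_seq_maximal_mod_null (μ := μ)
    (Q := fun A => IsInvariantSet R A ∧ ErgodicOnRel μ R A) (fun A h => h.1.1)
    ⟨.empty, fun B _ hB _ => Or.inl (measure_mono_null hB measure_empty)⟩
  set A₀ := ⋃ n, F n
  have hA₀ : IsInvariantSet R A₀ := .iUnion fun n => (hF n).1
  have hA₀h : HyperfiniteOn μ R A₀ := hyperfiniteOn_iUnion (fun n => (hF n).1) fun n => (hF n).2
  have hU : IsInvariantSet R (⋃ n, f n) := .iUnion fun n => (hf n).1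
  set Z := (A₀ ∪ ⋃ n, f n)ᶜ
  have hZ : IsInvariantSet R Z := (hA₀.union hU).compl
  have hnull : ∀ W, IsInvariantSet R W → HyperfiniteOn μ R W → Disjoint W A₀ → μ W = 0 :=
    fun W hW hWh hd => by
      have := hFmax W ⟨hW, hWh⟩
      rwa [hd.sdiff_eq_left] at this
  have hZ0 : μ Z = 0 := by
    refine hnull Z hZ ?_ (disjoint_compl_left.mono_right subset_union_left)
    refine hyperfiniteOn_of_hasSmallPartitionsOn hμ hRm hR hsub hZ
      (hasSmallPartitionsOn_of_forall_not_ergodic hZ fun W hWZ hW hW0 hWe => hW0 ?_)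
    have := hfmax W ⟨hW, hWe⟩
    rwa [(disjoint_compl_left.mono hWZ subset_union_right :
      Disjoint W (⋃ n, f n)).sdiff_eq_left] at this
  set D : ℕ → Set (Γ → ℝ) := fun n => disjointed f n \ A₀
  have hD : ∀ n, IsInvariantSet R (D n) := fun n =>
    (IsInvariantSet.disjointed (fun n => (hf n).1) n).sdiff hA₀
  have hDd : Pairwise fun m n => Disjoint (D m) (D n) := fun m n hmn =>
    (disjoint_disjointed f hmn).mono sdiff_subset sdiff_subset
  have hDU : IsInvariantSet R (⋃ n, D n)ᶜ := (IsInvariantSet.iUnion hD).compl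
  refine ⟨fun n => n.casesOn (⋃ n, D n)ᶜ D, ?_, ?_, ?_, ?_, ?_, ?_⟩
  · rintro (_ | n)
    exacts [hDU.1, (hD n).1]
  · rintro (_ | m) (_ | n) hmn
    · exact absurd rfl hmn
    · exact disjoint_compl_left.mono_right (subset_iUnion D n)
    · exact disjoint_compl_right.mono_left (subset_iUnion D m)
    · exact hDd fun h => hmn (congrArg _ h)
  · refine eq_univ_of_forall fun x => ?_
    by_cases hx : x ∈ ⋃ n, D n
    · obtain ⟨n, hn⟩ := mem_iUnion.1 hx
      exact mem_iUnion_of_mem (n + 1) hn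
    · exact mem_iUnion_of_mem 0 hx
  · rintro (_ | n)
    exacts [hDU.2, (hD n).2]
  · refine hA₀h.of_ae (fun x hx h => ?_) (measure_mono_null (t := Z) (fun x hx => ?_) hZ0)
    · obtain ⟨n, hn⟩ := mem_iUnion.1 h
      exact hn.2 hx
    · rintro (h | h)
      · exact hx.2 h
      · rw [← iUnion_disjointed] at h
        obtain ⟨n, hn⟩ := mem_iUnion.1 h
        exact hx.1 (mem_iUnion_of_mem n ⟨hn, hx.2⟩)
  · rintro (_ | n) hn hn0
    · omega
    have he : ErgodicOnRel μ R (D n) := (hf n).2.mono_invariant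
      (sdiff_subset.trans (disjointed_subset f n)) (hD n)
    refine ⟨he, (stronglyErgodicOnRel_or_hyperfiniteOn hμ hRm hR hsub (hD n) he).resolve_right
      fun h => hn0 (hnull _ (hD n) h disjoint_sdiff_left)⟩

end
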